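/- arXiv:2305.11765 — 11 statements merged into one kernel-verified Lean document; each statement's English description precedes it below -/
import Mathlib

section
/- There exists a universal constant λ ≥ 1 such that for every d ≥ 2, every isotropic log-concave probability distribution on ℝ^d is λ-nice. -/
open MeasureTheory
open scoped RealInnerProductSpace ENNReal

/-- A probability distribution `μ` on `ℝ^d` is `λ`-nice if:
(1) `E[⟨v,x⟩²] ∈ [1/λ, λ]` for every unit vector `v`;
(2) the pushforward of `μ` under the orthogonal projection onto any two-dimensional
subspace (identified with `ℝ²` via an orthonormal basis `u₁, u₂`) has a density `q`
with `q(x) ≥ 1/λ` whenever `‖x‖ ≤ 1/λ`; and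
(3) there is a function `Q : [0,∞) → [0,∞)` with `sup Q ≤ λ` and
`∫₀^∞ r^k Q(r) dr ≤ λ` for `k = 1, 3, 5`, such that `q(x) ≤ Q(‖x‖)` for all `x`
and all two-dimensional subspaces. -/
def IsNice {d : ℕ} (lam : ℝ) (μ : Measure (EuclideanSpace ℝ (Fin d))) : Prop :=
  (∀ v : EuclideanSpace ℝ (Fin d), ‖v‖ = 1 →
      (∫ x, ⟪v, x⟫ ^ 2 ∂μ) ∈ Set.Icc (1 / lam) lam) ∧
  ∃ Q : ℝ → ℝ, (∀ r, 0 ≤ Q r) ∧ (∀ r, Q r ≤ lam) ∧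
    (∀ k : ℕ, k = 1 ∨ k = 3 ∨ k = 5 →
      ∫⁻ r in Set.Ioi (0 : ℝ), ENNReal.ofReal (r ^ k * Q r) ≤ ENNReal.ofReal lam) ∧
    (∀ u₁ u₂ : EuclideanSpace ℝ (Fin d), ‖u₁‖ = 1 → ‖u₂‖ = 1 → ⟪u₁, u₂⟫ = 0 →
      ∃ q : EuclideanSpace ℝ (Fin 2) → ℝ, (∀ p, 0 ≤ q p) ∧
        Measure.map
            (fun x => (WithLp.equiv 2 (Fin 2 → ℝ)).symm ![⟪u₁, x⟫, ⟪u₂, x⟫]) μ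
          = volume.withDensity (fun p => ENNReal.ofReal (q p)) ∧
        (∀ p : EuclideanSpace ℝ (Fin 2), ‖p‖ ≤ 1 / lam → 1 / lam ≤ q p) ∧
        (∀ p : EuclideanSpace ℝ (Fin 2), q p ≤ Q ‖p‖))

theorem measure_eq_iSup_nonempty_isCompact {A : Set ℝ} (hA : MeasurableSet A) :
    volume A = ⨆ K : {K : Set ℝ // K ⊆ A ∧ IsCompact K ∧ K.Nonempty}, volume K.1 := by
  apply le_antisymm
  · refine le_of_forall_lt fun r hr => ?_
    obtain ⟨K, hKA, hK, hrK⟩ := hA.exists_lt_isCompact hr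
    have hKne : K.Nonempty := by
      rcases K.eq_empty_or_nonempty with h | h
      · simp [h] at hrK
      · exact h
    exact hrK.trans_le (le_iSup (fun K : {K : Set ℝ // K ⊆ A ∧ IsCompact K ∧ K.Nonempty} =>
      volume K.1) ⟨K, hKA, hK, hKne⟩)
  · exact iSup_le fun K => measure_mono K.2.1

open scoped Pointwise in
theorem volume_image_mul_add (t c : ℝ) (A : Set ℝ) :
    volume ((fun x => t * x + c) '' A) = ENNReal.ofReal |t| * volume A := by
  have h : (fun x => t * x + c) '' A = (fun x => x + c) '' (t • A) := by
    rw [← Set.image_smul, Set.image_image]; simp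
  rw [h, Set.image_add_right, measure_preimage_add_right, Measure.addHaar_smul]
  simp

/-- One-dimensional Brunn–Minkowski inequality for convex combinations of sets. -/
theorem volume_add_volume_le_of_combo {A B C : Set ℝ} (hA : MeasurableSet A)
    (hB : MeasurableSet B) (hAne : A.Nonempty) (hBne : B.Nonempty) {t : ℝ} (ht0 : 0 < t)
    (ht1 : t < 1) (h : ∀ x ∈ A, ∀ y ∈ B, t * x + (1 - t) * y ∈ C) :
    ENNReal.ofReal t * volume A + ENNReal.ofReal (1 - t) * volume B ≤ volume C := by
  have hs : 0 < 1 - t := by linarith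
  rw [measure_eq_iSup_nonempty_isCompact hA, measure_eq_iSup_nonempty_isCompact hB,
    ENNReal.mul_iSup, ENNReal.mul_iSup]
  obtain ⟨a₀, ha₀⟩ := hAne
  obtain ⟨b₀, hb₀⟩ := hBne
  have : Nonempty {K : Set ℝ // K ⊆ A ∧ IsCompact K ∧ K.Nonempty} :=
    ⟨⟨{a₀}, by simpa using ha₀, isCompact_singleton, by simp⟩⟩
  have : Nonempty {K : Set ℝ // K ⊆ B ∧ IsCompact K ∧ K.Nonempty} :=
    ⟨⟨{b₀}, by simpa using hb₀, isCompact_singleton, by simp⟩⟩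
  refine ENNReal.iSup_add_iSup_le ?_
  rintro ⟨K, hKA, hK, hKne⟩ ⟨L, hLB, hL, hLne⟩
  obtain ⟨a, haK, ha⟩ := hK.exists_isGreatest hKne
  obtain ⟨b, hbL, hb⟩ := hL.exists_isLeast hLne
  set p := t * a + (1 - t) * b with hp
  have e1 : ENNReal.ofReal t * volume K ≤ volume (C ∩ Set.Iio p) := by
    calc ENNReal.ofReal t * volume K
        = volume ((fun x => t * x + (1 - t) * b) '' K) := by
          rw [volume_image_mul_add, abs_of_pos ht0]
      _ = volume ((fun x => t * x + (1 - t) * b) '' K \ {p}) :=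
          (measure_sdiff_null (by simp)).symm
      _ ≤ _ := by
          apply measure_mono
          rintro _ ⟨⟨x, hx, rfl⟩, hne⟩
          refine ⟨h x (hKA hx) b (hLB hbL), lt_of_le_of_ne ?_ hne⟩
          have := mul_le_mul_of_nonneg_left (ha hx) ht0.le
          simp only [hp]; linarith
  have e2 : ENNReal.ofReal (1 - t) * volume L ≤ volume (C \ Set.Iio p) := by
    calc ENNReal.ofReal (1 - t) * volume L
        = volume ((fun x => (1 - t) * x + t * a) '' L) := by
          rw [volume_image_mul_add, abs_of_pos hs]
      _ ≤ _ := by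
          apply measure_mono
          rintro _ ⟨y, hy, rfl⟩
          have h1 := h a (hKA haK) y (hLB hy)
          refine ⟨by simpa [add_comm] using h1, ?_⟩
          have := mul_le_mul_of_nonneg_left (hb hy) hs.le
          simp only [hp, Set.mem_Iio, not_lt]; linarith
  calc _ ≤ volume (C ∩ Set.Iio p) + volume (C \ Set.Iio p) := add_le_add e1 e2
    _ = _ := measure_inter_add_sdiff _ measurableSet_Iio

theorem ENNReal.rpow_mul_rpow_le_add {a b : ℝ≥0∞} {t : ℝ} (ht0 : 0 < t) (ht1 : t < 1) :
    a ^ t * b ^ (1 - t) ≤ ENNReal.ofReal t * a + ENNReal.ofReal (1 - t) * b := by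
  have hs : 0 < 1 - t := by linarith
  have hpq : (t⁻¹).HolderConjugate (1 - t)⁻¹ :=
    Real.HolderConjugate.inv_one_sub_inv ht0 ht1
  have := ENNReal.young_inequality (a ^ t) (b ^ (1 - t)) hpq
  rw [← ENNReal.rpow_mul, ← ENNReal.rpow_mul, mul_inv_cancel₀ ht0.ne', mul_inv_cancel₀ hs.ne',
    ENNReal.rpow_one, ENNReal.rpow_one, ENNReal.ofReal_inv_of_pos ht0,
    ENNReal.ofReal_inv_of_pos hs, div_eq_mul_inv, div_eq_mul_inv, inv_inv, inv_inv] at this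
  simpa [mul_comm] using this

/-- The Prékopa–Leindler inequality on the line for functions with supremum one, in arithmetic
form. -/
theorem lintegral_add_lintegral_le_of_min_le {f g h : ℝ → ℝ} (hf : Measurable f)
    (hg : Measurable g) (hh : Measurable h) (hf0 : ∀ x, 0 ≤ f x) (hg0 : ∀ x, 0 ≤ g x)
    (hh0 : ∀ x, 0 ≤ h x) (hf1 : ∀ x, f x ≤ 1) (hg1 : ∀ x, g x ≤ 1)
    (hfs : ∀ a < 1, ∃ x, a < f x) (hgs : ∀ a < 1, ∃ x, a < g x) {t : ℝ} (ht0 : 0 < t)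
    (ht1 : t < 1) (hle : ∀ x y, min (f x) (g y) ≤ h (t * x + (1 - t) * y)) :
    ENNReal.ofReal t * (∫⁻ x, ENNReal.ofReal (f x)) +
      ENNReal.ofReal (1 - t) * (∫⁻ x, ENNReal.ofReal (g x)) ≤ ∫⁻ x, ENNReal.ofReal (h x) := by
  have hanti : ∀ k : ℝ → ℝ, Measurable fun a : ℝ => volume {x | a < k x} := fun k =>
    Antitone.measurable fun a b hab => measure_mono fun x (hx : b < k x) => hab.trans_lt hx
  rw [lintegral_eq_lintegral_meas_lt _ (ae_of_all _ hf0) hf.aemeasurable,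
    lintegral_eq_lintegral_meas_lt _ (ae_of_all _ hg0) hg.aemeasurable,
    lintegral_eq_lintegral_meas_lt _ (ae_of_all _ hh0) hh.aemeasurable,
    ← lintegral_const_mul _ (hanti f), ← lintegral_const_mul _ (hanti g),
    ← lintegral_add_left ((hanti f).const_mul _)]
  refine lintegral_mono fun a => ?_
  rcases lt_or_ge a 1 with ha | ha
  · exact volume_add_volume_le_of_combo (measurableSet_lt measurable_const hf)
      (measurableSet_lt measurable_const hg) (hfs a ha) (hgs a ha) ht0 ht1
      fun x hx y hy => (lt_min hx hy).trans_le (hle x y)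
  · have e : ∀ k : ℝ → ℝ, (∀ x, k x ≤ 1) → {x | a < k x} = ∅ := fun k hk =>
      Set.eq_empty_of_forall_notMem fun x hx => absurd (hx.trans_le (hk x)) (not_lt.2 ha)
    simp [e f hf1, e g hg1]

theorem prekopa_leindler_real_of_bounded {f g h : ℝ → ℝ≥0∞} (hf : Measurable f)
    (hg : Measurable g) (hh : Measurable h) (hfb : (⨆ x, f x) ≠ ∞) (hgb : (⨆ x, g x) ≠ ∞)
    {t : ℝ} (ht0 : 0 < t) (ht1 : t < 1)
    (hle : ∀ x y, f x ^ t * g y ^ (1 - t) ≤ h (t * x + (1 - t) * y)) :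
    (∫⁻ x, f x) ^ t * (∫⁻ x, g x) ^ (1 - t) ≤ ∫⁻ x, h x := by
  have hs : 0 < 1 - t := by linarith
  set M := ⨆ x, f x with hM
  set N := ⨆ x, g x with hN
  rcases eq_or_ne M 0 with hM0 | hM0
  · have : ∀ x, f x = 0 := by simpa [hM] using hM0
    simp [this, ht0]
  rcases eq_or_ne N 0 with hN0 | hN0
  · have : ∀ x, g x = 0 := by simpa [hN] using hN0
    simp [this, hs]
  set D := M ^ t * N ^ (1 - t) with hD
  have hMt : M ^ t ≠ ∞ := ENNReal.rpow_ne_top_of_nonneg ht0.le hfb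
  have hNt : N ^ (1 - t) ≠ ∞ := ENNReal.rpow_ne_top_of_nonneg hs.le hgb
  have hMt0 : M ^ t ≠ 0 := by simp [ENNReal.rpow_eq_zero_iff, hM0, hfb]
  have hNt0 : N ^ (1 - t) ≠ 0 := by simp [ENNReal.rpow_eq_zero_iff, hN0, hgb]
  have hDt : D ≠ ∞ := ENNReal.mul_ne_top hMt hNt
  have hD0 : D ≠ 0 := mul_ne_zero hMt0 hNt0
  have hdiv : ∀ a b : ℝ≥0∞, (a / M) ^ t * (b / N) ^ (1 - t) = a ^ t * b ^ (1 - t) / D := by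
    intro a b
    rw [ENNReal.div_rpow_of_nonneg _ _ ht0.le, ENNReal.div_rpow_of_nonneg _ _ hs.le,
      div_eq_mul_inv, div_eq_mul_inv, div_eq_mul_inv, hD,
      ENNReal.mul_inv (Or.inl hMt0) (Or.inl hMt)]
    ring
  have hf1 : ∀ x, f x / M ≤ 1 := fun x =>
    ENNReal.div_le_of_le_mul (by simpa using le_iSup f x)
  have hg1 : ∀ x, g x / N ≤ 1 := fun x =>
    ENNReal.div_le_of_le_mul (by simpa using le_iSup g x)
  have hft : ∀ x, f x / M ≠ ∞ := fun x => ((hf1 x).trans_lt ENNReal.one_lt_top).ne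
  have hgt : ∀ x, g x / N ≠ ∞ := fun x => ((hg1 x).trans_lt ENNReal.one_lt_top).ne
  have hht : ∀ x, min (h x / D) 1 ≠ ∞ := fun x =>
    ((min_le_right _ _).trans_lt ENNReal.one_lt_top).ne
  have hsup : ∀ k : ℝ → ℝ≥0∞, (⨆ x, k x) ≠ 0 → (⨆ x, k x) ≠ ∞ →
      (∀ x, k x / (⨆ x, k x) ≠ ∞) → ∀ a < (1 : ℝ), ∃ x, a < (k x / ⨆ x, k x).toReal := by
    intro k k0 kt kk a ha
    have h1 : ENNReal.ofReal a < ⨆ x, k x / ⨆ x, k x := by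
      rw [← ENNReal.iSup_div, ENNReal.div_self k0 kt]
      simpa using ha
    obtain ⟨x, hx⟩ := lt_iSup_iff.1 h1
    refine ⟨x, lt_of_not_ge fun hle => hx.not_ge ?_⟩
    rw [← ENNReal.ofReal_toReal (kk x)]
    exact ENNReal.ofReal_le_ofReal hle
  have key := lintegral_add_lintegral_le_of_min_le (f := fun x => (f x / M).toReal)
    (g := fun x => (g x / N).toReal) (h := fun x => (min (h x / D) 1).toReal)
    (hf.div_const M).ennreal_toReal (hg.div_const N).ennreal_toReal
    ((hh.div_const D).min measurable_const).ennreal_toReal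
    (fun _ => ENNReal.toReal_nonneg) (fun _ => ENNReal.toReal_nonneg)
    (fun _ => ENNReal.toReal_nonneg)
    (fun x => ENNReal.toReal_le_of_le_ofReal zero_le_one (by simpa using hf1 x))
    (fun x => ENNReal.toReal_le_of_le_ofReal zero_le_one (by simpa using hg1 x))
    (hsup f hM0 hfb hft) (hsup g hN0 hgb hgt) ht0 ht1 (by
      intro x y
      rw [← ENNReal.toReal_min (hft x) (hgt y)]
      refine ENNReal.toReal_mono (hht _) (le_min ?_ ((min_le_left _ _).trans (hf1 x)))
      set m := min (f x / M) (g y / N) with hm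
      have hmm : m = m ^ t * m ^ (1 - t) := by
        rw [← ENNReal.rpow_add_of_nonneg _ _ ht0.le hs.le]; simp
      calc m = m ^ t * m ^ (1 - t) := hmm
        _ ≤ (f x / M) ^ t * (g y / N) ^ (1 - t) :=
          mul_le_mul' (ENNReal.rpow_le_rpow (min_le_left _ _) ht0.le)
            (ENNReal.rpow_le_rpow (min_le_right _ _) hs.le)
        _ = f x ^ t * g y ^ (1 - t) / D := hdiv _ _
        _ ≤ _ := ENNReal.div_le_div_right (hle x y) D)
  simp only [ENNReal.ofReal_toReal (hft _), ENNReal.ofReal_toReal (hgt _),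
    ENNReal.ofReal_toReal (hht _)] at key
  have h2 : (∫⁻ x, f x) ^ t * (∫⁻ x, g x) ^ (1 - t) / D ≤ (∫⁻ x, h x) / D := by
    rw [← hdiv]
    refine (ENNReal.rpow_mul_rpow_le_add ht0 ht1).trans ?_
    have e : ∀ (k : ℝ → ℝ≥0∞) (c : ℝ≥0∞), Measurable k → (∫⁻ x, k x) / c = ∫⁻ x, k x / c := by
      intro k c hk
      simp only [div_eq_mul_inv]
      rw [lintegral_mul_const _ hk]
    rw [e f M hf, e g N hg, e h D hh]
    exact key.trans (lintegral_mono fun x => min_le_left _ _)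
  have h3 := mul_le_mul_left h2 D
  rwa [ENNReal.div_mul_cancel hD0 hDt, ENNReal.div_mul_cancel hD0 hDt] at h3

theorem lintegral_eq_iSup_lintegral_min {k : ℝ → ℝ≥0∞} (hk : Measurable k) :
    ∫⁻ x, k x = ⨆ n : ℕ, ∫⁻ x, min (k x) n := by
  rw [← lintegral_iSup (fun n => hk.min measurable_const)]
  · congr 1
    ext x
    rw [← inf_iSup_eq, ENNReal.iSup_natCast]
    simp
  · intro m n hmn x
    exact min_le_min_left _ (by exact_mod_cast hmn)

/-- The Prékopa–Leindler inequality on the real line. -/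
theorem prekopa_leindler_real {f g h : ℝ → ℝ≥0∞} (hf : Measurable f)
    (hg : Measurable g) (hh : Measurable h) {t : ℝ} (ht0 : 0 < t) (ht1 : t < 1)
    (hle : ∀ x y, f x ^ t * g y ^ (1 - t) ≤ h (t * x + (1 - t) * y)) :
    (∫⁻ x, f x) ^ t * (∫⁻ x, g x) ^ (1 - t) ≤ ∫⁻ x, h x := by
  have hs : 0 < 1 - t := by linarith
  have hpow : ∀ {r : ℝ} (hr : 0 < r) (a : ℕ → ℝ≥0∞), (⨆ n, a n) ^ r = ⨆ n, a n ^ r :=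
    fun hr a => (ENNReal.orderIsoRpow _ hr).map_iSup a
  rw [lintegral_eq_iSup_lintegral_min hf, lintegral_eq_iSup_lintegral_min hg, hpow ht0, hpow hs,
    ENNReal.iSup_mul]
  refine iSup_le fun n => ?_
  rw [ENNReal.mul_iSup]
  refine iSup_le fun m => ?_
  have hb : ∀ (k : ℝ → ℝ≥0∞) (n : ℕ), (⨆ x, min (k x) n) ≠ ∞ := fun k n =>
    ((iSup_le fun x => min_le_right _ _).trans_lt (ENNReal.natCast_lt_top n)).ne
  exact prekopa_leindler_real_of_bounded (hf.min measurable_const) (hg.min measurable_const) hh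
    (hb f n) (hb g m) ht0 ht1 fun x y =>
      (mul_le_mul' (ENNReal.rpow_le_rpow (min_le_left _ _) ht0.le)
        (ENNReal.rpow_le_rpow (min_le_left _ _) hs.le)).trans (hle x y)

/-- The Prékopa–Leindler inequality on `ℝⁿ`. -/
theorem prekopa_leindler_pi (n : ℕ) {f g h : (Fin n → ℝ) → ℝ≥0∞} (hf : Measurable f)
    (hg : Measurable g) (hh : Measurable h) {t : ℝ} (ht0 : 0 < t) (ht1 : t < 1)
    (hle : ∀ x y, f x ^ t * g y ^ (1 - t) ≤ h (t • x + (1 - t) • y)) :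
    (∫⁻ x, f x) ^ t * (∫⁻ x, g x) ^ (1 - t) ≤ ∫⁻ x, h x := by
  induction n with
  | zero =>
    rw [lintegral_unique, lintegral_unique, lintegral_unique]
    have hv : (volume : Measure (Fin 0 → ℝ)) Set.univ = 1 := by
      rw [volume_pi, Measure.pi_univ]; simp
    simp only [hv, mul_one]
    exact (hle _ _).trans_eq (congrArg h (Subsingleton.elim _ _))
  | succ n ih =>
    set e := (MeasurableEquiv.piFinSuccAbove (fun _ : Fin (n + 1) => ℝ) 0).symm with he
    have hmp : MeasurePreserving e volume volume :=
      (volume_preserving_piFinSuccAbove (fun _ : Fin (n + 1) => ℝ) 0).symm _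
    have hint : ∀ k : (Fin (n + 1) → ℝ) → ℝ≥0∞, Measurable k →
        ∫⁻ x, k x = ∫⁻ a : ℝ, ∫⁻ y : Fin n → ℝ, k (e (a, y)) := by
      intro k hk
      rw [← hmp.lintegral_comp hk]
      exact lintegral_prod _ (hk.comp e.measurable).aemeasurable
    have hm : ∀ k : (Fin (n + 1) → ℝ) → ℝ≥0∞, Measurable k →
        Measurable fun a : ℝ => ∫⁻ y : Fin n → ℝ, k (e (a, y)) := fun k hk =>
      (hk.comp e.measurable).lintegral_prod_right'
    have hs : ∀ k : (Fin (n + 1) → ℝ) → ℝ≥0∞, Measurable k → ∀ a : ℝ,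
        Measurable fun y : Fin n → ℝ => k (e (a, y)) := fun k hk a =>
      (hk.comp e.measurable).comp measurable_prodMk_left
    rw [hint f hf, hint g hg, hint h hh]
    refine prekopa_leindler_real (hm f hf) (hm g hg) (hm h hh) ht0 ht1 fun a b => ?_
    refine ih (hs f hf a) (hs g hg b) (hs h hh _) fun x y => ?_
    refine (hle _ _).trans_eq (congrArg h ?_)
    ext i
    refine Fin.cases ?_ (fun j => ?_) i <;> simp [he, MeasurableEquiv.piFinSuccAbove]

/-- The Prékopa–Leindler inequality on Euclidean space. -/
theorem prekopa_leindler_euclidean (n : ℕ) {f g h : EuclideanSpace ℝ (Fin n) → ℝ≥0∞}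
    (hf : Measurable f) (hg : Measurable g) (hh : Measurable h) {t : ℝ} (ht0 : 0 < t)
    (ht1 : t < 1) (hle : ∀ x y, f x ^ t * g y ^ (1 - t) ≤ h (t • x + (1 - t) • y)) :
    (∫⁻ x, f x) ^ t * (∫⁻ x, g x) ^ (1 - t) ≤ ∫⁻ x, h x := by
  have hmp := PiLp.volume_preserving_toLp (Fin n)
  rw [← hmp.lintegral_comp hf, ← hmp.lintegral_comp hg, ← hmp.lintegral_comp hh]
  exact prekopa_leindler_pi n (hf.comp hmp.measurable) (hg.comp hmp.measurable)
    (hh.comp hmp.measurable) ht0 ht1 fun x y => hle _ _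

/-- Log-concavity of an extended nonnegative function. -/
def LogConcave {E : Type*} [AddCommGroup E] [Module ℝ E] (F : E → ℝ≥0∞) : Prop :=
  ∀ x y : E, ∀ t : ℝ, 0 < t → t < 1 → F x ^ t * F y ^ (1 - t) ≤ F (t • x + (1 - t) • y)

theorem ENNReal.eq_rpow_mul_rpow_one_sub (a : ℝ≥0∞) {t : ℝ} (ht0 : 0 < t) (ht1 : t < 1) :
    a ^ t * a ^ (1 - t) = a := by
  rw [← ENNReal.rpow_add_of_nonneg _ _ ht0.le (by linarith)]; simp

theorem ENNReal.lt_rpow_mul_rpow {a b c : ℝ≥0∞} {t : ℝ} (ht0 : 0 < t) (ht1 : t < 1)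
    (hb : a < b) (hc : a < c) : a < b ^ t * c ^ (1 - t) := by
  have h0 : a < min b c := lt_min hb hc
  calc a < min b c := h0
    _ = (min b c) ^ t * (min b c) ^ (1 - t) :=
      (ENNReal.eq_rpow_mul_rpow_one_sub _ ht0 ht1).symm
    _ ≤ _ := mul_le_mul' (ENNReal.rpow_le_rpow (min_le_left _ _) ht0.le)
        (ENNReal.rpow_le_rpow (min_le_right _ _) (by linarith))

theorem LogConcave.convex_lt {E : Type*} [AddCommGroup E] [Module ℝ E] {F : E → ℝ≥0∞}
    (hF : LogConcave F) (a : ℝ≥0∞) : Convex ℝ {x | a < F x} := by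
  rw [convex_iff_forall_pos]
  intro x hx y hy s r hs hr hsr
  obtain rfl : r = 1 - s := by linarith
  exact (ENNReal.lt_rpow_mul_rpow hs (by linarith) hx hy).trans_le (hF x y s hs (by linarith))

/-- The lower semicontinuous regularization of an extended nonnegative function. -/
noncomputable def lscEnvelope {E : Type*} [TopologicalSpace E] (F : E → ℝ≥0∞) (x : E) : ℝ≥0∞ :=
  ⨆ a : {a : ℝ≥0∞ // x ∈ interior {y | a < F y}}, a.1

theorem lt_lscEnvelope_iff {E : Type*} [TopologicalSpace E] {F : E → ℝ≥0∞} {x : E} {a : ℝ≥0∞} :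
    a < lscEnvelope F x ↔ ∃ b, a < b ∧ x ∈ interior {y | b < F y} := by
  simp only [lscEnvelope, lt_iSup_iff, Subtype.exists]
  exact ⟨fun ⟨b, h1, h2⟩ => ⟨b, h2, h1⟩, fun ⟨b, h1, h2⟩ => ⟨b, h2, h1⟩⟩

theorem isOpen_lt_lscEnvelope {E : Type*} [TopologicalSpace E] (F : E → ℝ≥0∞) (a : ℝ≥0∞) :
    IsOpen {x | a < lscEnvelope F x} := by
  have : {x | a < lscEnvelope F x} = ⋃ b : {b // a < b}, interior {y | b.1 < F y} := by
    ext x; simp [lt_lscEnvelope_iff]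
  rw [this]
  exact isOpen_iUnion fun b => isOpen_interior

theorem measurable_lscEnvelope {E : Type*} [TopologicalSpace E] [MeasurableSpace E]
    [OpensMeasurableSpace E] (F : E → ℝ≥0∞) : Measurable (lscEnvelope F) :=
  measurable_of_Ioi fun a => (isOpen_lt_lscEnvelope F a).measurableSet

theorem lscEnvelope_le {E : Type*} [TopologicalSpace E] (F : E → ℝ≥0∞) (x : E) :
    lscEnvelope F x ≤ F x :=
  iSup_le fun a => (show x ∈ {y | a.1 < F y} from interior_subset a.2).le

section Regularization

variable {E : Type*} [NormedAddCommGroup E] [NormedSpace ℝ E]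

theorem logConcave_lscEnvelope {F : E → ℝ≥0∞} (hF : LogConcave F) :
    LogConcave (lscEnvelope F) := by
  intro x y t ht0 ht1
  have hs : 0 < 1 - t := by linarith
  have hpow : ∀ {r : ℝ} (hr : 0 < r) {ι : Type} (a : ι → ℝ≥0∞), (⨆ n, a n) ^ r = ⨆ n, a n ^ r :=
    fun hr _ a => (ENNReal.orderIsoRpow _ hr).map_iSup a
  conv_lhs => rw [lscEnvelope, lscEnvelope, hpow ht0, hpow hs, ENNReal.iSup_mul]
  refine iSup_le fun a => ?_
  rw [ENNReal.mul_iSup]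
  refine iSup_le fun b => ?_
  refine le_iSup (fun a : {a : ℝ≥0∞ // t • x + (1 - t) • y ∈ interior {y | a < F y}} => a.1)
    ⟨a.1 ^ t * b.1 ^ (1 - t), ?_⟩
  obtain ⟨U, hU, hUo, hxU⟩ := mem_interior.1 a.2
  have hyb : y ∈ {y | b.1 < F y} := interior_subset b.2
  refine mem_interior.2 ⟨(fun z => t⁻¹ • (z - (1 - t) • y)) ⁻¹' U, ?_, ?_, ?_⟩
  · intro z hz
    have hz' := hU hz
    have e : z = t • (t⁻¹ • (z - (1 - t) • y)) + (1 - t) • y := by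
      rw [smul_smul, mul_inv_cancel₀ ht0.ne']; simp
    show a.1 ^ t * b.1 ^ (1 - t) < F z
    rw [e]
    refine lt_of_lt_of_le ?_ (hF _ y t ht0 ht1)
    exact ENNReal.mul_lt_mul (ENNReal.rpow_lt_rpow hz' ht0) (ENNReal.rpow_lt_rpow hyb hs)
  · exact hUo.preimage (by fun_prop)
  · simpa [smul_smul, inv_mul_cancel₀ ht0.ne'] using hxU

theorem lscEnvelope_ae_eq [FiniteDimensional ℝ E] [MeasurableSpace E] [BorelSpace E]
    (μ : Measure E) [μ.IsAddHaarMeasure] {F : E → ℝ≥0∞} (hF : LogConcave F) :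
    lscEnvelope F =ᵐ[μ] F := by
  have h : ∀ a : ℚ, ∀ᵐ x ∂μ, x ∉ frontier {y | ENNReal.ofReal a < F y} := fun a =>
    measure_eq_zero_iff_ae_notMem.1 ((hF.convex_lt _).addHaar_frontier μ)
  filter_upwards [ae_all_iff.2 h] with x hx
  refine le_antisymm (lscEnvelope_le F x) (le_of_forall_lt fun a ha => ?_)
  obtain ⟨q, hq0, haq, hqF⟩ := ENNReal.lt_iff_exists_rat_btwn.1 ha
  refine lt_lscEnvelope_iff.2 ⟨_, haq, ?_⟩
  by_contra hcon
  exact hx q ⟨subset_closure hqF, hcon⟩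

end Regularization

theorem LogConcave.withDensity_rpow_mul_le {n : ℕ} {F : EuclideanSpace ℝ (Fin n) → ℝ≥0∞}
    (hF : LogConcave F) (hFm : Measurable F) {A B C : Set (EuclideanSpace ℝ (Fin n))}
    (hA : MeasurableSet A) (hB : MeasurableSet B) (hC : MeasurableSet C) {t : ℝ} (ht0 : 0 < t)
    (ht1 : t < 1) (h : ∀ x ∈ A, ∀ y ∈ B, t • x + (1 - t) • y ∈ C) :
    (volume.withDensity F A) ^ t * (volume.withDensity F B) ^ (1 - t) ≤
      volume.withDensity F C := by
  have hs : 0 < 1 - t := by linarith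
  rw [withDensity_apply _ hA, withDensity_apply _ hB, withDensity_apply _ hC,
    ← lintegral_indicator hA, ← lintegral_indicator hB, ← lintegral_indicator hC]
  refine prekopa_leindler_euclidean n (hFm.indicator hA) (hFm.indicator hB) (hFm.indicator hC)
    ht0 ht1 fun x y => ?_
  by_cases hx : x ∈ A
  · by_cases hy : y ∈ B
    · simpa [hx, hy, h x hx y hy] using hF x y t ht0 ht1
    · simp [hy, hs]
  · simp [hx, ht0]

/-- A real random variable whose upper tail function is log-concave. -/
def TailLogConcave {Ω : Type} [MeasurableSpace Ω] (μ : Measure Ω) (X : Ω → ℝ) : Prop :=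
  ∀ r s t : ℝ, 0 < t → t < 1 →
    μ {ω | r < X ω} ^ t * μ {ω | s < X ω} ^ (1 - t) ≤ μ {ω | t * r + (1 - t) * s < X ω}

/-- A centred random variable of variance one with log-concave upper and lower tails. -/
structure IsStandardLogConcave {Ω : Type} [MeasurableSpace Ω] (μ : Measure Ω) (X : Ω → ℝ) :
    Prop where
  measurable : Measurable X
  integrable_sq : Integrable (fun ω => X ω ^ 2) μ
  integral_eq : ∫ ω, X ω ∂μ = 0
  integral_sq_eq : ∫ ω, X ω ^ 2 ∂μ = 1
  tail : TailLogConcave μ X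
  tail_neg : TailLogConcave μ fun ω => -X ω

section Tail

variable {Ω : Type} [MeasurableSpace Ω] {μ : Measure Ω} {X : Ω → ℝ}

theorem IsStandardLogConcave.neg (hX : IsStandardLogConcave μ X) :
    IsStandardLogConcave μ fun ω => -X ω where
  measurable := hX.measurable.neg
  integrable_sq := by simpa using hX.integrable_sq
  integral_eq := by rw [integral_neg, hX.integral_eq, neg_zero]
  integral_sq_eq := by simpa using hX.integral_sq_eq
  tail := hX.tail_neg
  tail_neg := by simpa using hX.tail

theorem IsStandardLogConcave.measure_two_le_abs (hX : IsStandardLogConcave μ X) :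
    μ {ω | 2 ≤ |X ω|} ≤ ENNReal.ofReal (1 / 4) := by
  have h := mul_meas_ge_le_lintegral₀ (μ := μ)
    (f := fun ω => ENNReal.ofReal (X ω ^ 2)) (by
      exact (hX.measurable.pow_const 2).ennreal_ofReal.aemeasurable) (ENNReal.ofReal 4)
  rw [← ofReal_integral_eq_lintegral_ofReal hX.integrable_sq
    (ae_of_all _ fun ω => sq_nonneg _), hX.integral_sq_eq] at h
  have e : {ω | 2 ≤ |X ω|} ⊆ {ω | ENNReal.ofReal 4 ≤ ENNReal.ofReal (X ω ^ 2)} := by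
    intro ω (hω : 2 ≤ |X ω|)
    refine ENNReal.ofReal_le_ofReal ?_
    rw [← sq_abs]; nlinarith
  have h2 := (mul_le_mul_right (measure_mono e) (ENNReal.ofReal 4)).trans h
  rw [ENNReal.ofReal_div_of_pos (by norm_num), ENNReal.le_div_iff_mul_le (by simp) (by simp)]
  rwa [mul_comm]

theorem IsStandardLogConcave.measure_lt_le [IsProbabilityMeasure μ]
    (hX : IsStandardLogConcave μ X) (s : ℝ) :
    μ {ω | s < X ω} ≤ ENNReal.ofReal (Real.exp ((2 - s) / 4)) := by
  rcases le_or_gt s 2 with hs | hs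
  · refine prob_le_one.trans ?_
    rw [← ENNReal.ofReal_one]
    exact ENNReal.ofReal_le_ofReal (Real.one_le_exp (by linarith))
  by_contra! hcon
  set r := (s - 2) / 4 with hr
  have hr0 : 0 < r := by rw [hr]; linarith
  set t := r / (r + 1) with ht
  have ht0 : 0 < t := by positivity
  have ht1 : t < 1 := by rw [ht, div_lt_one (by linarith)]; linarith
  have ht2 : (1 - t) * r = t := by rw [ht]; field_simp; ring
  have key := hX.tail (-2) s t ht0 ht1
  have hmid : t * -2 + (1 - t) * s = 2 := by
    have : s = 4 * r + 2 := by rw [hr]; ring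
    rw [this]; linarith
  rw [hmid] at key
  have hhi : μ {ω | 2 < X ω} ≤ ENNReal.ofReal (1 / 4) :=
    (measure_mono fun ω (hω : 2 < X ω) => (hω.le.trans (le_abs_self _))).trans
      hX.measure_two_le_abs
  have hlo : ENNReal.ofReal (3 / 4) ≤ μ {ω | -2 < X ω} := by
    have h1 : μ {ω | -2 < X ω}ᶜ ≤ ENNReal.ofReal (1 / 4) := by
      refine (measure_mono fun ω hω => ?_).trans hX.measure_two_le_abs
      have hω' : X ω ≤ -2 := by simpa using hω
      show 2 ≤ |X ω|
      exact le_trans (by linarith) (neg_le_abs _)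
    have h2 := prob_compl_eq_one_sub (μ := μ) (measurableSet_lt measurable_const hX.measurable)
      (s := {ω | -2 < X ω})
    rw [h2, tsub_le_iff_right] at h1
    have h3 : ENNReal.ofReal (1 / 4) + ENNReal.ofReal (3 / 4) = 1 := by
      rw [← ENNReal.ofReal_add (by norm_num) (by norm_num)]; norm_num
    rw [← h3] at h1
    exact (ENNReal.add_le_add_iff_left ENNReal.ofReal_ne_top).1 h1
  have h4 : ENNReal.ofReal (3 / 4) ^ t * ENNReal.ofReal (Real.exp ((2 - s) / 4)) ^ (1 - t) ≤
      ENNReal.ofReal (1 / 4) :=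
    (mul_le_mul' (ENNReal.rpow_le_rpow hlo ht0.le)
      (ENNReal.rpow_le_rpow hcon.le (by linarith))).trans (key.trans hhi)
  rw [ENNReal.ofReal_rpow_of_nonneg (by norm_num) ht0.le,
    ENNReal.ofReal_rpow_of_nonneg (Real.exp_pos _).le (by linarith),
    ← ENNReal.ofReal_mul (by positivity), ENNReal.ofReal_le_ofReal_iff (by norm_num),
    ← Real.exp_mul] at h4
  have e1 : (2 - s) / 4 * (1 - t) = -1 * t := by
    have : (2 - s) / 4 = -r := by rw [hr]; ring
    rw [this]; linarith
  rw [e1, Real.exp_mul, ← Real.mul_rpow (by norm_num) (Real.exp_pos _).le] at h4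
  have h5 : 1 / 4 < 3 / 4 * Real.exp (-1) := by
    have h3 : Real.exp 1 < 3 := Real.exp_one_lt_d9.trans (by norm_num)
    rw [Real.exp_neg, ← div_eq_mul_inv, lt_div_iff₀ (Real.exp_pos 1)]
    linarith
  have h6 : 3 / 4 * Real.exp (-1) ≤ (3 / 4 * Real.exp (-1)) ^ t := by
    have hle : 3 / 4 * Real.exp (-1) ≤ 1 := by
      have : Real.exp (-1) ≤ 1 := Real.exp_le_one_iff.2 (by norm_num)
      linarith
    simpa using Real.rpow_le_rpow_of_exponent_ge (by positivity) hle ht1.le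
  linarith

theorem IsStandardLogConcave.measure_lt_abs_le [IsProbabilityMeasure μ]
    (hX : IsStandardLogConcave μ X) (s : ℝ) :
    μ {ω | s < |X ω|} ≤ ENNReal.ofReal (2 * Real.exp ((2 - s) / 4)) := by
  have e : {ω | s < |X ω|} = {ω | s < X ω} ∪ {ω | s < -X ω} := by
    ext ω; simp [lt_abs]
  rw [e, two_mul, ENNReal.ofReal_add (Real.exp_pos _).le (Real.exp_pos _).le]
  exact (measure_union_le _ _).trans (add_le_add (hX.measure_lt_le s) (hX.neg.measure_lt_le s))

end Tail

theorem lintegral_pow_mul_exp_lt_top (k : ℕ) {b : ℝ} (hb : 0 < b) :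
    ∫⁻ r in Set.Ioi (0 : ℝ), ENNReal.ofReal (r ^ k * Real.exp (-b * r)) < ∞ := by
  have h := integrableOn_rpow_mul_exp_neg_mul_rpow (s := k) (p := 1) (b := b)
    (by have : (0 : ℝ) ≤ k := k.cast_nonneg
        linarith) one_pos hb
  have h2 := h.lintegral_lt_top
  simpa using h2

theorem IsStandardLogConcave.exists_fourth_moment_le :
    ∃ C : ℝ, 1 ≤ C ∧ ∀ (Ω : Type) [MeasurableSpace Ω] (μ : Measure Ω) [IsProbabilityMeasure μ]
      (X : Ω → ℝ), IsStandardLogConcave μ X →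
        ∫⁻ ω, ENNReal.ofReal (X ω ^ 4) ∂μ ≤ ENNReal.ofReal C := by
  set I := ∫⁻ r in Set.Ioi (0 : ℝ), ENNReal.ofReal (r ^ 3 * Real.exp (-(1 / 4) * r)) with hI
  have hIt : I < ∞ := lintegral_pow_mul_exp_lt_top 3 (by norm_num)
  set J := ENNReal.ofReal 4 * (ENNReal.ofReal (2 * Real.exp (1 / 2)) * I) with hJ
  have hJt : J ≠ ∞ := ENNReal.mul_ne_top ENNReal.ofReal_ne_top
    (ENNReal.mul_ne_top ENNReal.ofReal_ne_top hIt.ne)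
  refine ⟨max 1 J.toReal, le_max_left _ _, fun Ω _ μ _ X hX => ?_⟩
  have hJle : J ≤ ENNReal.ofReal (max 1 J.toReal) := by
    conv_lhs => rw [← ENNReal.ofReal_toReal hJt]
    exact ENNReal.ofReal_le_ofReal (le_max_right _ _)
  refine le_trans ?_ hJle
  have h := lintegral_rpow_eq_lintegral_meas_lt_mul μ (f := fun ω => |X ω|)
    (ae_of_all _ fun ω => abs_nonneg _) (hX.measurable.abs.aemeasurable) (p := 4) (by norm_num)
  have e : ∀ ω, |X ω| ^ (4 : ℝ) = X ω ^ 4 := by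
    intro ω
    have : |X ω| ^ (4 : ℝ) = |X ω| ^ 4 := by exact_mod_cast Real.rpow_natCast |X ω| 4
    rw [this]; exact Even.pow_abs (by decide) _
  simp only [e] at h
  rw [h, hJ, hI, ← lintegral_const_mul (ENNReal.ofReal (2 * Real.exp (1 / 2))) (by fun_prop)]
  refine mul_le_mul_right ?_ _
  refine setLIntegral_mono (by fun_prop) fun r (hr : 0 < r) => ?_
  refine (mul_le_mul_left (hX.measure_lt_abs_le r) _).trans ?_
  rw [← ENNReal.ofReal_mul (by positivity), ← ENNReal.ofReal_mul (by positivity)]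
  apply ENNReal.ofReal_le_ofReal
  have e2 : r ^ ((4 : ℝ) - 1) = r ^ 3 := by
    rw [show (4 : ℝ) - 1 = ((3 : ℕ) : ℝ) by norm_num, Real.rpow_natCast]
  have e3 : Real.exp ((2 - r) / 4) = Real.exp (1 / 2) * Real.exp (-(1 / 4) * r) := by
    rw [← Real.exp_add]; congr 1; ring
  rw [e2, e3]
  apply le_of_eq; ring

theorem IsStandardLogConcave.exists_le_measure_lt :
    ∃ a p : ℝ, 0 < a ∧ 0 < p ∧ ∀ (Ω : Type) [MeasurableSpace Ω] (μ : Measure Ω)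
      [IsProbabilityMeasure μ] (X : Ω → ℝ), IsStandardLogConcave μ X →
        p ≤ μ.real {ω | a < X ω} := by
  obtain ⟨C, hC1, hC⟩ := IsStandardLogConcave.exists_fourth_moment_le
  set K := Real.sqrt (2 * C) with hK
  have hK2 : K ^ 2 = 2 * C := Real.sq_sqrt (by linarith)
  have hK0 : 0 < K := Real.sqrt_pos.2 (by linarith)
  refine ⟨1 / (16 * K), 1 / (128 * K ^ 2), by positivity, by positivity,
    fun Ω _ μ _ X hX => ?_⟩
  have hX2 := hX.integrable_sq
  have hX1 : Integrable X μ := by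
    have : MemLp X 2 μ := (memLp_two_iff_integrable_sq hX.measurable.aestronglyMeasurable).2 hX2
    exact this.integrable (by norm_num)
  have hX4 : Integrable (fun ω => X ω ^ 4) μ := by
    refine ⟨(hX.measurable.pow_const 4).aestronglyMeasurable, ?_⟩
    rw [hasFiniteIntegral_iff_ofReal (ae_of_all _ fun ω => by positivity)]
    exact (hC Ω μ X hX).trans_lt ENNReal.ofReal_lt_top
  have hC' : ∫ ω, X ω ^ 4 ∂μ ≤ C := by
    rw [integral_eq_lintegral_of_nonneg_ae (ae_of_all _ fun ω => by positivity)
      (hX.measurable.pow_const 4).aestronglyMeasurable]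
    exact ENNReal.toReal_le_of_le_ofReal (by linarith) (hC Ω μ X hX)
  have habs : 1 / (2 * K) ≤ ∫ ω, |X ω| ∂μ := by
    have h1 : ∫ ω, X ω ^ 2 ∂μ ≤ ∫ ω, (K * |X ω| + X ω ^ 4 / K ^ 2) ∂μ := by
      refine integral_mono hX2 ((hX1.abs.const_mul K).add (hX4.div_const _)) fun ω => ?_
      show X ω ^ 2 ≤ K * |X ω| + X ω ^ 4 / K ^ 2
      have e4 : X ω ^ 4 = |X ω| ^ 4 := (Even.pow_abs (by decide) _).symm
      rw [e4, ← sq_abs]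
      set x := |X ω|
      have hx : 0 ≤ x := abs_nonneg _
      rcases le_total x K with h | h
      · have : 0 ≤ x ^ 4 / K ^ 2 := by positivity
        nlinarith
      · have : x ^ 2 ≤ x ^ 4 / K ^ 2 := by
          rw [le_div_iff₀ (by positivity)]
          have : K ^ 2 ≤ x ^ 2 := by gcongr
          nlinarith [sq_nonneg x]
        have : 0 ≤ K * x := by positivity
        linarith
    rw [integral_add (hX1.abs.const_mul K) (hX4.div_const _), integral_const_mul,
      integral_div, hX.integral_sq_eq, hK2] at h1
    have h2 : (∫ ω, X ω ^ 4 ∂μ) / (2 * C) ≤ 1 / 2 := by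
      rw [div_le_iff₀ (by linarith)]; linarith
    rw [div_le_iff₀ (by positivity)]
    linarith
  have hpos : 1 / (4 * K) ≤ ∫ ω, max (X ω) 0 ∂μ := by
    have e : ∀ ω, max (X ω) 0 = (|X ω| + X ω) / 2 := by
      intro ω
      rcases le_total 0 (X ω) with h | h
      · rw [max_eq_left h, abs_of_nonneg h]; ring
      · rw [max_eq_right h, abs_of_nonpos h]; ring
    simp only [e]
    rw [integral_div, integral_add hX1.abs hX1, hX.integral_eq]
    have : 1 / (4 * K) = 1 / (2 * K) / 2 := by field_simp; norm_num
    linarith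
  set a := 1 / (16 * K) with ha
  set S := {ω | a < X ω} with hS
  have hSm : MeasurableSet S := measurableSet_lt measurable_const hX.measurable
  have hi : Integrable (S.indicator fun _ => 16 * K) μ := (integrable_const _).indicator hSm
  have hai : Integrable (fun ω => a + S.indicator (fun _ => 16 * K) ω) μ :=
    (integrable_const a).add hi
  have hup : ∫ ω, max (X ω) 0 ∂μ ≤
      ∫ ω, (a + S.indicator (fun _ => 16 * K) ω + X ω ^ 2 / (16 * K)) ∂μ := by
    refine integral_mono hX1.pos_part
      (hai.add (hX2.div_const _)) fun ω => ?_
    show max (X ω) 0 ≤ a + S.indicator (fun _ => 16 * K) ω + X ω ^ 2 / (16 * K)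
    have h0 : 0 ≤ X ω ^ 2 / (16 * K) := by positivity
    have ha0 : 0 < a := by positivity
    by_cases hω : ω ∈ S
    · have hω' : a < X ω := hω
      rw [Set.indicator_of_mem hω, max_eq_left (by linarith)]
      rcases le_total (X ω) (16 * K) with h | h
      · linarith
      · have : X ω ≤ X ω ^ 2 / (16 * K) := by
          rw [le_div_iff₀ (by positivity)]; nlinarith
        have : 0 < 16 * K := by positivity
        linarith
    · have hω' : X ω ≤ a := not_lt.1 hω
      rw [Set.indicator_of_notMem hω]
      have : max (X ω) 0 ≤ a := max_le hω' ha0.le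
      linarith
  rw [integral_add hai (hX2.div_const _), integral_add (integrable_const a) hi,
    integral_div (16 * K) (fun ω => X ω ^ 2), hX.integral_sq_eq, integral_indicator_const _ hSm] at hup
  simp only [integral_const, probReal_univ, smul_eq_mul, one_mul] at hup
  have e1 : 1 / (4 * K) = 4 * a := by rw [ha]; field_simp; norm_num
  have e2 : 1 / (128 * K ^ 2) = 2 * a / (16 * K) := by rw [ha]; field_simp; norm_num
  rw [e2, div_le_iff₀ (by positivity)]
  linarith

/-- The plane. -/
local notation "𝔼²" => EuclideanSpace ℝ (Fin 2)

theorem norm_le_abs_add_abs (x : 𝔼²) : ‖x‖ ≤ |x 0| + |x 1| := by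
  rw [EuclideanSpace.norm_eq, Fin.sum_univ_two, Real.sqrt_le_left (by positivity)]
  simp only [Real.norm_eq_abs]
  nlinarith [abs_nonneg (x 0), abs_nonneg (x 1)]

/-- A planar isotropic log-concave density puts values bounded below, at bounded distance from the
origin, in every direction. -/
theorem exists_lt_inner_of_isStandardLogConcave :
    ∃ a κ : ℝ, 0 < a ∧ 0 < κ ∧ ∀ G : 𝔼² → ℝ≥0∞,
      IsProbabilityMeasure (volume.withDensity G) →
      (∀ w : 𝔼², ‖w‖ = 1 → IsStandardLogConcave (volume.withDensity G) fun x => ⟪w, x⟫) →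
      ∀ v : 𝔼², ‖v‖ = 1 → ∃ x, a < ⟪v, x⟫ ∧ ENNReal.ofReal κ < G x := by
  obtain ⟨a, p, ha, hp, hap⟩ := IsStandardLogConcave.exists_le_measure_lt
  set R := 4 + 8 * (8 / p) with hR
  set V := volume.real (Metric.closedBall (0 : 𝔼²) R) with hV
  have hV0 : 0 ≤ V := measureReal_nonneg
  refine ⟨a, p / (4 * (V + 1)), ha, by positivity, fun G hprob hG v hv => ?_⟩
  set ν := volume.withDensity G with hν
  by_contra! hcon
  set S := {x : 𝔼² | a < ⟪v, x⟫} with hS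
  have hSm : MeasurableSet S := measurableSet_lt measurable_const (by fun_prop)
  have hball : MeasurableSet (Metric.closedBall (0 : 𝔼²) R) := Metric.isClosed_closedBall.measurableSet
  have h1 : p ≤ ν.real S := hap _ ν _ (hG v hv)
  have hexp : Real.exp ((2 - R / 2) / 4) ≤ p / 8 := by
    have e : (2 - R / 2) / 4 = -(8 / p) := by rw [hR]; ring
    rw [e, Real.exp_neg, inv_le_comm₀ (Real.exp_pos _) (by positivity), inv_div]
    have := Real.add_one_le_exp (8 / p)
    linarith
  have htail : ∀ i : Fin 2, ν {x | R / 2 < |x i|} ≤ ENNReal.ofReal (p / 4) := by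
    intro i
    have := (hG (EuclideanSpace.single i 1) (by simp)).measure_lt_abs_le (R / 2)
    simp only [EuclideanSpace.inner_single_left, map_one, one_mul] at this
    exact this.trans (ENNReal.ofReal_le_ofReal (by linarith))
  have hout : ν (Metric.closedBall (0 : 𝔼²) R)ᶜ ≤ ENNReal.ofReal (p / 2) := by
    have hsub : (Metric.closedBall (0 : 𝔼²) R)ᶜ ⊆
        {x | R / 2 < |x 0|} ∪ {x | R / 2 < |x 1|} := by
      intro x hx
      have hx' : R < ‖x‖ := by simpa using hx
      by_contra hc
      simp only [Set.mem_union, Set.mem_ofPred_eq, not_or, not_lt] at hc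
      have := norm_le_abs_add_abs x
      linarith
    refine ((measure_mono hsub).trans (measure_union_le _ _)).trans ?_
    refine (add_le_add (htail 0) (htail 1)).trans_eq ?_
    rw [← ENNReal.ofReal_add (by positivity) (by positivity)]
    congr 1; ring
  have hin : ν (S ∩ Metric.closedBall 0 R) ≤ ENNReal.ofReal (p / (4 * (V + 1)) * V) := by
    rw [hν, withDensity_apply _ (hSm.inter hball)]
    calc ∫⁻ x in S ∩ Metric.closedBall 0 R, G x
        ≤ ∫⁻ _ in S ∩ Metric.closedBall (0 : 𝔼²) R, ENNReal.ofReal (p / (4 * (V + 1))) :=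
          setLIntegral_mono measurable_const fun x hx => hcon x hx.1
      _ ≤ ENNReal.ofReal (p / (4 * (V + 1))) * volume (Metric.closedBall (0 : 𝔼²) R) := by
          rw [setLIntegral_const]
          gcongr
          exact Set.inter_subset_right
      _ = _ := by
          rw [ENNReal.ofReal_mul (by positivity), hV, Measure.real,
            ENNReal.ofReal_toReal measure_closedBall_lt_top.ne]
  have h2 : ν S ≤ ENNReal.ofReal (p / (4 * (V + 1)) * V) + ENNReal.ofReal (p / 2) := by
    refine le_trans (measure_mono (t := (S ∩ Metric.closedBall 0 R) ∪
      (Metric.closedBall (0 : 𝔼²) R)ᶜ) fun x hx => ?_) ((measure_union_le _ _).trans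
      (add_le_add hin hout))
    by_cases h : x ∈ Metric.closedBall (0 : 𝔼²) R
    · exact Or.inl ⟨hx, h⟩
    · exact Or.inr h
  rw [← ENNReal.ofReal_add (by positivity) (by positivity)] at h2
  have h3 : ν.real S ≤ p / (4 * (V + 1)) * V + p / 2 :=
    ENNReal.toReal_le_of_le_ofReal (by positivity) h2
  have h4 : p / (4 * (V + 1)) * V ≤ p / 4 := by
    rw [div_mul_eq_mul_div, div_le_div_iff₀ (by positivity) (by positivity)]
    nlinarith
  linarith

/-- A lower semicontinuous planar isotropic log-concave density is bounded below near the
origin. -/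
theorem exists_lt_of_norm_le_of_isStandardLogConcave :
    ∃ a κ : ℝ, 0 < a ∧ 0 < κ ∧ ∀ G : 𝔼² → ℝ≥0∞, LogConcave G → (∀ b, IsOpen {x | b < G x}) →
      IsProbabilityMeasure (volume.withDensity G) →
      (∀ w : 𝔼², ‖w‖ = 1 → IsStandardLogConcave (volume.withDensity G) fun x => ⟪w, x⟫) →
      ∀ x : 𝔼², ‖x‖ ≤ a → ENNReal.ofReal κ < G x := by
  obtain ⟨a, κ, ha, hκ, h⟩ := exists_lt_inner_of_isStandardLogConcave
  refine ⟨a, κ, ha, hκ, fun G hG hopen hprob hstd p hpa => ?_⟩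
  by_contra hp
  obtain ⟨f, hf⟩ := geometric_hahn_banach_open_point (hG.convex_lt _) (hopen (ENNReal.ofReal κ)) hp
  obtain ⟨w, rfl⟩ := (InnerProductSpace.toDual ℝ 𝔼²).surjective f
  simp only [InnerProductSpace.toDual_apply_apply] at hf
  have hw : w ≠ 0 := by
    rintro rfl
    obtain ⟨x, -, hx⟩ := h G hprob hstd (EuclideanSpace.single 0 1) (by simp)
    simpa using hf x hx
  have hw0 : 0 < ‖w‖ := norm_pos_iff.2 hw
  obtain ⟨x, hax, hx⟩ := h G hprob hstd (‖w‖⁻¹ • w) (norm_smul_inv_norm hw)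
  have h1 := hf x hx
  have h2 := real_inner_le_norm w p
  rw [real_inner_smul_left, lt_inv_mul_iff₀ hw0] at hax
  nlinarith

theorem exists_le_exp_of_isStandardLogConcave :
    ∃ a κ C : ℝ, 0 < a ∧ 0 < κ ∧ 0 < C ∧ ∀ G : 𝔼² → ℝ≥0∞, LogConcave G →
      (∀ b, IsOpen {x | b < G x}) → IsProbabilityMeasure (volume.withDensity G) →
      (∀ w : 𝔼², ‖w‖ = 1 → IsStandardLogConcave (volume.withDensity G) fun x => ⟪w, x⟫) →
      (∀ x : 𝔼², ‖x‖ ≤ a → ENNReal.ofReal κ < G x) ∧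
        ∀ x : 𝔼², G x ≤ ENNReal.ofReal (C * Real.exp (-(1 / 4) * ‖x‖)) := by
  obtain ⟨a, κ, ha, hκ, h⟩ := exists_lt_of_norm_le_of_isStandardLogConcave
  set V := volume.real (Metric.ball (0 : 𝔼²) (a / 2)) with hV
  have hV0 : 0 < V := ENNReal.toReal_pos (Metric.measure_ball_pos _ _ (by positivity)).ne'
    measure_ball_lt_top.ne
  set D := κ ^ (1 / 2 : ℝ) * V with hD
  have hD0 : 0 < D := by positivity
  refine ⟨a, κ, Real.exp ((2 + a) / 2) / D ^ 2, ha, hκ, by positivity,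
    fun G hG hopen hprob hstd => ⟨h G hG hopen hprob hstd, fun z => ?_⟩⟩
  have hlow := h G hG hopen hprob hstd
  set ν := volume.withDensity G with hν
  obtain ⟨v, hv, hvz⟩ : ∃ v : 𝔼², ‖v‖ = 1 ∧ ⟪v, z⟫ = ‖z‖ := by
    rcases eq_or_ne z 0 with rfl | hz
    · exact ⟨EuclideanSpace.single 0 1, by simp, by simp⟩
    · refine ⟨‖z‖⁻¹ • z, norm_smul_inv_norm hz, ?_⟩
      have : ‖z‖ ≠ 0 := norm_ne_zero_iff.2 hz
      rw [real_inner_smul_left, real_inner_self_eq_norm_sq]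
      field_simp
  set B := Metric.ball ((1 / 2 : ℝ) • z) (a / 2) with hB
  have hBV : volume B = ENNReal.ofReal V := by
    rw [hB, Measure.addHaar_ball_center, hV, Measure.real,
      ENNReal.ofReal_toReal measure_ball_lt_top.ne]
  have h1 : G z ^ (1 / 2 : ℝ) * ENNReal.ofReal D ≤ ν B := by
    rw [hν, withDensity_apply _ measurableSet_ball, hD, ENNReal.ofReal_mul (by positivity), ← hBV,
      ← mul_assoc, ← setLIntegral_const]
    refine setLIntegral_mono' measurableSet_ball fun y hy => ?_
    have hy' : ‖y - (1 / 2 : ℝ) • z‖ < a / 2 := by simpa [hB, dist_eq_norm] using hy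
    have hw : ‖(2 : ℝ) • y - z‖ ≤ a := by
      have e : (2 : ℝ) • y - z = (2 : ℝ) • (y - (1 / 2 : ℝ) • z) := by
        rw [smul_sub, smul_smul]; norm_num
      rw [e, norm_smul, Real.norm_ofNat]; linarith
    have h2 := hG z ((2 : ℝ) • y - z) (1 / 2) (by norm_num) (by norm_num)
    have e : (1 / 2 : ℝ) • z + (1 - 1 / 2 : ℝ) • ((2 : ℝ) • y - z) = y := by
      rw [smul_sub, smul_smul]; norm_num
    rw [e, show (1 - 1 / 2 : ℝ) = 1 / 2 by norm_num] at h2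
    refine le_trans ?_ h2
    rw [← ENNReal.ofReal_rpow_of_nonneg hκ.le (by norm_num)]
    gcongr
    exact (hlow _ hw).le
  have h3 : ν B ≤ ENNReal.ofReal (Real.exp ((2 - (‖z‖ / 2 - a)) / 4)) := by
    refine (measure_mono fun y hy => ?_).trans ((hstd v hv).measure_lt_le (‖z‖ / 2 - a))
    have hy' : ‖y - (1 / 2 : ℝ) • z‖ < a / 2 := by simpa [hB, dist_eq_norm] using hy
    have h4 := neg_le_of_abs_le (abs_real_inner_le_norm v (y - (1 / 2 : ℝ) • z))
    rw [inner_sub_right, real_inner_smul_right, hvz, hv] at h4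
    show ‖z‖ / 2 - a < ⟪v, y⟫
    linarith
  have h5 := h1.trans h3
  rw [← ENNReal.le_div_iff_mul_le (by left; simpa using hD0) (by simp),
    ← ENNReal.ofReal_div_of_pos hD0] at h5
  have h6 : G z = (G z ^ (1 / 2 : ℝ)) ^ 2 := by
    rw [← ENNReal.rpow_natCast, ← ENNReal.rpow_mul]; norm_num
  rw [h6]
  refine (pow_le_pow_left' h5 2).trans ?_
  rw [← ENNReal.ofReal_pow (by positivity)]
  apply ENNReal.ofReal_le_ofReal
  rw [div_pow, ← Real.exp_nat_mul, div_mul_eq_mul_div, ← Real.exp_add]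
  apply le_of_eq
  congr 2
  push_cast; ring

theorem IsStandardLogConcave.map {Ω Ω' : Type} [MeasurableSpace Ω] [MeasurableSpace Ω']
    {μ : Measure Ω} {φ : Ω → Ω'} (hφ : Measurable φ) {Y : Ω' → ℝ} (hY : Measurable Y)
    (h : IsStandardLogConcave μ fun ω => Y (φ ω)) : IsStandardLogConcave (μ.map φ) Y := by
  have hm : ∀ r, Measure.map φ μ {ω | r < Y ω} = μ {ω | r < Y (φ ω)} := fun r =>
    Measure.map_apply hφ (measurableSet_lt measurable_const hY)
  have hm' : ∀ r, Measure.map φ μ {ω | r < -Y ω} = μ {ω | r < -Y (φ ω)} := fun r =>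
    Measure.map_apply hφ (measurableSet_lt measurable_const hY.neg)
  refine ⟨hY, ?_, ?_, ?_, ?_, ?_⟩
  · exact (integrable_map_measure (hY.pow_const 2).aestronglyMeasurable hφ.aemeasurable).2
      h.integrable_sq
  · rw [integral_map hφ.aemeasurable hY.aestronglyMeasurable]; exact h.integral_eq
  · rw [integral_map hφ.aemeasurable (hY.pow_const 2).aestronglyMeasurable]
    exact h.integral_sq_eq
  · intro r s t ht0 ht1
    simpa only [hm] using h.tail r s t ht0 ht1
  · intro r s t ht0 ht1
    simpa only [hm'] using h.tail_neg r s t ht0 ht1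

theorem LogConcave.tailLogConcave_inner {n : ℕ} {F : EuclideanSpace ℝ (Fin n) → ℝ≥0∞}
    (hF : LogConcave F) (hFm : Measurable F) (v : EuclideanSpace ℝ (Fin n)) :
    TailLogConcave (volume.withDensity F) fun x => ⟪v, x⟫ := by
  have hms : ∀ r : ℝ, MeasurableSet {x : EuclideanSpace ℝ (Fin n) | r < ⟪v, x⟫} := fun r =>
    measurableSet_lt measurable_const (by fun_prop)
  intro r s t ht0 ht1
  refine hF.withDensity_rpow_mul_le hFm (hms r) (hms s) (hms _) ht0 ht1
    fun x (hx : r < ⟪v, x⟫) y (hy : s < ⟪v, y⟫) => ?_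
  show t * r + (1 - t) * s < ⟪v, t • x + (1 - t) • y⟫
  rw [inner_add_right, real_inner_smul_right, real_inner_smul_right]
  have : 0 < 1 - t := by linarith
  gcongr

section Isotropic

variable {d : ℕ} {μ : Measure (EuclideanSpace ℝ (Fin d))}

theorem integrable_coord_mul_coord_of_isotropic
    (hcov : ∀ i j : Fin d, (∫ x, x i * x j ∂μ) = if i = j then 1 else 0) (i j : Fin d) :
    Integrable (fun x => x i * x j) μ := by
  have hsq : ∀ i : Fin d, MemLp (fun x : EuclideanSpace ℝ (Fin d) => x i) 2 μ := by
    intro i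
    refine (memLp_two_iff_integrable_sq (Measurable.aestronglyMeasurable (by fun_prop))).2 ?_
    by_contra hcon
    have h := hcov i i
    simp only [← sq] at h
    rw [integral_undef hcon] at h
    simp at h
  exact (hsq i).integrable_mul (hsq j)

theorem inner_sq_eq_sum (v x : EuclideanSpace ℝ (Fin d)) :
    ⟪v, x⟫ ^ 2 = ∑ i, ∑ j, v i * v j * (x i * x j) := by
  rw [PiLp.inner_apply, sq, Finset.sum_mul_sum]
  refine Finset.sum_congr rfl fun i _ => Finset.sum_congr rfl fun j _ => ?_
  simp only [RCLike.inner_apply, conj_trivial]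
  ring

theorem integrable_inner_sq_of_isotropic
    (hcov : ∀ i j : Fin d, (∫ x, x i * x j ∂μ) = if i = j then 1 else 0)
    (v : EuclideanSpace ℝ (Fin d)) : Integrable (fun x => ⟪v, x⟫ ^ 2) μ := by
  simp only [inner_sq_eq_sum]
  exact integrable_finsetSum _ fun i _ => integrable_finsetSum _ fun j _ =>
    (integrable_coord_mul_coord_of_isotropic hcov i j).const_mul _

theorem integral_inner_sq_of_isotropic
    (hcov : ∀ i j : Fin d, (∫ x, x i * x j ∂μ) = if i = j then 1 else 0)
    {v : EuclideanSpace ℝ (Fin d)} (hv : ‖v‖ = 1) : ∫ x, ⟪v, x⟫ ^ 2 ∂μ = 1 := by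
  have hint := integrable_coord_mul_coord_of_isotropic hcov
  simp only [inner_sq_eq_sum]
  rw [integral_finsetSum _ fun i _ => integrable_finsetSum _ fun j _ =>
    (hint i j).const_mul _]
  have h : ∀ i, ∫ x : EuclideanSpace ℝ (Fin d), ∑ j, v i * v j * (x i * x j) ∂μ = v i ^ 2 := by
    intro i
    rw [integral_finsetSum _ fun j _ => (hint i j).const_mul _]
    simp only [integral_const_mul, hcov]
    simp [sq]
  simp only [h]
  rw [← EuclideanSpace.real_norm_sq_eq, hv, one_pow]

theorem integral_inner_of_isotropic [IsProbabilityMeasure μ] (hmean : (∫ x, x ∂μ) = 0)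
    (hcov : ∀ i j : Fin d, (∫ x, x i * x j ∂μ) = if i = j then 1 else 0)
    (v : EuclideanSpace ℝ (Fin d)) : ∫ x, ⟪v, x⟫ ∂μ = 0 := by
  have hid : Integrable (fun x : EuclideanSpace ℝ (Fin d) => x) μ := by
    have hsq : Integrable (fun x : EuclideanSpace ℝ (Fin d) => 1 + ∑ i, x i * x i) μ :=
      (integrable_const _).add (integrable_finsetSum _ fun i _ =>
        integrable_coord_mul_coord_of_isotropic hcov i i)
    refine hsq.mono' measurable_id.aestronglyMeasurable (ae_of_all _ fun x => ?_)
    have h := EuclideanSpace.real_norm_sq_eq x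
    simp only [sq] at h
    show ‖x‖ ≤ _
    rw [← h]
    nlinarith [sq_nonneg (‖x‖ - 1)]
  rw [integral_inner hid, hmean, inner_zero_right]

end Isotropic

theorem LogConcave.isStandardLogConcave_inner {d : ℕ} {F : EuclideanSpace ℝ (Fin d) → ℝ≥0∞}
    (hF : LogConcave F) (hFm : Measurable F) [IsProbabilityMeasure (volume.withDensity F)]
    (hmean : (∫ x, x ∂(volume.withDensity F)) = 0)
    (hcov : ∀ i j : Fin d, (∫ x, x i * x j ∂(volume.withDensity F)) = if i = j then 1 else 0)
    {v : EuclideanSpace ℝ (Fin d)} (hv : ‖v‖ = 1) :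
    IsStandardLogConcave (volume.withDensity F) fun x => ⟪v, x⟫ where
  measurable := by fun_prop
  integrable_sq := integrable_inner_sq_of_isotropic hcov v
  integral_eq := integral_inner_of_isotropic hmean hcov v
  integral_sq_eq := integral_inner_sq_of_isotropic hcov hv
  tail := hF.tailLogConcave_inner hFm v
  tail_neg := by simpa only [inner_neg_left] using hF.tailLogConcave_inner hFm (-v)

theorem measurable_planarProjection {d : ℕ} (u₁ u₂ : EuclideanSpace ℝ (Fin d)) :
    Measurable fun x : EuclideanSpace ℝ (Fin d) =>
      ((WithLp.equiv 2 (Fin 2 → ℝ)).symm ![⟪u₁, x⟫, ⟪u₂, x⟫] : 𝔼²) := by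
  refine (PiLp.volume_preserving_toLp (Fin 2)).measurable.comp (measurable_pi_iff.2 fun i => ?_)
  fin_cases i
  · show Measurable fun x => ⟪u₁, x⟫
    fun_prop
  · show Measurable fun x => ⟪u₂, x⟫
    fun_prop

/-- Two-dimensional marginals of log-concave densities have lower semicontinuous log-concave
densities. -/
theorem LogConcave.exists_marginal {d : ℕ} (hd : 2 ≤ d) {F : EuclideanSpace ℝ (Fin d) → ℝ≥0∞}
    (hF : LogConcave F) (hFm : Measurable F) {u₁ u₂ : EuclideanSpace ℝ (Fin d)}
    (h₁ : ‖u₁‖ = 1) (h₂ : ‖u₂‖ = 1) (h₁₂ : ⟪u₁, u₂⟫ = 0) :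
    ∃ G : 𝔼² → ℝ≥0∞, LogConcave G ∧ (∀ b, IsOpen {x | b < G x}) ∧
      Measure.map (fun x => (WithLp.equiv 2 (Fin 2 → ℝ)).symm ![⟪u₁, x⟫, ⟪u₂, x⟫])
        (volume.withDensity F) = volume.withDensity G := by
  obtain ⟨n, rfl⟩ : ∃ n, d = 2 + n := ⟨d - 2, by omega⟩
  have horth : Orthonormal ℝ (Set.domRestrict (Set.range Sum.inl)
      (Sum.elim ![u₁, u₂] (fun _ : Fin n => (0 : EuclideanSpace ℝ (Fin (2 + n)))))) := by
    constructor
    · rintro ⟨_, i, rfl⟩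
      fin_cases i
      · simpa using h₁
      · simpa using h₂
    · rintro ⟨_, i, rfl⟩ ⟨_, j, rfl⟩ hij
      fin_cases i <;> fin_cases j
      · simp at hij
      · simpa using h₁₂
      · simpa [real_inner_comm] using h₁₂
      · simp at hij
  obtain ⟨b, hb⟩ := horth.exists_orthonormalBasis_extension_of_card_eq (by simp)
  have hb1 : b (Sum.inl 0) = u₁ := hb _ ⟨0, rfl⟩
  have hb2 : b (Sum.inl 1) = u₂ := hb _ ⟨1, rfl⟩
  set π : EuclideanSpace ℝ (Fin (2 + n)) → 𝔼² :=
    fun x => (WithLp.equiv 2 (Fin 2 → ℝ)).symm ![⟪u₁, x⟫, ⟪u₂, x⟫] with hπ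
  have hπm : Measurable π := measurable_planarProjection u₁ u₂
  set Φ : 𝔼² × EuclideanSpace ℝ (Fin n) → EuclideanSpace ℝ (Fin (2 + n)) := fun z =>
    b.repr.symm (WithLp.toLp 2 (Sum.elim z.1 z.2)) with hΦ
  have hΦmp : MeasurePreserving Φ volume volume := by
    have e1 := (PiLp.volume_preserving_ofLp (Fin 2)).prod (PiLp.volume_preserving_ofLp (Fin n))
    have e2 := (volume_measurePreserving_sumPiEquivProdPi
      (fun _ : Fin 2 ⊕ Fin n => ℝ)).symm (MeasurableEquiv.sumPiEquivProdPi _)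
    have e3 := PiLp.volume_preserving_toLp (Fin 2 ⊕ Fin n)
    have e4 := b.measurePreserving_repr_symm
    exact e4.comp (e3.comp (e2.comp e1))
  have hπΦ : ∀ p y, π (Φ (p, y)) = p := by
    intro p y
    have e : ∀ i, ⟪b (Sum.inl i), Φ (p, y)⟫ = p i := by
      intro i
      rw [← b.repr_apply_apply]
      simp [hΦ]
    ext i
    fin_cases i
    · simpa [hπ, ← hb1] using e 0
    · simpa [hπ, ← hb2] using e 1
  set G₀ : 𝔼² → ℝ≥0∞ := fun p => ∫⁻ y, F (Φ (p, y)) with hG₀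
  have hFΦ : Measurable fun z => F (Φ z) := hFm.comp hΦmp.measurable
  have hG₀lc : LogConcave G₀ := by
    intro p q t ht0 ht1
    refine prekopa_leindler_euclidean n (hFΦ.comp measurable_prodMk_left)
      (hFΦ.comp measurable_prodMk_left) (hFΦ.comp measurable_prodMk_left) ht0 ht1 fun x y => ?_
    refine (hF _ _ t ht0 ht1).trans_eq (congrArg F ?_)
    simp only [hΦ]
    rw [← map_smul, ← map_smul, ← map_add]
    congr 1
    ext i
    rcases i with i | i <;> simp
  refine ⟨lscEnvelope G₀, logConcave_lscEnvelope hG₀lc, isOpen_lt_lscEnvelope G₀, ?_⟩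
  rw [withDensity_congr_ae (lscEnvelope_ae_eq volume hG₀lc)]
  refine Measure.ext fun (A : Set 𝔼²) hA => ?_
  have hm : Measurable fun z => (π ⁻¹' A).indicator F (Φ z) :=
    (hFm.indicator (hπm hA)).comp hΦmp.measurable
  rw [Measure.map_apply hπm hA, withDensity_apply _ (hπm hA), withDensity_apply _ hA,
    ← lintegral_indicator (hπm hA), ← lintegral_indicator hA,
    ← hΦmp.lintegral_comp (hFm.indicator (hπm hA)), Measure.volume_eq_prod,
    lintegral_prod (fun z => (π ⁻¹' A).indicator F (Φ z)) hm.aemeasurable]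
  refine lintegral_congr fun p => ?_
  by_cases hp : p ∈ A
  · simp [Set.indicator, hπΦ, hp, hG₀]
  · simp [Set.indicator, hπΦ, hp]

/-- There is a universal constant `λ ≥ 1` such that every isotropic log-concave
probability distribution on `ℝ^d` (`d ≥ 2`) is `λ`-nice. A measure is log-concave if
it has a density `f` (w.r.t. Lebesgue measure) with `f(tx+(1-t)y) ≥ f(x)^t f(y)^{1-t}`,
and isotropic if it has mean zero and identity covariance. -/
theorem isotropic_log_concave_is_nice :
    ∃ lam : ℝ, 1 ≤ lam ∧ ∀ d : ℕ, 2 ≤ d →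
      ∀ μ : Measure (EuclideanSpace ℝ (Fin d)), IsProbabilityMeasure μ →
        (∃ f : EuclideanSpace ℝ (Fin d) → ℝ, (∀ x, 0 ≤ f x) ∧
          μ = volume.withDensity (fun x => ENNReal.ofReal (f x)) ∧
          ∀ x y : EuclideanSpace ℝ (Fin d), ∀ t : ℝ, 0 ≤ t → t ≤ 1 →
            f x ^ t * f y ^ (1 - t) ≤ f (t • x + (1 - t) • y)) →
        (∫ x, x ∂μ) = 0 →
        (∀ i j : Fin d, (∫ x, x i * x j ∂μ) = if i = j then 1 else 0) →
        IsNice lam μ := by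
  obtain ⟨a, κ, C, ha, hκ, hC, hmain⟩ := exists_le_exp_of_isStandardLogConcave
  set Q : ℝ → ℝ := fun r => C * Real.exp (-(1 / 4) * |r|) with hQ
  set K : ℕ → ℝ := fun k => (∫⁻ r in Set.Ioi (0 : ℝ), ENNReal.ofReal (r ^ k * Q r)).toReal with hK
  have hKtop : ∀ k, ∫⁻ r in Set.Ioi (0 : ℝ), ENNReal.ofReal (r ^ k * Q r) ≠ ∞ := by
    intro k
    have e : ∫⁻ r in Set.Ioi (0 : ℝ), ENNReal.ofReal (r ^ k * Q r) =
        ∫⁻ r in Set.Ioi (0 : ℝ),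
          ENNReal.ofReal C * ENNReal.ofReal (r ^ k * Real.exp (-(1 / 4) * r)) := by
      refine setLIntegral_congr_fun measurableSet_Ioi fun r (hr : 0 < r) => ?_
      simp only [hQ]
      rw [← ENNReal.ofReal_mul hC.le, abs_of_pos hr]
      congr 1
      ring
    rw [e, lintegral_const_mul' _ _ ENNReal.ofReal_ne_top]
    exact ENNReal.mul_ne_top ENNReal.ofReal_ne_top
      (lintegral_pow_mul_exp_lt_top k (by norm_num)).ne
  have hK0 : ∀ k, 0 ≤ K k := fun k => ENNReal.toReal_nonneg
  have ha' : 0 < 1 / a := by positivity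
  have hκ' : 0 < 1 / κ := by positivity
  set lam : ℝ := 1 + 1 / a + 1 / κ + C + (K 1 + K 3 + K 5) with hlam
  have hlam1 : 1 ≤ lam := by linarith [hK0 1, hK0 3, hK0 5]
  have hlama : 1 / lam ≤ a := by
    rw [one_div_le (by linarith) ha]
    linarith [hK0 1, hK0 3, hK0 5]
  have hlamκ : 1 / lam ≤ κ := by
    rw [one_div_le (by linarith) hκ]
    linarith [hK0 1, hK0 3, hK0 5]
  refine ⟨lam, hlam1, ?_⟩
  rintro d hd μ hμ ⟨f, hf0, hμf, hf⟩ hmean hcov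
  refine ⟨fun v hv => ?_, Q, fun r => by positivity, fun r => ?_, fun k hk => ?_,
    fun u₁ u₂ h₁ h₂ h₁₂ => ?_⟩
  · rw [integral_inner_sq_of_isotropic hcov hv]
    exact ⟨(div_le_one (by linarith)).2 hlam1, hlam1⟩
  · have h : Real.exp (-(1 / 4) * |r|) ≤ 1 := Real.exp_le_one_iff.2 (by nlinarith [abs_nonneg r])
    have : Q r ≤ C := mul_le_of_le_one_right hC.le h
    linarith [hK0 1, hK0 3, hK0 5]
  · rw [← ENNReal.ofReal_toReal (hKtop k)]
    refine ENNReal.ofReal_le_ofReal ?_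
    change K k ≤ lam
    rcases hk with rfl | rfl | rfl <;> linarith [hK0 1, hK0 3, hK0 5]
  have hF₀ : LogConcave fun x => ENNReal.ofReal (f x) := by
    intro x y t ht0 ht1
    rw [ENNReal.ofReal_rpow_of_nonneg (hf0 x) ht0.le,
      ENNReal.ofReal_rpow_of_nonneg (hf0 y) (by linarith),
      ← ENNReal.ofReal_mul (Real.rpow_nonneg (hf0 x) _)]
    exact ENNReal.ofReal_le_ofReal (hf x y t ht0.le ht1.le)
  set F := lscEnvelope fun x => ENNReal.ofReal (f x)
  have hF : LogConcave F := logConcave_lscEnvelope hF₀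
  have hFm : Measurable F := measurable_lscEnvelope _
  have hμF : μ = volume.withDensity F :=
    hμf.trans (withDensity_congr_ae (lscEnvelope_ae_eq volume hF₀)).symm
  clear_value F
  subst hμF
  obtain ⟨G, hG, hGo, hGμ⟩ := hF.exists_marginal hd hFm h₁ h₂ h₁₂
  have hπm := measurable_planarProjection u₁ u₂
  have hGprob : IsProbabilityMeasure (volume.withDensity G) := by
    rw [← hGμ]
    exact Measure.isProbabilityMeasure_map hπm.aemeasurable
  obtain ⟨hGlow, hGup⟩ := hmain G hG hGo hGprob fun w hw => by
    rw [← hGμ]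
    refine IsStandardLogConcave.map hπm (by fun_prop) ?_
    have hw' : ‖w 0 • u₁ + w 1 • u₂‖ = 1 := by
      have e : ‖w 0 • u₁ + w 1 • u₂‖ ^ 2 = 1 := by
        rw [norm_add_sq_real, norm_smul, norm_smul, real_inner_smul_left, real_inner_smul_right,
          h₁, h₂, h₁₂]
        have := EuclideanSpace.real_norm_sq_eq w
        rw [hw, Fin.sum_univ_two] at this
        simp
        linarith
      nlinarith [norm_nonneg (w 0 • u₁ + w 1 • u₂)]
    have e : ∀ x : EuclideanSpace ℝ (Fin d),
        ⟪w, (WithLp.equiv 2 (Fin 2 → ℝ)).symm ![⟪u₁, x⟫, ⟪u₂, x⟫]⟫ =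
          ⟪w 0 • u₁ + w 1 • u₂, x⟫ := by
      intro x
      rw [PiLp.inner_apply, Fin.sum_univ_two, inner_add_left, real_inner_smul_left,
        real_inner_smul_left]
      simp [mul_comm]
    have hstd := hF.isStandardLogConcave_inner hFm hmean hcov hw'
    rw [← funext e] at hstd
    exact hstd
  have hGtop : ∀ p, G p ≠ ∞ := fun p => ne_top_of_le_ne_top ENNReal.ofReal_ne_top (hGup p)
  refine ⟨fun p => (G p).toReal, fun p => ENNReal.toReal_nonneg, ?_, fun p hp => ?_, fun p => ?_⟩
  · simpa only [ENNReal.ofReal_toReal (hGtop _)] using hGμ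
  · exact hlamκ.trans ((ENNReal.ofReal_le_iff_le_toReal (hGtop p)).1 (hGlow p (hp.trans hlama)).le)
  · refine ENNReal.toReal_le_of_le_ofReal (by positivity) ?_
    simpa only [hQ, abs_norm] using hGup p
end

section
/- There is a universal constant C > 0 with the following property. Let d ≥ 2, λ ≥ 1, let D be a λ-nice probability distribution on ℝ^d, let σ ≤ 1/(2λ), and let w be a unit vector. Then 2σ/λ² ≤ P_{x∼D}[|⟨w,x⟩| ≤ σ] ≤ C·λ·σ. -/
open MeasureTheory
open scoped RealInnerProductSpace ENNReal

/-- Tonelli's theorem in polar coordinates, integrating over the radius first. -/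
theorem lintegral_eq_lintegral_angle_radius {g : ℝ × ℝ → ℝ≥0∞} (hg : Measurable g) :
    ∫⁻ z, g z = ∫⁻ θ in Set.Ioo (-Real.pi) Real.pi, ∫⁻ r in Set.Ioi (0 : ℝ),
      ENNReal.ofReal r * g (r * Real.cos θ, r * Real.sin θ) := by
  rw [← lintegral_comp_polarCoord_symm]
  have htarget : polarCoord.target = Set.Ioi (0 : ℝ) ×ˢ Set.Ioo (-Real.pi) Real.pi := rfl
  rw [htarget, Measure.volume_eq_prod, ← Measure.prod_restrict, lintegral_prod_symm']
  · rfl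
  · simp only [smul_eq_mul, polarCoord_symm_apply]
    fun_prop

/-- Angles whose cosine is small lie close to `π / 2` or `-π / 2`. -/
theorem volume_abs_cos_le {s : ℝ} :
    volume {θ ∈ Set.Ioo (-Real.pi) Real.pi | |Real.cos θ| ≤ s}
      ≤ ENNReal.ofReal (2 * Real.pi * s) := by
  rcases lt_or_ge s 0 with hs | hs
  · have hempty : {θ ∈ Set.Ioo (-Real.pi) Real.pi | |Real.cos θ| ≤ s} = ∅ := by
      ext θ
      simpa using fun _ _ => hs.trans_le (abs_nonneg (Real.cos θ))
    exact (congrArg volume hempty).trans_le (by simp)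
  have hpi := Real.pi_pos
  have hsub : {θ ∈ Set.Ioo (-Real.pi) Real.pi | |Real.cos θ| ≤ s} ⊆
      Metric.closedBall (Real.pi / 2) (Real.pi / 2 * s) ∪
        Metric.closedBall (-(Real.pi / 2)) (Real.pi / 2 * s) := by
    rintro θ ⟨⟨h1, h2⟩, hc⟩
    have habs : |Real.pi / 2 - (|θ|)| ≤ Real.pi / 2 := by
      have := abs_nonneg θ
      have := abs_lt.2 ⟨h1, h2⟩
      rw [abs_le]
      constructor <;> linarith
    have hsin := Real.mul_abs_le_abs_sin habs
    rw [Real.sin_pi_div_two_sub, Real.cos_abs] at hsin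
    have hdist : |Real.pi / 2 - (|θ|)| ≤ Real.pi / 2 * s := by
      calc |Real.pi / 2 - (|θ|)| = Real.pi / 2 * (2 / Real.pi * |Real.pi / 2 - (|θ|)|) := by
            field_simp
        _ ≤ Real.pi / 2 * s := by
            gcongr
            exact hsin.trans hc
    rcases le_total 0 θ with hθ | hθ
    · left
      rwa [abs_of_nonneg hθ, abs_sub_comm] at hdist
    · right
      rw [abs_of_nonpos hθ] at hdist
      rw [Metric.mem_closedBall, Real.dist_eq]
      convert hdist using 2
      ring
  calc _ ≤ _ := measure_mono hsub
    _ ≤ _ := measure_union_le _ _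
    _ = _ := by
      rw [Real.volume_closedBall, Real.volume_closedBall,
        ← ENNReal.ofReal_add (by positivity) (by positivity)]
      congr 1
      ring

/-- If `F` is dominated by a bounded radial function with bounded first radial moment, its mass
in a strip is at most proportional to the width of the strip. The radial function need not be
measurable. -/
theorem setLIntegral_strip_le {lam σ : ℝ} (hlam : 0 ≤ lam) (hσ : 0 ≤ σ)
    {F : ℝ × ℝ → ℝ≥0∞} {Q : ℝ → ℝ} (hQ : ∀ r, Q r ≤ lam)
    (hmoment : ∫⁻ r in Set.Ioi (0 : ℝ), ENNReal.ofReal (r * Q r) ≤ ENNReal.ofReal lam)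
    (hF : ∀ z, F z ≤ ENNReal.ofReal (Q √(z.1 ^ 2 + z.2 ^ 2))) :
    ∫⁻ z in Set.Icc (-σ) σ ×ˢ Set.univ, F z
      ≤ ENNReal.ofReal ((4 + 2 * Real.pi) * lam * σ) := by
  have hstrip : MeasurableSet (Set.Icc (-σ) σ ×ˢ (Set.univ : Set ℝ)) :=
    measurableSet_Icc.prod .univ
  have hbox : MeasurableSet (Set.Icc (-σ) σ ×ˢ Set.Icc (-1 : ℝ) 1) :=
    measurableSet_Icc.prod measurableSet_Icc
  have hangle : MeasurableSet {θ : ℝ | |Real.cos θ| ≤ σ} :=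
    measurableSet_le (by fun_prop) measurable_const
  rw [← lintegral_indicator hstrip]
  obtain ⟨g, hg, hgF, hint⟩ := exists_measurable_le_lintegral_eq volume
    ((Set.Icc (-σ) σ ×ˢ (Set.univ : Set ℝ)).indicator F)
  rw [hint]
  have hg_le : ∀ z, g z ≤ ENNReal.ofReal (Q √(z.1 ^ 2 + z.2 ^ 2)) := fun z =>
    (hgF z).trans ((Set.indicator_le_self _ _ z).trans (hF z))
  have hg_zero : ∀ z, z ∉ Set.Icc (-σ) σ ×ˢ (Set.univ : Set ℝ) → g z = 0 := fun z hz => by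
    simpa [Set.indicator_of_notMem hz] using hgF z
  have hnear : ∫⁻ z in Set.Icc (-σ) σ ×ˢ Set.Icc (-1 : ℝ) 1, g z
      ≤ ENNReal.ofReal (4 * lam * σ) := by
    calc _ ≤ ∫⁻ _ in Set.Icc (-σ) σ ×ˢ Set.Icc (-1 : ℝ) 1, ENNReal.ofReal lam :=
          lintegral_mono fun z => (hg_le z).trans (ENNReal.ofReal_le_ofReal (hQ _))
      _ = _ := by
          rw [setLIntegral_const, Measure.volume_eq_prod, Measure.prod_prod, Real.volume_Icc,
            Real.volume_Icc, ← ENNReal.ofReal_mul (by linarith), ← ENNReal.ofReal_mul hlam]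
          congr 1
          ring
  have hfar : ∫⁻ z in (Set.Icc (-σ) σ ×ˢ Set.Icc (-1 : ℝ) 1)ᶜ, g z
      ≤ ENNReal.ofReal (2 * Real.pi * lam * σ) := by
    rw [← lintegral_indicator hbox.compl,
      lintegral_eq_lintegral_angle_radius (hg.indicator hbox.compl)]
    calc _ ≤ ∫⁻ θ in Set.Ioo (-Real.pi) Real.pi,
            {θ : ℝ | |Real.cos θ| ≤ σ}.indicator (fun _ => ENNReal.ofReal lam) θ := by
          refine lintegral_mono fun θ => ?_
          by_cases hθ : |Real.cos θ| ≤ σ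
          · rw [Set.indicator_of_mem (show θ ∈ {θ : ℝ | |Real.cos θ| ≤ σ} from hθ)]
            refine le_trans (setLIntegral_mono' measurableSet_Ioi fun r hr => ?_) hmoment
            rw [ENNReal.ofReal_mul (le_of_lt hr)]
            gcongr
            refine (Set.indicator_le_self _ _ _).trans ((hg_le _).trans_eq ?_)
            have hsq : (r * Real.cos θ) ^ 2 + (r * Real.sin θ) ^ 2 = r ^ 2 := by
              linear_combination r ^ 2 * Real.sin_sq_add_cos_sq θ
            simp only [hsq, Real.sqrt_sq (le_of_lt hr)]
          · rw [Set.indicator_of_notMem (show θ ∉ {θ : ℝ | |Real.cos θ| ≤ σ} from hθ)]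
            refine (setLIntegral_eq_zero measurableSet_Ioi fun r hr => ?_).le
            have hr0 : 0 < r := hr
            refine mul_eq_zero_of_right _ (Set.indicator_apply_eq_zero.2 fun hmem => ?_)
            refine hg_zero _ fun hz => hθ ?_
            have hx : |r * Real.cos θ| ≤ σ := abs_le.2 hz.1
            have hy : 1 < |r * Real.sin θ| := by
              by_contra! hy
              exact hmem ⟨hz.1, abs_le.1 hy⟩
            rw [abs_mul, abs_of_pos hr0] at hx hy
            have hr1 : 1 ≤ r := by nlinarith [Real.abs_sin_le_one θ]
            nlinarith [abs_nonneg (Real.cos θ)]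
      _ = ENNReal.ofReal lam *
            volume {θ ∈ Set.Ioo (-Real.pi) Real.pi | |Real.cos θ| ≤ σ} := by
          rw [lintegral_indicator_const hangle, Measure.restrict_apply hangle, Set.inter_comm]
          rfl
      _ ≤ ENNReal.ofReal lam * ENNReal.ofReal (2 * Real.pi * σ) := by
          gcongr
          exact volume_abs_cos_le
      _ = _ := by
          rw [← ENNReal.ofReal_mul hlam]
          congr 1
          ring
  rw [← lintegral_add_compl g hbox]
  refine (add_le_add hnear hfar).trans_eq ?_
  have := Real.pi_pos
  rw [← ENNReal.ofReal_add (by positivity) (by positivity)]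
  congr 1
  ring

/-- If `F ≥ 1 / lam` on the disc of radius `1 / lam`, its mass in a strip is at least proportional
to the width of the strip. -/
theorem le_setLIntegral_strip {lam σ : ℝ} (hlam : 0 < lam) (hσ : 0 ≤ σ)
    (hσ' : σ ≤ 1 / (2 * lam)) {F : ℝ × ℝ → ℝ≥0∞}
    (hF : ∀ z : ℝ × ℝ, √(z.1 ^ 2 + z.2 ^ 2) ≤ 1 / lam → ENNReal.ofReal (1 / lam) ≤ F z) :
    ENNReal.ofReal (2 * σ / lam ^ 2) ≤ ∫⁻ z in Set.Icc (-σ) σ ×ˢ Set.univ, F z := by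
  set h := 1 / (2 * lam) with hh
  have h0 : 0 ≤ h := by positivity
  have hh' : 1 / lam = 2 * h := by rw [hh]; field_simp
  calc ENNReal.ofReal (2 * σ / lam ^ 2)
      = ∫⁻ _ in Set.Icc (-σ) σ ×ˢ Set.Icc (-h) h, ENNReal.ofReal (1 / lam) := by
        rw [setLIntegral_const, Measure.volume_eq_prod, Measure.prod_prod, Real.volume_Icc,
          Real.volume_Icc, ← ENNReal.ofReal_mul (by linarith),
          ← ENNReal.ofReal_mul (by positivity)]
        congr 1
        rw [hh]
        field_simp
        ring
    _ ≤ ∫⁻ z in Set.Icc (-σ) σ ×ˢ Set.Icc (-h) h, F z := by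
        refine setLIntegral_mono' (measurableSet_Icc.prod measurableSet_Icc) fun z hz => hF z ?_
        rw [hh', Real.sqrt_le_left (by positivity)]
        obtain ⟨⟨h1, h2⟩, h3, h4⟩ := hz
        nlinarith
    _ ≤ _ := lintegral_mono_set (Set.prod_mono le_rfl (Set.subset_univ _))

/-- In dimension at least two, every vector is orthogonal to some unit vector. -/
theorem exists_norm_eq_one_inner_eq_zero {E : Type*} [NormedAddCommGroup E]
    [InnerProductSpace ℝ E] [FiniteDimensional ℝ E] (hE : 2 ≤ Module.finrank ℝ E) (w : E) :
    ∃ u : E, ‖u‖ = 1 ∧ ⟪w, u⟫ = 0 := by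
  have hsum := Submodule.finrank_add_finrank_orthogonal (ℝ ∙ w)
  have hspan : Module.finrank ℝ (ℝ ∙ w) ≤ 1 := by
    simpa using finrank_span_le_card (R := ℝ) ({w} : Set E)
  have : Nontrivial (ℝ ∙ w)ᗮ := Module.nontrivial_of_finrank_pos (R := ℝ) (by omega)
  obtain ⟨u, hu⟩ := exists_norm_eq (ℝ ∙ w)ᗮ zero_le_one
  exact ⟨u, hu, Submodule.mem_orthogonal_singleton_iff_inner_right.1 u.2⟩

/-- Strips have the mass computed from the density of a planar projection. -/
theorem measure_strip_eq_setLIntegral {E : Type*} [NormedAddCommGroup E] [InnerProductSpace ℝ E]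
    [MeasurableSpace E] [BorelSpace E] [SecondCountableTopology E] {μ : Measure E} {w u : E}
    {F : EuclideanSpace ℝ (Fin 2) → ℝ≥0∞}
    (hF : Measure.map (fun x => (WithLp.equiv 2 (Fin 2 → ℝ)).symm ![⟪w, x⟫, ⟪u, x⟫]) μ
      = volume.withDensity F) (σ : ℝ) :
    μ {x | |⟪w, x⟫| ≤ σ} = ∫⁻ z in Set.Icc (-σ) σ ×ˢ Set.univ, F !₂[z.1, z.2] := by
  let e : ℝ × ℝ ≃ᵐ EuclideanSpace ℝ (Fin 2) :=
    MeasurableEquiv.finTwoArrow.symm.trans (MeasurableEquiv.toLp 2 (Fin 2 → ℝ))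
  have he : MeasurePreserving e :=
    (PiLp.volume_preserving_toLp (Fin 2)).comp (volume_preserving_finTwoArrow ℝ).symm
  have he_apply : ∀ z : ℝ × ℝ, e z = !₂[z.1, z.2] := fun z => by
    ext i
    fin_cases i <;> rfl
  let s : Set (EuclideanSpace ℝ (Fin 2)) := {p | |p 0| ≤ σ}
  have hs : MeasurableSet s := measurableSet_le (by fun_prop) measurable_const
  have hproj : Measurable
      (fun x : E => (WithLp.equiv 2 (Fin 2 → ℝ)).symm ![⟪w, x⟫, ⟪u, x⟫]) := by
    refine (PiLp.volume_preserving_toLp (Fin 2)).measurable.comp (measurable_pi_iff.2 fun i => ?_)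
    fin_cases i
    · exact (continuous_const.inner continuous_id).measurable
    · exact (continuous_const.inner continuous_id).measurable
  have hpre : e ⁻¹' s = Set.Icc (-σ) σ ×ˢ Set.univ := by
    ext z
    simp [s, he_apply, abs_le]
  calc μ {x | |⟪w, x⟫| ≤ σ} = volume.withDensity F s := by
        rw [← hF, Measure.map_apply hproj hs]
        rfl
    _ = ∫⁻ p in s, F p := withDensity_apply F hs
    _ = ∫⁻ z in e ⁻¹' s, F (e z) :=
        (he.setLIntegral_comp_preimage_emb e.measurableEmbedding F s).symm
    _ = _ := by simp only [hpre, he_apply]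

/-- For a `λ`-nice distribution `D` on `ℝ^d`, a unit vector `w`, and a width
`0 < σ ≤ 1/(2λ)`, the probability of the strip `{x : |⟨w,x⟩| ≤ σ}` is between
`2σ/λ²` and `C·λ·σ` for a universal constant `C`. -/
theorem nice_strip_probability :
    ∃ C : ℝ, 0 < C ∧ ∀ d : ℕ, 2 ≤ d → ∀ lam : ℝ, 1 ≤ lam →
      ∀ μ : Measure (EuclideanSpace ℝ (Fin d)), IsProbabilityMeasure μ → IsNice lam μ →
        ∀ σ : ℝ, 0 < σ → σ ≤ 1 / (2 * lam) →
          ∀ w : EuclideanSpace ℝ (Fin d), ‖w‖ = 1 →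
            2 * σ / lam ^ 2 ≤ (μ {x | |⟪w, x⟫| ≤ σ}).toReal ∧
            (μ {x | |⟪w, x⟫| ≤ σ}).toReal ≤ C * lam * σ := by
  have hpi := Real.pi_pos
  refine ⟨4 + 2 * Real.pi, by positivity, ?_⟩
  intro d hd lam hlam μ hμ ⟨_, Q, _, hQ, hmoment, hdensity⟩ σ hσ hσ' w hw
  obtain ⟨u, hu, hwu⟩ := exists_norm_eq_one_inner_eq_zero (by simpa using hd) w
  obtain ⟨q, _, hmap, hlower, hupper⟩ := hdensity w u hw hu hwu
  have hlam0 : 0 < lam := by linarith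
  have hnorm : ∀ z : ℝ × ℝ, ‖!₂[z.1, z.2]‖ = √(z.1 ^ 2 + z.2 ^ 2) := fun z => by
    simp [EuclideanSpace.norm_eq]
  have hstrip := measure_strip_eq_setLIntegral hmap σ
  constructor
  · refine (ENNReal.ofReal_le_iff_le_toReal (measure_ne_top μ _)).1 ?_
    rw [hstrip]
    refine le_setLIntegral_strip hlam0 hσ.le hσ' fun z hz => ?_
    exact ENNReal.ofReal_le_ofReal (hlower _ ((hnorm z).trans_le hz))
  · refine ENNReal.toReal_le_of_le_ofReal (by positivity) ?_
    rw [hstrip]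
    refine setLIntegral_strip_le hlam0.le hσ.le hQ ?_ fun z => ?_
    · simpa using hmoment 1 (Or.inl rfl)
    · rw [← hnorm]
      exact ENNReal.ofReal_le_ofReal (hupper _)
end

section
/- There is a universal constant C > 0 with the following property. Let d ≥ 2, λ ≥ 1, let D be a λ-nice probability distribution on ℝ^d, let σ ≤ 1/(2λ), and let w, v be orthogonal unit vectors in ℝ^d. Then σ/(2λ⁴) ≤ E_{x∼D}[⟨v,x⟩² · 1{|⟨w,x⟩| ≤ σ}] ≤ C·λ·σ. -/
open MeasureTheory
open scoped RealInnerProductSpace ENNReal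

open Real

/-- On `(-π, π)`, the set where `|cos θ| ≤ s` has length at most `2πs`. -/
lemma volume_abs_cos_le_inter_Ioo_le {s : ℝ} (hs : 0 ≤ s) :
    volume ({θ : ℝ | |cos θ| ≤ s} ∩ Set.Ioo (-π) π) ≤ ENNReal.ofReal (2 * π * s) := by
  have hsub : {θ : ℝ | |cos θ| ≤ s} ∩ Set.Ioo (-π) π ⊆
      Set.Icc (π / 2 - π / 2 * s) (π / 2 + π / 2 * s) ∪
        Set.Icc (-(π / 2) - π / 2 * s) (-(π / 2) + π / 2 * s) := by
    rintro θ ⟨hθ, h1, h2⟩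
    have key : |(|θ| - π / 2)| ≤ π / 2 * s := by
      have hθ' : |θ| ≤ π := abs_le.2 ⟨h1.le, h2.le⟩
      have h := mul_abs_le_abs_sin (x := |θ| - π / 2)
        (abs_le.2 ⟨by linarith [abs_nonneg θ], by linarith⟩)
      rw [sin_sub_pi_div_two, abs_neg, cos_abs] at h
      have h3 := h.trans hθ
      rw [div_mul_eq_mul_div, div_le_iff₀ pi_pos] at h3
      linarith
    rw [abs_le] at key
    rcases abs_cases θ with ⟨h, _⟩ | ⟨h, _⟩
    · left; constructor <;> linarith [key.1, key.2]
    · right; constructor <;> linarith [key.1, key.2]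
  refine (measure_mono hsub).trans ((measure_union_le _ _).trans ?_)
  have hp : 0 ≤ π * s := by positivity
  rw [Real.volume_Icc, Real.volume_Icc, ← ENNReal.ofReal_add (by linarith) (by linarith)]
  exact ENNReal.ofReal_le_ofReal (by linarith)

/-- The second radial moment is controlled by the first and the third one. No measurability of
the integrand is needed. -/
lemma setLIntegral_sq_mul_le_add (Q : ℝ → ℝ) (hQ : ∀ r, 0 ≤ Q r) :
    ∫⁻ r in Set.Ioi (0 : ℝ), ENNReal.ofReal (r ^ 2 * Q r) ≤
      (∫⁻ r in Set.Ioi (0 : ℝ), ENNReal.ofReal (r ^ 1 * Q r)) +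
        ∫⁻ r in Set.Ioi (0 : ℝ), ENNReal.ofReal (r ^ 3 * Q r) := by
  rw [← Set.Ioc_union_Ioi_eq_Ioi zero_le_one, lintegral_union measurableSet_Ioi
    (Set.Ioc_disjoint_Ioi le_rfl), Set.Ioc_union_Ioi_eq_Ioi zero_le_one]
  gcongr ?_ + ?_
  · refine (setLIntegral_mono' measurableSet_Ioc fun r hr => ?_).trans
      (lintegral_mono_set Set.Ioc_subset_Ioi_self)
    exact ENNReal.ofReal_le_ofReal (mul_le_mul_of_nonneg_right
      (pow_le_pow_of_le_one hr.1.le hr.2 (by norm_num)) (hQ r))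
  · refine (setLIntegral_mono' measurableSet_Ioi fun r hr => ?_).trans
      (lintegral_mono_set (Set.Ioi_subset_Ioi zero_le_one))
    exact ENNReal.ofReal_le_ofReal (mul_le_mul_of_nonneg_right
      (pow_le_pow_right₀ (le_of_lt hr) (by norm_num)) (hQ r))

/-- The identification of `ℝ × ℝ` with the Euclidean plane preserves Lebesgue measure. -/
lemma measurePreserving_prod_euclideanSpace_two :
    MeasurePreserving (fun z : ℝ × ℝ => (!₂[z.1, z.2] : EuclideanSpace ℝ (Fin 2))) :=
  (PiLp.volume_preserving_toLp (Fin 2)).comp (volume_preserving_finTwoArrow ℝ).symm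

lemma norm_polar_euclideanSpace_two {r : ℝ} (hr : 0 ≤ r) (θ : ℝ) :
    ‖(!₂[r * cos θ, r * sin θ] : EuclideanSpace ℝ (Fin 2))‖ = r := by
  rw [EuclideanSpace.norm_eq, Real.sqrt_eq_iff_mul_self_eq (by positivity) hr]
  simp only [Fin.sum_univ_two, norm_eq_abs, sq_abs]
  simp only [Matrix.cons_val_zero, Matrix.cons_val_one]
  linear_combination r ^ 2 * sin_sq_add_cos_sq θ

lemma measurableSet_strip (σ : ℝ) :
    MeasurableSet {p : EuclideanSpace ℝ (Fin 2) | |p 0| ≤ σ} :=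
  measurableSet_le (by fun_prop) measurable_const

/-- If a planar density is dominated by a radial function `Q`, its second moment over a strip of
half-width `σ` is at most `2πσ` times the second radial moment of `Q`. -/
lemma setLIntegral_strip_withDensity_le {σ : ℝ} (hσ : 0 ≤ σ) {Q : ℝ → ℝ} (hQ : ∀ r, 0 ≤ Q r)
    {q : EuclideanSpace ℝ (Fin 2) → ℝ} (hq : ∀ p, q p ≤ Q ‖p‖) :
    ∫⁻ p in {p | |p 0| ≤ σ}, ENNReal.ofReal (p 1 ^ 2)
        ∂(volume.withDensity fun p => ENNReal.ofReal (q p)) ≤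
      ENNReal.ofReal (2 * π * σ) * ∫⁻ r in Set.Ioi (0 : ℝ), ENNReal.ofReal (r ^ 2 * Q r) := by
  obtain ⟨g, hgm, hgq, hg⟩ := exists_measurable_le_withDensity_eq
    (μ := (volume : Measure (EuclideanSpace ℝ (Fin 2)))) fun p => ENNReal.ofReal (q p)
  have hm : Measurable fun p : EuclideanSpace ℝ (Fin 2) => ENNReal.ofReal (p 1 ^ 2) := by fun_prop
  set F : EuclideanSpace ℝ (Fin 2) → ℝ≥0∞ :=
    {p | |p 0| ≤ σ}.indicator (g * fun p => ENNReal.ofReal (p 1 ^ 2)) with hF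
  have hFm : Measurable F := (hgm.mul hm).indicator (measurableSet_strip σ)
  rw [← hg, setLIntegral_withDensity_eq_setLIntegral_mul _ hgm hm (measurableSet_strip σ),
    ← lintegral_indicator (measurableSet_strip σ), ← hF,
    ← measurePreserving_prod_euclideanSpace_two.lintegral_comp hFm,
    ← lintegral_comp_polarCoord_symm]
  have hpt : ∀ p ∈ polarCoord.target,
      ENNReal.ofReal p.1 • F !₂[(polarCoord.symm p).1, (polarCoord.symm p).2] ≤
        ENNReal.ofReal (p.1 ^ 3 * Q p.1) * {θ | |cos θ| ≤ σ / p.1}.indicator 1 p.2 := by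
    rintro ⟨r, θ⟩ ⟨hr, -⟩
    replace hr : 0 < r := hr
    change ENNReal.ofReal r • F !₂[r * cos θ, r * sin θ] ≤
      ENNReal.ofReal (r ^ 3 * Q r) * {θ | |cos θ| ≤ σ / r}.indicator 1 θ
    by_cases hmem : |cos θ| ≤ σ / r
    · rw [Set.indicator_of_mem (show θ ∈ {θ | |cos θ| ≤ σ / r} from hmem)]
      have hFle : F !₂[r * cos θ, r * sin θ] ≤ ENNReal.ofReal (Q r * r ^ 2) := by
        refine (Set.indicator_le_self _ _ _).trans ?_
        rw [ENNReal.ofReal_mul (hQ r)]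
        refine mul_le_mul' ((hgq _).trans (ENNReal.ofReal_le_ofReal ?_))
          (ENNReal.ofReal_le_ofReal ?_)
        · simpa only [norm_polar_euclideanSpace_two hr.le] using hq !₂[r * cos θ, r * sin θ]
        · change (r * sin θ) ^ 2 ≤ r ^ 2
          nlinarith [sin_sq_le_one θ, sq_nonneg r]
      calc ENNReal.ofReal r • F !₂[r * cos θ, r * sin θ]
          ≤ ENNReal.ofReal r * ENNReal.ofReal (Q r * r ^ 2) := by
            rw [smul_eq_mul]; gcongr
        _ = ENNReal.ofReal (r ^ 3 * Q r) * (1 : ℝ → ℝ≥0∞) θ := by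
            rw [← ENNReal.ofReal_mul hr.le, Pi.one_apply, mul_one]; congr 1; ring
    · have hnot : (!₂[r * cos θ, r * sin θ] : EuclideanSpace ℝ (Fin 2)) ∉ {p | |p 0| ≤ σ} := by
        change ¬ |r * cos θ| ≤ σ
        rw [abs_mul, abs_of_pos hr]
        rwa [le_div_iff₀ hr, mul_comm] at hmem
      rw [hF, Set.indicator_of_notMem hnot, smul_zero]
      exact zero_le
  have hpm : MeasurableSet polarCoord.target := polarCoord.open_target.measurableSet
  refine (setLIntegral_mono' hpm hpt).trans ?_
  rw [polarCoord_target, Measure.volume_eq_prod, ← Measure.prod_restrict]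
  refine (lintegral_prod_le _).trans ?_
  rw [← lintegral_const_mul' _ _ ENNReal.ofReal_ne_top]
  refine setLIntegral_mono' measurableSet_Ioi fun r hr => ?_
  replace hr : 0 < r := hr
  have hcos : MeasurableSet {θ : ℝ | |cos θ| ≤ σ / r} :=
    measurableSet_le (by fun_prop) measurable_const
  dsimp only
  rw [lintegral_const_mul' _ _ ENNReal.ofReal_ne_top, lintegral_indicator_one hcos,
    Measure.restrict_apply hcos]
  refine (mul_le_mul_right (volume_abs_cos_le_inter_Ioo_le (by positivity)) _).trans_eq ?_
  rw [← ENNReal.ofReal_mul (mul_nonneg (by positivity) (hQ r)),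
    ← ENNReal.ofReal_mul (by positivity)]
  congr 1
  field_simp

/-- The second moment over a strip of half-width `σ` of a planar density that is at least `c` on
the ball of radius `ρ ≥ 2σ`. -/
lemma le_setLIntegral_strip_withDensity {σ ρ c : ℝ} (hσ : 0 ≤ σ) (hσρ : 2 * σ ≤ ρ) (hc : 0 ≤ c)
    {q : EuclideanSpace ℝ (Fin 2) → ℝ} (hq : ∀ p, ‖p‖ ≤ ρ → c ≤ q p) :
    ENNReal.ofReal (c * σ * ρ ^ 3 / 2) ≤
      ∫⁻ p in {p | |p 0| ≤ σ}, ENNReal.ofReal (p 1 ^ 2)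
        ∂(volume.withDensity fun p => ENNReal.ofReal (q p)) := by
  have hρ : 0 ≤ ρ := by linarith
  have hm : Measurable fun p : EuclideanSpace ℝ (Fin 2) => ENNReal.ofReal (p 1 ^ 2) := by fun_prop
  set R : Set (EuclideanSpace ℝ (Fin 2)) := {p | |p 0| ≤ σ ∧ |p 1| ≤ 4 / 5 * ρ} with hR
  have habs : Measurable fun p : EuclideanSpace ℝ (Fin 2) => |p 1| := by fun_prop
  have hRm : MeasurableSet R :=
    (measurableSet_strip σ).inter (measurableSet_le habs measurable_const)
  have hle : R.indicator (fun _ => ENNReal.ofReal c) ≤ fun p => ENNReal.ofReal (q p) := by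
    refine Set.indicator_le fun p hp => ENNReal.ofReal_le_ofReal (hq p ?_)
    refine abs_le_of_sq_le_sq' ?_ hρ |>.2
    rw [EuclideanSpace.norm_sq_eq]
    simp only [Fin.sum_univ_two, norm_eq_abs]
    nlinarith [hp.1, hp.2, abs_nonneg (p 0), abs_nonneg (p 1)]
  have hint : ∫⁻ y in Set.Icc (-(4 / 5 * ρ)) (4 / 5 * ρ), ENNReal.ofReal (y ^ 2) =
      ENNReal.ofReal (2 / 3 * (4 / 5 * ρ) ^ 3) := by
    rw [← ofReal_integral_eq_lintegral_ofReal
        ((continuous_pow 2).continuousOn.integrableOn_compact isCompact_Icc)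
        (ae_of_all _ fun y => sq_nonneg y),
      integral_Icc_eq_integral_Ioc, ← intervalIntegral.integral_of_le (by linarith), integral_pow]
    congr 1
    norm_num
    ring
  have hprod : (fun z : ℝ × ℝ => (!₂[z.1, z.2] : EuclideanSpace ℝ (Fin 2))) ⁻¹' R =
      Set.Icc (-σ) σ ×ˢ Set.Icc (-(4 / 5 * ρ)) (4 / 5 * ρ) := by
    ext z
    simp [hR, abs_le, -Set.Icc_prod_Icc]
  calc ENNReal.ofReal (c * σ * ρ ^ 3 / 2)
      ≤ ENNReal.ofReal c *
          (ENNReal.ofReal (σ - -σ) * ENNReal.ofReal (2 / 3 * (4 / 5 * ρ) ^ 3)) := by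
        rw [← ENNReal.ofReal_mul (by linarith), ← ENNReal.ofReal_mul hc]
        refine ENNReal.ofReal_le_ofReal ?_
        have : 0 ≤ c * σ * ρ ^ 3 := by positivity
        linarith
    _ = ENNReal.ofReal c * ∫⁻ p in R, ENNReal.ofReal (p 1 ^ 2) := by
        rw [← measurePreserving_prod_euclideanSpace_two.setLIntegral_comp_preimage hRm hm, hprod,
          Measure.volume_eq_prod, ← Measure.prod_restrict]
        have hz : Measurable fun z : ℝ × ℝ => ENNReal.ofReal (z.2 ^ 2) := by fun_prop
        change _ = ENNReal.ofReal c * ∫⁻ z : ℝ × ℝ, ENNReal.ofReal (z.2 ^ 2) ∂_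
        rw [lintegral_prod _ hz.aemeasurable]
        dsimp only
        rw [lintegral_const, hint, Measure.restrict_apply_univ,
          Real.volume_Icc, mul_comm (ENNReal.ofReal (2 / 3 * _))]
    _ = ∫⁻ p in R, ENNReal.ofReal (p 1 ^ 2)
          ∂(volume.withDensity (R.indicator fun _ => ENNReal.ofReal c)) := by
        rw [setLIntegral_withDensity_eq_setLIntegral_mul _ (measurable_const.indicator hRm) hm hRm,
          ← lintegral_const_mul _ hm]
        refine setLIntegral_congr_fun hRm fun p hp => ?_
        simp [Set.indicator_of_mem hp]
    _ ≤ _ := lintegral_mono' (Measure.restrict_mono (fun p hp => hp.1)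
        (withDensity_mono (ae_of_all _ hle))) le_rfl

/-- For a `λ`-nice distribution `D` on `ℝ^d`, orthogonal unit vectors `w, v`, and a
width `0 < σ ≤ 1/(2λ)`, the restricted second moment `E[⟨v,x⟩² · 1{|⟨w,x⟩| ≤ σ}]`
is between `σ/(2λ⁴)` and `C·λ·σ` for a universal constant `C`. -/
theorem nice_strip_second_moment :
    ∃ C : ℝ, 0 < C ∧ ∀ d : ℕ, 2 ≤ d → ∀ lam : ℝ, 1 ≤ lam →
      ∀ μ : Measure (EuclideanSpace ℝ (Fin d)), IsProbabilityMeasure μ → IsNice lam μ →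
        ∀ σ : ℝ, 0 < σ → σ ≤ 1 / (2 * lam) →
          ∀ w v : EuclideanSpace ℝ (Fin d), ‖w‖ = 1 → ‖v‖ = 1 → ⟪w, v⟫ = 0 →
            σ / (2 * lam ^ 4) ≤ (∫ x in {x | |⟪w, x⟫| ≤ σ}, ⟪v, x⟫ ^ 2 ∂μ) ∧
            (∫ x in {x | |⟪w, x⟫| ≤ σ}, ⟪v, x⟫ ^ 2 ∂μ) ≤ C * lam * σ := by
  refine ⟨4 * π, by positivity, ?_⟩
  rintro d - lam hlam μ - ⟨-, Q, hQ0, -, hQint, hproj⟩ σ hσ hσl w v hw hv hwv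
  obtain ⟨q, -, hmap, hqlow, hqQ⟩ := hproj w v hw hv hwv
  have hlam0 : 0 < lam := by linarith
  have hm : Measurable fun p : EuclideanSpace ℝ (Fin 2) => ENNReal.ofReal (p 1 ^ 2) := by fun_prop
  have hTm : Measurable fun x : EuclideanSpace ℝ (Fin d) =>
      (WithLp.equiv 2 (Fin 2 → ℝ)).symm ![⟪w, x⟫, ⟪v, x⟫] := by
    refine (PiLp.volume_preserving_toLp (Fin 2)).measurable.comp (measurable_pi_iff.2 fun i => ?_)
    fin_cases i
    · change Measurable fun x : EuclideanSpace ℝ (Fin d) => ⟪w, x⟫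
      fun_prop
    · change Measurable fun x : EuclideanSpace ℝ (Fin d) => ⟪v, x⟫
      fun_prop
  have hplane : ∫⁻ x in {x | |⟪w, x⟫| ≤ σ}, ENNReal.ofReal (⟪v, x⟫ ^ 2) ∂μ =
      ∫⁻ p in {p | |p 0| ≤ σ}, ENNReal.ofReal (p 1 ^ 2)
        ∂(volume.withDensity fun p => ENNReal.ofReal (q p)) := by
    rw [← hmap, setLIntegral_map (measurableSet_strip σ) hm hTm]
    rfl
  have hupper : ∫⁻ x in {x | |⟪w, x⟫| ≤ σ}, ENNReal.ofReal (⟪v, x⟫ ^ 2) ∂μ ≤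
      ENNReal.ofReal (4 * π * lam * σ) := by
    rw [hplane]
    calc _ ≤ ENNReal.ofReal (2 * π * σ) *
          ∫⁻ r in Set.Ioi (0 : ℝ), ENNReal.ofReal (r ^ 2 * Q r) :=
          setLIntegral_strip_withDensity_le hσ.le hQ0 hqQ
      _ ≤ ENNReal.ofReal (2 * π * σ) * (ENNReal.ofReal lam + ENNReal.ofReal lam) := by
          gcongr
          exact (setLIntegral_sq_mul_le_add Q hQ0).trans
            (add_le_add (hQint 1 (by norm_num)) (hQint 3 (by norm_num)))
      _ = ENNReal.ofReal (4 * π * lam * σ) := by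
          rw [← ENNReal.ofReal_add hlam0.le hlam0.le, ← ENNReal.ofReal_mul (by positivity)]
          congr 1
          ring
  have hlower : ENNReal.ofReal (σ / (2 * lam ^ 4)) ≤
      ∫⁻ x in {x | |⟪w, x⟫| ≤ σ}, ENNReal.ofReal (⟪v, x⟫ ^ 2) ∂μ := by
    rw [hplane]
    have hσ2 : 2 * σ ≤ 1 / lam := by
      rw [le_div_iff₀ (by positivity)] at hσl ⊢
      linarith
    refine le_of_eq_of_le ?_
      (le_setLIntegral_strip_withDensity hσ.le hσ2 (by positivity) hqlow)
    congr 1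
    field_simp
  have hmeas : AEStronglyMeasurable (fun x : EuclideanSpace ℝ (Fin d) => ⟪v, x⟫ ^ 2)
      (μ.restrict {x | |⟪w, x⟫| ≤ σ}) :=
    (by fun_prop : Continuous fun x : EuclideanSpace ℝ (Fin d) => ⟪v, x⟫ ^ 2).aestronglyMeasurable
  rw [integral_eq_lintegral_of_nonneg_ae (ae_of_all _ fun x => sq_nonneg _) hmeas]
  exact ⟨(ENNReal.ofReal_le_iff_le_toReal (hupper.trans_lt ENNReal.ofReal_lt_top).ne).1 hlower,
    ENNReal.toReal_le_of_le_ofReal (by positivity) hupper⟩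
end

section
/- Let d ≥ 2, λ ≥ 1, and let D be a λ-nice probability distribution on ℝ^d. Then for any two unit vectors u, u' in ℝ^d, E_{x∼D}[⟨u,x⟩² · ⟨u',x⟩²] ≤ 2π·λ. -/
open MeasureTheory
open scoped RealInnerProductSpace ENNReal

/-- If a measurable density on the plane is dominated by a radial function whose (possibly merely
lower) fifth radial moment is at most `C`, then its fourth moment is at most `2πC`. -/
theorem lintegral_norm_pow_four_mul_le_of_le_radial
    {f : EuclideanSpace ℝ (Fin 2) → ℝ≥0∞} (hf : Measurable f) {Q : ℝ → ℝ}
    (hfQ : ∀ p, f p ≤ ENNReal.ofReal (Q ‖p‖)) {C : ℝ≥0∞}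
    (hQ : ∫⁻ r in Set.Ioi (0 : ℝ), ENNReal.ofReal (r ^ 5 * Q r) ≤ C) :
    ∫⁻ p, f p * ENNReal.ofReal (‖p‖ ^ 4) ≤ ENNReal.ofReal (2 * Real.pi) * C := by
  let e := Complex.orthonormalBasisOneI.repr
  have hF : Measurable fun p : EuclideanSpace ℝ (Fin 2) => f p * ENNReal.ofReal (‖p‖ ^ 4) := by
    fun_prop
  rw [← e.measurePreserving.lintegral_comp hF, ← Complex.lintegral_comp_polarCoord_symm]
  have hpolar : Measurable fun p : ℝ × ℝ => Complex.polarCoord.symm p := by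
    simp only [Complex.polarCoord_symm_apply]
    fun_prop
  have he : Measurable e := e.continuous.measurable
  have hG : Measurable fun p : ℝ × ℝ => ENNReal.ofReal p.1 •
      (f (e (Complex.polarCoord.symm p)) *
        ENNReal.ofReal (‖e (Complex.polarCoord.symm p)‖ ^ 4)) :=
    measurable_fst.ennreal_ofReal.smul (hF.comp (he.comp hpolar))
  rw [polarCoord_target, Measure.volume_eq_prod, ← Measure.prod_restrict,
    lintegral_prod_symm _ hG.aemeasurable]
  calc
    _ ≤ ∫⁻ _ in Set.Ioo (-Real.pi) Real.pi, C := by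
      refine lintegral_mono fun θ => le_trans (setLIntegral_mono' measurableSet_Ioi ?_) hQ
      intro r hr
      have hr0 : 0 < r := hr
      have hnorm : ‖e (Complex.polarCoord.symm (r, θ))‖ = r := by
        rw [e.norm_map, Complex.norm_polarCoord_symm, abs_of_pos hr0]
      have hle := hfQ (e (Complex.polarCoord.symm (r, θ)))
      rw [hnorm] at hle
      calc
        _ = ENNReal.ofReal r * (f (e (Complex.polarCoord.symm (r, θ))) *
              ENNReal.ofReal (r ^ 4)) := by simp only [hnorm, smul_eq_mul]
        _ ≤ ENNReal.ofReal r * (ENNReal.ofReal (Q r) * ENNReal.ofReal (r ^ 4)) := by gcongr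
        _ = ENNReal.ofReal (r ^ 5 * Q r) := by
          rw [← ENNReal.ofReal_mul' (by positivity), ← ENNReal.ofReal_mul hr0.le]
          congr 1
          ring
    _ = ENNReal.ofReal (2 * Real.pi) * C := by
      rw [lintegral_const, Measure.restrict_apply_univ, Real.volume_Ioo, mul_comm]
      congr 2
      ring

/-- In dimension at least two, every vector is orthogonal to some unit vector. -/
theorem exists_norm_eq_one_inner_eq_zero_s6 {d : ℕ} (hd : 2 ≤ d) (u : EuclideanSpace ℝ (Fin d)) :
    ∃ v : EuclideanSpace ℝ (Fin d), ‖v‖ = 1 ∧ ⟪u, v⟫ = 0 := by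
  have hne : (ℝ ∙ u)ᗮ ≠ ⊥ := by
    intro h
    have hsum := (ℝ ∙ u).finrank_add_finrank_orthogonal
    have hle := (finrank_span_le_card (R := ℝ) ({u} : Set (EuclideanSpace ℝ (Fin d)))).trans_eq
      (by simp : _ = 1)
    rw [h, finrank_bot, finrank_euclideanSpace_fin] at hsum
    omega
  obtain ⟨w, hw, hw0⟩ := Submodule.exists_mem_ne_zero_of_ne_bot hne
  refine ⟨(‖w‖⁻¹ : ℝ) • w, norm_smul_inv_norm hw0, ?_⟩
  rw [inner_smul_right, Submodule.mem_orthogonal_singleton_iff_inner_right.1 hw, mul_zero]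

/-- Every one-dimensional marginal of a nice distribution has fourth moment at most `2πλ`. -/
theorem IsNice.lintegral_inner_pow_four_le {d : ℕ} (hd : 2 ≤ d) {lam : ℝ}
    {μ : Measure (EuclideanSpace ℝ (Fin d))} (hnice : IsNice lam μ)
    {u : EuclideanSpace ℝ (Fin d)} (hu : ‖u‖ = 1) :
    ∫⁻ x, ENNReal.ofReal (⟪u, x⟫ ^ 4) ∂μ ≤ ENNReal.ofReal (2 * Real.pi * lam) := by
  obtain ⟨v, hv, huv⟩ := exists_norm_eq_one_inner_eq_zero_s6 hd u
  obtain ⟨-, Q, -, -, hQ, hproj⟩ := hnice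
  obtain ⟨q, -, hmap, -, hqQ⟩ := hproj u v hu hv huv
  obtain ⟨f, hf, hfq, hdens⟩ := exists_measurable_le_withDensity_eq
    (volume : Measure (EuclideanSpace ℝ (Fin 2))) fun p => ENNReal.ofReal (q p)
  have hT : Measurable fun x : EuclideanSpace ℝ (Fin d) =>
      (WithLp.equiv 2 (Fin 2 → ℝ)).symm ![⟪u, x⟫, ⟪v, x⟫] := by
    refine (WithLp.measurable_toLp 2 (Fin 2 → ℝ)).comp (measurable_pi_lambda _ fun i => ?_)
    fin_cases i
    · exact (continuous_const.inner continuous_id).measurable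
    · exact (continuous_const.inner continuous_id).measurable
  have hg : Measurable fun p : EuclideanSpace ℝ (Fin 2) => ENNReal.ofReal (‖p‖ ^ 4) := by
    fun_prop
  calc
    _ ≤ ∫⁻ x, ENNReal.ofReal
          (‖(WithLp.equiv 2 (Fin 2 → ℝ)).symm ![⟪u, x⟫, ⟪v, x⟫]‖ ^ 4) ∂μ := by
      refine lintegral_mono fun x => ENNReal.ofReal_le_ofReal ?_
      have h := PiLp.norm_apply_le ((WithLp.equiv 2 (Fin 2 → ℝ)).symm ![⟪u, x⟫, ⟪v, x⟫]) 0
      exact ((Even.pow_abs (by decide) _).symm.le).trans (pow_le_pow_left₀ (abs_nonneg _) h 4)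
    _ = ∫⁻ p, f p * ENNReal.ofReal (‖p‖ ^ 4) := by
      rw [← lintegral_map hg hT, hmap, ← hdens, lintegral_withDensity_eq_lintegral_mul _ hf hg]
      rfl
    _ ≤ ENNReal.ofReal (2 * Real.pi) * ENNReal.ofReal lam :=
      lintegral_norm_pow_four_mul_le_of_le_radial hf
        (fun p => (hfq p).trans (ENNReal.ofReal_le_ofReal (hqQ p))) (hQ 5 (by simp))
    _ = _ := (ENNReal.ofReal_mul (by positivity)).symm

/-- For a `λ`-nice distribution on `ℝ^d` and any two unit vectors `u, u'`,
`E[⟨u,x⟩² · ⟨u',x⟩²] ≤ 2π·λ`. -/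
theorem nice_fourth_moment_bound
    (d : ℕ) (hd : 2 ≤ d) (lam : ℝ) (hlam : 1 ≤ lam)
    (μ : Measure (EuclideanSpace ℝ (Fin d))) [IsProbabilityMeasure μ]
    (hnice : IsNice lam μ)
    (u u' : EuclideanSpace ℝ (Fin d)) (hu : ‖u‖ = 1) (hu' : ‖u'‖ = 1) :
    (∫ x, ⟪u, x⟫ ^ 2 * ⟪u', x⟫ ^ 2 ∂μ) ≤ 2 * Real.pi * lam := by
  have hlam0 : 0 ≤ lam := zero_le_one.trans hlam
  have hmeas : ∀ w : EuclideanSpace ℝ (Fin d), Measurable fun x => (⟪w, x⟫ : ℝ) := fun w =>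
    (continuous_const.inner continuous_id).measurable
  have hmeas4 : ∀ w : EuclideanSpace ℝ (Fin d),
      Measurable fun x => (2⁻¹ : ℝ≥0∞) * ENNReal.ofReal (⟪w, x⟫ ^ 4) := fun w =>
    ((hmeas w).pow_const 4).ennreal_ofReal.const_mul _
  rw [integral_eq_lintegral_of_nonneg_ae (Filter.Eventually.of_forall fun x => by positivity)
    (Measurable.fun_mul ((hmeas u).pow_const 2) ((hmeas u').pow_const 2)).aestronglyMeasurable]
  refine ENNReal.toReal_le_of_le_ofReal (by positivity) ?_
  have htwo : (2⁻¹ : ℝ≥0∞) = ENNReal.ofReal 2⁻¹ := by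
    rw [ENNReal.ofReal_inv_of_pos two_pos, ENNReal.ofReal_ofNat]
  calc
    _ ≤ ∫⁻ x, (2⁻¹ * ENNReal.ofReal (⟪u, x⟫ ^ 4) + 2⁻¹ * ENNReal.ofReal (⟪u', x⟫ ^ 4)) ∂μ := by
      refine lintegral_mono fun x => ?_
      simp only
      rw [htwo, ← ENNReal.ofReal_mul (by positivity), ← ENNReal.ofReal_mul (by positivity),
        ← ENNReal.ofReal_add (by positivity) (by positivity)]
      refine ENNReal.ofReal_le_ofReal ?_
      nlinarith [sq_nonneg (⟪u, x⟫ ^ 2 - ⟪u', x⟫ ^ 2)]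
    _ = 2⁻¹ * ∫⁻ x, ENNReal.ofReal (⟪u, x⟫ ^ 4) ∂μ +
          2⁻¹ * ∫⁻ x, ENNReal.ofReal (⟪u', x⟫ ^ 4) ∂μ := by
      rw [lintegral_add_left (hmeas4 u),
        lintegral_const_mul _ ((hmeas u).pow_const 4).ennreal_ofReal,
        lintegral_const_mul _ ((hmeas u').pow_const 4).ennreal_ofReal]
    _ ≤ 2⁻¹ * ENNReal.ofReal (2 * Real.pi * lam) + 2⁻¹ * ENNReal.ofReal (2 * Real.pi * lam) := by
      gcongr
      · exact hnice.lintegral_inner_pow_four_le hd hu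
      · exact hnice.lintegral_inner_pow_four_le hd hu'
    _ = _ := by rw [← add_mul, ENNReal.inv_two_add_inv_two, one_mul]
end

section
/- Let d ≥ 2, λ ≥ 1, let D be a λ-nice probability distribution on ℝ^d, let σ > 0, c ≥ 0, and let w, v be orthogonal unit vectors in ℝ^d. Then E_{x∼D}[⟨v,x⟩² · 1{|⟨w,x⟩| ∈ [c, c+σ]}] ≤ 8·λ·σ. -/
open MeasureTheory
open scoped RealInnerProductSpace ENNReal

open Real Set in
/-- The pushforward of `|sin θ| dθ` on `(-π, π)` under `cos` is at most twice Lebesgue measure. -/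
theorem lintegral_abs_sin_mul_comp_cos_le (F : ℝ → ℝ≥0∞) :
    ∫⁻ θ in Ioo (-π) π, ENNReal.ofReal |sin θ| * F (cos θ) ≤ 2 * ∫⁻ t, F t := by
  have key : ∀ s : Set ℝ, MeasurableSet s → InjOn cos s →
      ∫⁻ θ in s, ENNReal.ofReal |sin θ| * F (cos θ) ≤ ∫⁻ t, F t := by
    intro s hs hinj
    have h := lintegral_image_eq_lintegral_abs_deriv_mul hs
      (fun x _ => (hasDerivAt_cos x).hasDerivWithinAt) hinj F
    simp only [abs_neg] at h
    rw [← h]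
    exact setLIntegral_le_lintegral _ _
  have hneg : InjOn cos (Icc (-π) 0) := by
    intro x hx y hy hxy
    have := injOn_cos (x₁ := -x) ⟨by linarith [hx.2], by linarith [hx.1]⟩
      (x₂ := -y) ⟨by linarith [hy.2], by linarith [hy.1]⟩ (by simpa only [cos_neg] using hxy)
    linarith
  have hsub : Ioo (-π) π ⊆ Icc (-π) 0 ∪ Icc 0 π := by
    intro x hx
    rcases le_total x 0 with h | h
    · exact Or.inl ⟨hx.1.le, h⟩
    · exact Or.inr ⟨h, hx.2.le⟩
  calc _ ≤ ∫⁻ θ in Icc (-π) 0 ∪ Icc 0 π, ENNReal.ofReal |sin θ| * F (cos θ) :=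
        lintegral_mono_set hsub
    _ ≤ _ := lintegral_union_le _ _ _
    _ ≤ (∫⁻ t, F t) + ∫⁻ t, F t :=
        add_le_add (key _ measurableSet_Icc hneg) (key _ measurableSet_Icc injOn_cos)
    _ = _ := (two_mul _).symm

open Set in
theorem volume_abs_mem_Icc_le (c σ : ℝ) (hσ : 0 ≤ σ) :
    volume {t : ℝ | |t| ∈ Icc c (c + σ)} ≤ ENNReal.ofReal (2 * σ) := by
  have hsub : {t : ℝ | |t| ∈ Icc c (c + σ)} ⊆ Icc c (c + σ) ∪ Icc (-(c + σ)) (-c) := by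
    rintro t ⟨h1, h2⟩
    rcases abs_cases t with ⟨h, _⟩ | ⟨h, _⟩
    · exact Or.inl ⟨by linarith, by linarith⟩
    · exact Or.inr ⟨by linarith, by linarith⟩
  calc _ ≤ volume (Icc c (c + σ) ∪ Icc (-(c + σ)) (-c)) := measure_mono hsub
    _ ≤ _ := measure_union_le _ _
    _ = ENNReal.ofReal (2 * σ) := by
      rw [Real.volume_Icc, Real.volume_Icc, ← ENNReal.ofReal_add (by linarith) (by linarith)]
      congr 1
      ring

open Real Set in
/-- The part of a circle of radius `r` lying over a strip, weighted by `sin²`. -/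
theorem lintegral_sin_sq_indicator_strip_le (c σ : ℝ) (hσ : 0 ≤ σ) {r : ℝ} (hr : 0 < r) :
    ∫⁻ θ in Ioo (-π) π, {t : ℝ | |t| ∈ Icc c (c + σ)}.indicator 1 (r * cos θ) *
      ENNReal.ofReal (sin θ ^ 2) ≤ ENNReal.ofReal (4 * σ / r) := by
  have hS : MeasurableSet {t : ℝ | |t| ∈ Icc c (c + σ)} :=
    measurable_norm (α := ℝ) measurableSet_Icc
  set S := {t : ℝ | |t| ∈ Icc c (c + σ)}
  calc _ ≤ ∫⁻ θ in Ioo (-π) π, ENNReal.ofReal |sin θ| *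
          (fun t => S.indicator 1 (r * t) : ℝ → ℝ≥0∞) (cos θ) := by
        refine lintegral_mono fun θ => ?_
        dsimp only
        rw [mul_comm]
        gcongr
        rw [← sq_abs]
        nlinarith [abs_nonneg (sin θ), abs_sin_le_one θ]
    _ ≤ 2 * ∫⁻ t, S.indicator 1 (r * t) := lintegral_abs_sin_mul_comp_cos_le _
    _ = 2 * volume ((r * ·) ⁻¹' S) := by
        congr 1
        rw [← lintegral_indicator_one (hS.preimage (measurable_const_mul r))]
        rfl
    _ ≤ 2 * (ENNReal.ofReal |r⁻¹| * ENNReal.ofReal (2 * σ)) := by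
        rw [Real.volume_preimage_mul_left hr.ne']
        gcongr
        exact volume_abs_mem_Icc_le c σ hσ
    _ = ENNReal.ofReal (4 * σ / r) := by
        rw [abs_of_pos (inv_pos.2 hr), ← ENNReal.ofReal_mul (inv_pos.2 hr).le,
          ← ENNReal.ofReal_ofNat 2, ← ENNReal.ofReal_mul (by norm_num)]
        congr 1
        field_simp
        ring

theorem measurable_essSup_right {α β : Type*} [MeasurableSpace α] [MeasurableSpace β]
    (ν : Measure β) [SFinite ν] {f : α → β → ℝ≥0∞} (hf : Measurable (Function.uncurry f)) :
    Measurable fun a => essSup (f a) ν := by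
  refine measurable_of_Iic fun b => ?_
  have : (fun a => essSup (f a) ν) ⁻¹' Set.Iic b =
      (fun a => ν (Prod.mk a ⁻¹' {p | b < Function.uncurry f p})) ⁻¹' {0} := by
    ext a
    have hiff : (∀ᵐ y ∂ν, f a y ≤ b) ↔ ν (Prod.mk a ⁻¹' {p | b < Function.uncurry f p}) = 0 := by
      rw [ae_iff]
      simp [Function.uncurry]
    simp only [Set.mem_preimage, Set.mem_Iic, Set.mem_singleton_iff, ← hiff]
    refine ⟨fun h => ?_, fun h => essSup_le_of_ae_le b h⟩
    filter_upwards [ENNReal.ae_le_essSup (f a)] with y hy using hy.trans h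
  rw [this]
  exact measurable_measure_prodMk_left (measurableSet_lt measurable_const hf)
    (measurableSet_singleton 0)

open Real Set in
/-- If a planar density `h` is dominated by a radial profile `N`, not necessarily measurable,
then the second moment over a strip is controlled by the first and third moments of `N`. -/
theorem lintegral_strip_sq_mul_le (c σ M : ℝ) (hσ : 0 ≤ σ) (hM : 0 ≤ M) {h : ℝ × ℝ → ℝ≥0∞}
    (hh : Measurable h) (N : ℝ → ℝ≥0∞)
    (hN : ∀ r > 0, ∀ θ, h (r * cos θ, r * sin θ) ≤ N r)
    (h₁ : ∫⁻ r in Ioi (0 : ℝ), ENNReal.ofReal r * N r ≤ ENNReal.ofReal M)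
    (h₃ : ∫⁻ r in Ioi (0 : ℝ), ENNReal.ofReal (r ^ 3) * N r ≤ ENNReal.ofReal M) :
    ∫⁻ p : ℝ × ℝ, {t : ℝ | |t| ∈ Icc c (c + σ)}.indicator 1 p.1 * ENNReal.ofReal (p.2 ^ 2) * h p
      ≤ ENNReal.ofReal (4 * σ * M) := by
  have hS : MeasurableSet {t : ℝ | |t| ∈ Icc c (c + σ)} :=
    measurable_norm (α := ℝ) measurableSet_Icc
  have hangle := fun r hr => lintegral_sin_sq_indicator_strip_le c σ hσ (r := r) hr
  set S := {t : ℝ | |t| ∈ Icc c (c + σ)}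
  have hSm : Measurable (S.indicator (1 : ℝ → ℝ≥0∞)) := measurable_one.indicator hS
  set f : ℝ → ℝ → ℝ≥0∞ := fun r θ => h (r * cos θ, r * sin θ)
  have hf : Measurable (Function.uncurry f) := by
    have : Measurable fun p : ℝ × ℝ => (p.1 * cos p.2, p.1 * sin p.2) := by fun_prop
    exact hh.comp this
  set G : ℝ → ℝ≥0∞ := fun r => essSup (f r) (volume.restrict (Ioo (-π) π))
  have hG : Measurable G := measurable_essSup_right _ hf
  have hGN : ∀ r > 0, G r ≤ N r := fun r hr =>
    essSup_le_of_ae_le _ (Filter.Eventually.of_forall fun θ => hN r hr θ)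
  have hGr : ∀ g : ℝ → ℝ≥0∞, ∫⁻ r in Ioi (0 : ℝ), g r * G r ≤ ∫⁻ r in Ioi (0 : ℝ), g r * N r :=
    fun g => setLIntegral_mono' measurableSet_Ioi fun r hr => by gcongr; exact hGN r hr
  rw [← lintegral_comp_polarCoord_symm]
  have htarget : (volume : Measure (ℝ × ℝ)).restrict polarCoord.target =
      (volume.restrict (Ioi 0)).prod (volume.restrict (Ioo (-π) π)) := by
    rw [Measure.prod_restrict]; rfl
  rw [htarget, lintegral_prod]
  swap
  · have h1 : Measurable fun p : ℝ × ℝ => S.indicator (1 : ℝ → ℝ≥0∞) (p.1 * cos p.2) :=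
      hSm.comp (by fun_prop)
    have h2 : Measurable fun p : ℝ × ℝ => h (p.1 * cos p.2, p.1 * sin p.2) := hf
    simp only [polarCoord_symm_apply, smul_eq_mul]
    exact (Measurable.mul (by fun_prop) ((h1.mul (by fun_prop)).mul h2)).aemeasurable
  calc _ ≤ ∫⁻ r in Ioi (0 : ℝ), ENNReal.ofReal (2 * σ) *
          (ENNReal.ofReal r * G r + ENNReal.ofReal (r ^ 3) * G r) := by
        refine setLIntegral_mono' measurableSet_Ioi fun r (hr : 0 < r) => ?_
        calc _ ≤ ∫⁻ θ in Ioo (-π) π, (ENNReal.ofReal (r ^ 3) * G r) *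
                (S.indicator 1 (r * cos θ) * ENNReal.ofReal (sin θ ^ 2)) := by
              refine lintegral_mono_ae ?_
              filter_upwards [ENNReal.ae_le_essSup (f r)] with θ hθ
              simp only [polarCoord_symm_apply, smul_eq_mul]
              have h3 : ENNReal.ofReal (r ^ 3) * ENNReal.ofReal (sin θ ^ 2) =
                  ENNReal.ofReal r * ENNReal.ofReal ((r * sin θ) ^ 2) := by
                rw [← ENNReal.ofReal_mul (by positivity), ← ENNReal.ofReal_mul hr.le]
                ring_nf
              calc _ ≤ ENNReal.ofReal r * (S.indicator 1 (r * cos θ) *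
                      ENNReal.ofReal ((r * sin θ) ^ 2) * G r) := by gcongr
                _ = (ENNReal.ofReal r * ENNReal.ofReal ((r * sin θ) ^ 2)) * G r *
                      S.indicator 1 (r * cos θ) := by ring
                _ = _ := by rw [← h3]; ring
          _ = (ENNReal.ofReal (r ^ 3) * G r) * ∫⁻ θ in Ioo (-π) π,
                (S.indicator 1 (r * cos θ) * ENNReal.ofReal (sin θ ^ 2)) := by
              refine lintegral_const_mul _ (Measurable.mul (hSm.comp (by fun_prop)) (by fun_prop))
          _ ≤ (ENNReal.ofReal (r ^ 3) * G r) * ENNReal.ofReal (4 * σ / r) := by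
              gcongr; exact hangle r hr
          _ = ENNReal.ofReal (4 * σ * r ^ 2) * G r := by
              rw [mul_right_comm, ← ENNReal.ofReal_mul (by positivity)]
              congr 2; field_simp
          _ ≤ ENNReal.ofReal (2 * σ * (r + r ^ 3)) * G r := by
              refine mul_le_mul_left (ENNReal.ofReal_le_ofReal ?_) _
              nlinarith [mul_nonneg (mul_nonneg hσ hr.le) (sq_nonneg (r - 1))]
          _ = _ := by
              rw [ENNReal.ofReal_mul (by positivity), ENNReal.ofReal_add hr.le (by positivity)]
              ring
    _ = ENNReal.ofReal (2 * σ) * ((∫⁻ r in Ioi (0 : ℝ), ENNReal.ofReal r * G r) +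
          ∫⁻ r in Ioi (0 : ℝ), ENNReal.ofReal (r ^ 3) * G r) := by
        rw [lintegral_const_mul _ (by fun_prop), lintegral_add_left (by fun_prop)]
    _ ≤ ENNReal.ofReal (2 * σ) * (ENNReal.ofReal M + ENNReal.ofReal M) := by
        gcongr
        · exact (hGr _).trans h₁
        · exact (hGr _).trans h₃
    _ = ENNReal.ofReal (4 * σ * M) := by
        rw [← ENNReal.ofReal_add hM hM, ← ENNReal.ofReal_mul (by positivity)]
        congr 1; ring

/-- For a `λ`-nice distribution on `ℝ^d`, orthogonal unit vectors `w, v`, `σ > 0`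
and `c ≥ 0`, the second moment of `⟨v,x⟩` restricted to the shifted strip
`{x : |⟨w,x⟩| ∈ [c, c+σ]}` is at most `8·λ·σ`. -/
theorem nice_shifted_strip_second_moment
    (d : ℕ) (hd : 2 ≤ d) (lam : ℝ) (hlam : 1 ≤ lam)
    (μ : Measure (EuclideanSpace ℝ (Fin d))) [IsProbabilityMeasure μ]
    (hnice : IsNice lam μ)
    (σ c : ℝ) (hσ : 0 < σ) (hc : 0 ≤ c)
    (w v : EuclideanSpace ℝ (Fin d)) (hw : ‖w‖ = 1) (hv : ‖v‖ = 1)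
    (hwv : ⟪w, v⟫ = 0) :
    (∫ x in {x | |⟪w, x⟫| ∈ Set.Icc c (c + σ)}, ⟪v, x⟫ ^ 2 ∂μ) ≤ 8 * lam * σ := by
  obtain ⟨-, Q, -, -, hQk, hproj⟩ := hnice
  obtain ⟨q, -, hmap, -, hqQ⟩ := hproj w v hw hv hwv
  obtain ⟨g, hg, hgq, hgd⟩ := exists_measurable_le_withDensity_eq
    (volume : Measure (EuclideanSpace ℝ (Fin 2))) (fun p => ENNReal.ofReal (q p))
  rw [← hgd] at hmap
  have hS : MeasurableSet {t : ℝ | |t| ∈ Set.Icc c (c + σ)} :=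
    measurable_norm (α := ℝ) measurableSet_Icc
  have hSm : Measurable ({t : ℝ | |t| ∈ Set.Icc c (c + σ)}.indicator (1 : ℝ → ℝ≥0∞)) :=
    measurable_one.indicator hS
  have hcoord : ∀ i : Fin 2, Measurable fun p : EuclideanSpace ℝ (Fin 2) => p i := by
    intro i; fun_prop
  have hT : Measurable fun x : EuclideanSpace ℝ (Fin d) =>
      (WithLp.equiv 2 (Fin 2 → ℝ)).symm ![⟪w, x⟫, ⟪v, x⟫] := by
    refine (PiLp.volume_preserving_toLp (Fin 2)).measurable.comp (measurable_pi_iff.2 fun i => ?_)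
    fin_cases i
    · exact (continuous_const.inner continuous_id).measurable
    · exact (continuous_const.inner continuous_id).measurable
  set e : ℝ × ℝ → EuclideanSpace ℝ (Fin 2) := fun p => WithLp.toLp 2 ![p.1, p.2] with he_def
  have he : MeasurePreserving e volume volume :=
    (PiLp.volume_preserving_toLp (Fin 2)).comp
      (volume_preserving_finTwoArrow ℝ).symm
  set F : EuclideanSpace ℝ (Fin 2) → ℝ≥0∞ := fun p =>
    {t : ℝ | |t| ∈ Set.Icc c (c + σ)}.indicator 1 (p 0) * ENNReal.ofReal (p 1 ^ 2) with hF_def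
  have hF : Measurable F := (hSm.comp (hcoord 0)).mul (by fun_prop)
  have hnorm : ∀ r > 0, ∀ θ : ℝ, ‖e (r * Real.cos θ, r * Real.sin θ)‖ = r := by
    intro r hr θ
    rw [EuclideanSpace.norm_eq, Real.sqrt_eq_iff_mul_self_eq_of_pos hr]
    simp only [he_def, Fin.sum_univ_two, Matrix.cons_val_zero, Matrix.cons_val_one,
      Real.norm_eq_abs, sq_abs]
    linear_combination r ^ 2 * (Real.sin_sq_add_cos_sq θ).symm
  have hmoment : ∀ k : ℕ, k = 1 ∨ k = 3 ∨ k = 5 →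
      ∫⁻ r in Set.Ioi (0 : ℝ), ENNReal.ofReal (r ^ k) * ENNReal.ofReal (Q r) ≤
        ENNReal.ofReal lam := by
    intro k hk
    refine le_trans (le_of_eq ?_) (hQk k hk)
    refine setLIntegral_congr_fun measurableSet_Ioi fun r (hr : 0 < r) => ?_
    exact (ENNReal.ofReal_mul (by positivity)).symm
  have hmain := lintegral_strip_sq_mul_le c σ lam hσ.le (by linarith) (hg.comp he.measurable)
    (fun r => ENNReal.ofReal (Q r))
    (fun r hr θ => (hgq _).trans (ENNReal.ofReal_le_ofReal
      ((hqQ _).trans_eq (congrArg Q (hnorm r hr θ)))))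
    (by simpa using hmoment 1 (by simp)) (hmoment 3 (by simp))
  have hlint : ∫⁻ x in {x | |⟪w, x⟫| ∈ Set.Icc c (c + σ)}, ENNReal.ofReal (⟪v, x⟫ ^ 2) ∂μ ≤
      ENNReal.ofReal (4 * σ * lam) := by
    have hA : MeasurableSet {x : EuclideanSpace ℝ (Fin d) | |⟪w, x⟫| ∈ Set.Icc c (c + σ)} :=
      hS.preimage (continuous_const.inner continuous_id).measurable
    calc _ = ∫⁻ x, F ((WithLp.equiv 2 (Fin 2 → ℝ)).symm ![⟪w, x⟫, ⟪v, x⟫]) ∂μ := by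
          rw [← lintegral_indicator hA]
          refine lintegral_congr fun x => ?_
          simp [hF_def, Set.indicator_apply]
      _ = ∫⁻ p, F p ∂(volume.withDensity g) := by rw [← hmap, lintegral_map hF hT]
      _ = ∫⁻ p, F p * g p := by
          rw [lintegral_withDensity_eq_lintegral_mul _ hg hF]
          simp only [Pi.mul_apply, mul_comm]
      _ = ∫⁻ p, F (e p) * g (e p) := (he.lintegral_comp (hF.mul hg)).symm
      _ ≤ _ := hmain
  have hcont : Continuous fun x : EuclideanSpace ℝ (Fin d) => ⟪v, x⟫ ^ 2 := by fun_prop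
  rw [integral_eq_lintegral_of_nonneg_ae (Filter.Eventually.of_forall fun x => sq_nonneg _)
    hcont.aestronglyMeasurable]
  refine (ENNReal.toReal_le_of_le_ofReal (by positivity) hlint).trans ?_
  nlinarith [mul_pos hσ (by linarith : 0 < lam)]
end

section
/- Let λ ≥ 1 and let Q : [0,∞) → [0,∞) be a measurable function with Q(r) ≤ λ for all r ≥ 0 and ∫₀^∞ r³ Q(r) dr ≤ λ. Then for every β ≥ 0, ∫₀^∞ r² Q(√(r² + β)) dr ≤ 2λ. -/
open MeasureTheory
open scoped ENNReal

/-- The substitution `s = √(r² + β)` does not increase the third moment on `(0, ∞)`. -/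
lemma lintegral_pow_three_mul_comp_sqrt_le {Q : ℝ → ℝ} (hQnn : ∀ r, 0 ≤ r → 0 ≤ Q r)
    {β : ℝ} (hβ : 0 ≤ β) :
    ∫⁻ r in Set.Ioi (0 : ℝ), ENNReal.ofReal (r ^ 3 * Q (Real.sqrt (r ^ 2 + β)))
      ≤ ∫⁻ r in Set.Ioi (0 : ℝ), ENNReal.ofReal (r ^ 3 * Q r) := by
  have hpos : ∀ r ∈ Set.Ioi (0 : ℝ), 0 < r ^ 2 + β := fun r hr => by
    have : (0 : ℝ) < r := hr
    positivity
  have hderiv : ∀ r ∈ Set.Ioi (0 : ℝ), HasDerivWithinAt (fun r => Real.sqrt (r ^ 2 + β))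
      (r / Real.sqrt (r ^ 2 + β)) (Set.Ioi 0) r := fun r hr => by
    have h := (((hasDerivAt_id r).pow 2).add_const β).sqrt (hpos r hr).ne'
    refine (h.congr_deriv ?_).hasDerivWithinAt
    have := (Real.sqrt_pos.2 (hpos r hr)).ne'
    simp
    field_simp
  have hinj : Set.InjOn (fun r => Real.sqrt (r ^ 2 + β)) (Set.Ioi 0) := by
    intro a ha b hb hab
    have h := (Real.sqrt_inj (hpos a ha).le (hpos b hb).le).1 hab
    exact (sq_eq_sq₀ (le_of_lt ha) (le_of_lt hb)).1 (by linarith)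
  have himage : (fun r => Real.sqrt (r ^ 2 + β)) '' Set.Ioi 0 ⊆ Set.Ioi 0 := by
    rintro _ ⟨r, hr, rfl⟩
    exact Real.sqrt_pos.2 (hpos r hr)
  refine le_trans ?_ (lintegral_mono_set himage)
  rw [lintegral_image_eq_lintegral_abs_deriv_mul measurableSet_Ioi hderiv hinj]
  refine setLIntegral_mono' measurableSet_Ioi fun r hr => ?_
  have hr0 : (0 : ℝ) < r := hr
  have hs := Real.sqrt_pos.2 (hpos r hr)
  have hsq := Real.sq_sqrt (hpos r hr).le
  have hQ := hQnn _ hs.le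
  rw [← ENNReal.ofReal_mul (abs_nonneg _), abs_of_pos (by positivity)]
  refine ENNReal.ofReal_le_ofReal ?_
  set s := Real.sqrt (r ^ 2 + β)
  calc r ^ 3 * Q s = r * r ^ 2 * Q s := by ring
    _ ≤ r * s ^ 2 * Q s := by
        have : r ^ 2 ≤ s ^ 2 := by linarith
        exact mul_le_mul_of_nonneg_right (mul_le_mul_of_nonneg_left this hr0.le) hQ
    _ = r / s * (s ^ 3 * Q s) := by field_simp

/-- Integral estimate: if `Q : [0,∞) → [0,∞)` is measurable with `Q ≤ λ` pointwise and
`∫₀^∞ r³ Q(r) dr ≤ λ`, then `∫₀^∞ r² Q(√(r² + β)) dr ≤ 2λ` for every `β ≥ 0`. -/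
theorem shifted_moment_integral_bound
    (lam : ℝ) (hlam : 1 ≤ lam)
    (Q : ℝ → ℝ) (hQmeas : Measurable Q)
    (hQnn : ∀ r, 0 ≤ r → 0 ≤ Q r) (hQbd : ∀ r, 0 ≤ r → Q r ≤ lam)
    (hQmom : ∫⁻ r in Set.Ioi (0 : ℝ), ENNReal.ofReal (r ^ 3 * Q r)
        ≤ ENNReal.ofReal lam)
    (β : ℝ) (hβ : 0 ≤ β) :
    ∫⁻ r in Set.Ioi (0 : ℝ), ENNReal.ofReal (r ^ 2 * Q (Real.sqrt (r ^ 2 + β)))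
      ≤ ENNReal.ofReal (2 * lam) := by
  have hlam0 : 0 ≤ lam := by linarith
  rw [← Set.Ioc_union_Ioi_eq_Ioi (zero_le_one' ℝ), two_mul, ENNReal.ofReal_add hlam0 hlam0]
  refine (lintegral_union_le _ _ _).trans (add_le_add ?_ ?_)
  · calc ∫⁻ r in Set.Ioc (0 : ℝ) 1, ENNReal.ofReal (r ^ 2 * Q (Real.sqrt (r ^ 2 + β)))
        ≤ ∫⁻ _ in Set.Ioc (0 : ℝ) 1, ENNReal.ofReal lam := by
          refine setLIntegral_mono' measurableSet_Ioc fun r hr => ENNReal.ofReal_le_ofReal ?_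
          have hr2 : r ^ 2 ≤ 1 := pow_le_one₀ hr.1.le hr.2
          have hQ := hQnn _ (Real.sqrt_nonneg (r ^ 2 + β))
          exact (mul_le_of_le_one_left hQ hr2).trans (hQbd _ (Real.sqrt_nonneg _))
      _ = ENNReal.ofReal lam := by simp
  · calc ∫⁻ r in Set.Ioi (1 : ℝ), ENNReal.ofReal (r ^ 2 * Q (Real.sqrt (r ^ 2 + β)))
        ≤ ∫⁻ r in Set.Ioi (1 : ℝ), ENNReal.ofReal (r ^ 3 * Q (Real.sqrt (r ^ 2 + β))) := by
          refine setLIntegral_mono' measurableSet_Ioi fun r hr => ENNReal.ofReal_le_ofReal ?_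
          exact mul_le_mul_of_nonneg_right (pow_le_pow_right₀ (le_of_lt hr) (by norm_num))
            (hQnn _ (Real.sqrt_nonneg _))
      _ ≤ ∫⁻ r in Set.Ioi (0 : ℝ), ENNReal.ofReal (r ^ 3 * Q (Real.sqrt (r ^ 2 + β))) :=
          lintegral_mono_set (Set.Ioi_subset_Ioi zero_le_one)
      _ ≤ ∫⁻ r in Set.Ioi (0 : ℝ), ENNReal.ofReal (r ^ 3 * Q r) :=
          lintegral_pow_three_mul_comp_sqrt_le hQnn hβ
      _ ≤ ENNReal.ofReal lam := hQmom
end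

section
/- Let d ≥ 2, let μ be a probability measure on ℝ^d, let w be a unit vector, let θ ∈ (0, π/4], and let a, b ≥ 0. Suppose (i) μ({x : |⟨w,x⟩| ≤ θ}) ≤ a, and (ii) for every unit vector v with ⟨v,w⟩ = 0, ∑_{i=2}^∞ (i−1)^{−2} · E_{x∼μ}[⟨v,x⟩² · 1{|⟨w,x⟩| ∈ [(i−1)θ, iθ)}] ≤ b. Then for every unit vector w' with angle ∠(w,w') ≤ θ, μ({x : sign(⟨w',x⟩) ≠ sign(⟨w,x⟩)}) ≤ a + 4b. -/
open MeasureTheory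
open scoped RealInnerProductSpace ENNReal

/-- `sgn t = 1` if `t ≥ 0` and `sgn t = -1` if `t < 0`. -/
noncomputable def sgn (t : ℝ) : ℝ := if 0 ≤ t then 1 else -1

theorem mul_abs_le_abs_of_sgn_add_ne {c t y : ℝ} (h : sgn (c * t + y) ≠ sgn t) :
    c * |t| ≤ |y| := by
  unfold sgn at h
  rcases le_or_gt 0 t with ht | ht
  · have h' : c * t + y < 0 := by
      by_contra hn
      exact h (by rw [if_pos (not_lt.mp hn), if_pos ht])
    rw [abs_of_nonneg ht]
    linarith [neg_le_abs y]
  · have h' : 0 ≤ c * t + y := by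
      by_contra hn
      exact h (by rw [if_neg hn, if_neg ht.not_ge])
    rw [abs_of_neg ht]
    linarith [le_abs_self y]

theorem exists_nat_mem_Ico_mul {θ r : ℝ} (hθ : 0 < θ) (hr : θ ≤ r) :
    ∃ i : ℕ, r ∈ Set.Ico (((i : ℝ) + 1) * θ) (((i : ℝ) + 2) * θ) := by
  have h1 : 1 ≤ r / θ := (one_le_div hθ).mpr hr
  refine ⟨⌊r / θ - 1⌋₊, ?_, ?_⟩
  · rw [← le_div_iff₀ hθ]
    linarith [Nat.floor_le (sub_nonneg.mpr h1)]
  · rw [← div_lt_iff₀ hθ]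
    linarith [Nat.lt_floor_add_one (r / θ - 1)]

/-- A unit vector `w'` at angle at most `θ ≤ π / 4` from `w` has a large component along `w`
and a component of norm at most `θ` orthogonal to `w`. -/
theorem exists_decomposition_of_angle_le {E : Type*} [NormedAddCommGroup E]
    [InnerProductSpace ℝ E] {w w' : E} (hw : ‖w‖ = 1) (hw' : ‖w'‖ = 1) {θ : ℝ}
    (hθ : θ ≤ Real.pi / 4) (hangle : InnerProductGeometry.angle w w' ≤ θ) :
    ∃ (c : ℝ) (u : E), w' = c • w + u ∧ ⟪u, w⟫ = 0 ∧ 1 / 2 ≤ c ∧ ‖u‖ ≤ θ ∧ c ^ 2 + ‖u‖ ^ 2 = 1 := by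
  set φ := InnerProductGeometry.angle w w' with hφ
  have hφ0 : 0 ≤ φ := InnerProductGeometry.angle_nonneg w w'
  have hcos : Real.cos φ = ⟪w, w'⟫ := by
    rw [hφ, InnerProductGeometry.cos_angle, hw, hw']
    simp
  have hu : ⟪w' - Real.cos φ • w, w⟫ = 0 := by
    rw [inner_sub_left, real_inner_smul_left, real_inner_self_eq_norm_sq, hw, hcos,
      real_inner_comm]
    ring
  have hsum : Real.cos φ ^ 2 + ‖w' - Real.cos φ • w‖ ^ 2 = 1 := by
    rw [norm_sub_sq_real, real_inner_smul_right, real_inner_comm, ← hcos, norm_smul, hw, hw',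
      Real.norm_eq_abs, mul_one, sq_abs]
    ring
  refine ⟨Real.cos φ, w' - Real.cos φ • w, by abel, hu, ?_, ?_, hsum⟩
  · rw [← Real.cos_pi_div_three]
    exact Real.cos_le_cos_of_nonneg_of_le_pi hφ0 (by linarith [Real.pi_pos])
      (by linarith [Real.pi_pos])
  · refine le_trans ?_ hangle
    refine le_trans ?_ (Real.sin_le hφ0)
    refine (sq_le_sq₀ (norm_nonneg _) ?_).mp ?_
    · exact Real.sin_nonneg_of_nonneg_of_le_pi hφ0 (InnerProductGeometry.angle_le_pi w w')
    · linarith [Real.sin_sq_add_cos_sq φ]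

/-- Deterministic core of the universally testable bound for local halfspace
disagreement: if (i) the mass of the band `{|⟨w,x⟩| ≤ θ}` is at most `a`, and
(ii) for every unit `v ⊥ w` the weighted sum over the bands
`{|⟨w,x⟩| ∈ [(i−1)θ, iθ)}`, `i ≥ 2`, of `(i−1)^{-2} E[⟨v,x⟩² 1_band]` is at most `b`,
then every halfspace with normal `w'` at angle at most `θ ∈ (0, π/4]` from `w`
disagrees with the one with normal `w` on a set of measure at most `a + 4b`. -/
theorem local_halfspace_disagreement_bound
    (d : ℕ) (hd : 2 ≤ d)
    (μ : Measure (EuclideanSpace ℝ (Fin d))) [IsProbabilityMeasure μ]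
    (w : EuclideanSpace ℝ (Fin d)) (hw : ‖w‖ = 1)
    (θ : ℝ) (hθ0 : 0 < θ) (hθ1 : θ ≤ Real.pi / 4)
    (a b : ℝ) (ha : 0 ≤ a) (hb : 0 ≤ b)
    (hband : μ {x | |⟪w, x⟫| ≤ θ} ≤ ENNReal.ofReal a)
    (hmom : ∀ v : EuclideanSpace ℝ (Fin d), ‖v‖ = 1 → ⟪v, w⟫ = 0 →
      (∑' i : ℕ, (1 / ((i : ℝ≥0∞) + 1) ^ 2) *
        ∫⁻ x in {x | |⟪w, x⟫| ∈ Set.Ico (((i : ℝ) + 1) * θ) (((i : ℝ) + 2) * θ)},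
          ENNReal.ofReal (⟪v, x⟫ ^ 2) ∂μ) ≤ ENNReal.ofReal b)
    (w' : EuclideanSpace ℝ (Fin d)) (hw' : ‖w'‖ = 1)
    (hangle : InnerProductGeometry.angle w w' ≤ θ) :
    μ {x | sgn ⟪w', x⟫ ≠ sgn ⟪w, x⟫} ≤ ENNReal.ofReal (a + 4 * b) := by
  obtain ⟨c, u, rfl, huw, hc, hu, hcu⟩ := exists_decomposition_of_angle_le hw hw' hθ1 hangle
  have hinner : ∀ x, ⟪c • w + u, x⟫ = c * ⟪w, x⟫ + ⟪u, x⟫ := fun x => by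
    rw [inner_add_left, real_inner_smul_left]
  simp only [hinner]
  rcases eq_or_ne u 0 with rfl | hu0
  · have hc1 : c = 1 := by
      rw [norm_zero] at hcu
      nlinarith
    simp [hc1]
  have hpos : 0 < ‖u‖ := norm_pos_iff.mpr hu0
  set v := ‖u‖⁻¹ • u with hv
  have huv : ∀ x, ⟪u, x⟫ = ‖u‖ * ⟪v, x⟫ := fun x => by
    rw [hv, real_inner_smul_left, mul_inv_cancel_left₀ hpos.ne']
  have hv1 : ‖v‖ = 1 := by
    rw [hv, norm_smul, norm_inv, norm_norm, inv_mul_cancel₀ hpos.ne']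
  have hvw : ⟪v, w⟫ = 0 := by rw [hv, real_inner_smul_left, huw, mul_zero]
  let band : ℕ → Set (EuclideanSpace ℝ (Fin d)) := fun i =>
    {x | |⟪w, x⟫| ∈ Set.Ico (((i : ℝ) + 1) * θ) (((i : ℝ) + 2) * θ)}
  let D := {x | sgn (c * ⟪w, x⟫ + ⟪u, x⟫) ≠ sgn ⟪w, x⟫}
  have hmeas : ∀ i, MeasurableSet (band i) := fun i =>
    measurableSet_Ico.preimage (by fun_prop)
  have hcover : D ⊆ {x | |⟪w, x⟫| ≤ θ} ∪ ⋃ i, D ∩ band i := by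
    intro x hx
    rcases le_or_gt |⟪w, x⟫| θ with h | h
    · exact Or.inl h
    · obtain ⟨i, hi⟩ := exists_nat_mem_Ico_mul hθ0 h.le
      exact Or.inr (Set.mem_iUnion.mpr ⟨i, hx, hi⟩)
  have hlarge : ∀ i, ∀ x ∈ D ∩ band i, ((i : ℝ) + 1) ^ 2 ≤ 4 * ⟪v, x⟫ ^ 2 := by
    rintro i x ⟨hx, hi, -⟩
    have h1 := mul_abs_le_abs_of_sgn_add_ne hx
    rw [huv, abs_mul, abs_norm] at h1
    have h2 : ((i : ℝ) + 1) * θ ≤ 2 * |⟪v, x⟫| * θ := by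
      have h3 : 1 / 2 * |⟪w, x⟫| ≤ c * |⟪w, x⟫| := by gcongr
      have h4 : ‖u‖ * |⟪v, x⟫| ≤ θ * |⟪v, x⟫| := by gcongr
      linarith
    have h5 := pow_le_pow_left₀ (by positivity) (le_of_mul_le_mul_right h2 hθ0) 2
    rw [mul_pow, sq_abs] at h5
    linarith
  have hpiece : ∀ i : ℕ, μ (D ∩ band i) ≤ 4 * ((1 / ((i : ℝ≥0∞) + 1) ^ 2) *
      ∫⁻ x in band i, ENNReal.ofReal (⟪v, x⟫ ^ 2) ∂μ) := by
    intro i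
    have hsub : D ∩ band i ⊆
        {x | ((i : ℝ≥0∞) + 1) ^ 2 ≤ 4 * ENNReal.ofReal (⟪v, x⟫ ^ 2)} ∩ band i := by
      intro x hx
      refine ⟨?_, hx.2⟩
      have h := ENNReal.ofReal_le_ofReal (hlarge i x hx)
      rw [ENNReal.ofReal_mul (by norm_num), ENNReal.ofReal_pow (by positivity),
        ENNReal.ofReal_add (by positivity) (by norm_num)] at h
      simpa using h
    have hmarkov := mul_meas_ge_le_lintegral₀ (μ := μ.restrict (band i))
      (f := fun x => 4 * ENNReal.ofReal (⟪v, x⟫ ^ 2)) (by fun_prop) (((i : ℝ≥0∞) + 1) ^ 2)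
    rw [Measure.restrict_apply' (hmeas i), lintegral_const_mul' _ _ (by simp)] at hmarkov
    have hle := (mul_le_mul_right (measure_mono hsub) _).trans hmarkov
    rw [mul_left_comm, one_div, ← ENNReal.div_eq_inv_mul,
      ENNReal.le_div_iff_mul_le (Or.inl (by simp)) (Or.inl (by finiteness)), mul_comm]
    exact hle
  calc μ D ≤ μ {x | |⟪w, x⟫| ≤ θ} + ∑' i, μ (D ∩ band i) :=
        (measure_mono hcover).trans <| (measure_union_le _ _).trans <|
          add_le_add_right (measure_iUnion_le _) _
    _ ≤ ENNReal.ofReal a + 4 * ENNReal.ofReal b := by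
        refine add_le_add hband ((ENNReal.tsum_le_tsum hpiece).trans ?_)
        rw [ENNReal.tsum_mul_left]
        gcongr
        exact hmom v hv1 hvw
    _ = ENNReal.ofReal (a + 4 * b) := by
        rw [ENNReal.ofReal_add ha (by positivity), ENNReal.ofReal_mul (by norm_num)]
        simp
end

section
/- Let w, w' be unit vectors in ℝ^d with angle θ = ∠(w,w') ∈ (0, π/2), and let x ∈ ℝ^d satisfy sign(⟨w,x⟩) ≠ sign(⟨w',x⟩). Then there exists a unit vector v ∈ span(w,w') with ⟨v,w⟩ = 0 such that |⟨v,x⟩| ≥ |⟨w,x⟩| / tan θ. -/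
open scoped RealInnerProductSpace

/-- Real numbers on different sides of `0` satisfy `c * |a| ≤ |b - c * a|`. -/
theorem mul_abs_le_abs_sub_mul_of_sgn_ne {a b c : ℝ} (h : sgn a ≠ sgn b) :
    c * |a| ≤ |b - c * a| := by
  unfold sgn at h
  split_ifs at h with ha hb hb
  · exact absurd rfl h
  · rw [abs_of_nonneg ha]
    linarith [neg_le_abs (b - c * a)]
  · rw [abs_of_neg (not_le.mp ha)]
    linarith [le_abs_self (b - c * a)]
  · exact absurd rfl h

/-- If the halfspaces with unit normals `w, w'` at angle `θ ∈ (0, π/2)` disagree on a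
point `x`, then there is a unit vector `v ∈ span(w,w')` orthogonal to `w` with
`|⟨v,x⟩| ≥ |⟨w,x⟩| / tan θ`. -/
theorem disagreement_orthogonal_component
    (d : ℕ) (w w' x : EuclideanSpace ℝ (Fin d))
    (hw : ‖w‖ = 1) (hw' : ‖w'‖ = 1)
    (hθ0 : 0 < InnerProductGeometry.angle w w')
    (hθ1 : InnerProductGeometry.angle w w' < Real.pi / 2)
    (hx : sgn ⟪w, x⟫ ≠ sgn ⟪w', x⟫) :
    ∃ v : EuclideanSpace ℝ (Fin d),
      v ∈ Submodule.span ℝ {w, w'} ∧ ‖v‖ = 1 ∧ ⟪v, w⟫ = 0 ∧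
      |⟪w, x⟫| / Real.tan (InnerProductGeometry.angle w w') ≤ |⟪v, x⟫| := by
  set θ := InnerProductGeometry.angle w w' with hθ
  have hs : 0 < Real.sin θ := Real.sin_pos_of_pos_of_lt_pi hθ0 (by linarith [Real.pi_pos])
  have hinner : ⟪w', w⟫ = Real.cos θ := by
    rw [real_inner_comm, hθ, InnerProductGeometry.cos_angle, hw, hw']
    simp
  have hnorm : ‖w' - Real.cos θ • w‖ = Real.sin θ := by
    rw [← sq_eq_sq₀ (norm_nonneg _) hs.le, norm_sub_sq_real, inner_smul_right, norm_smul,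
      hinner, hw, hw', Real.norm_eq_abs, mul_one, sq_abs, Real.sin_sq]
    ring
  refine ⟨(Real.sin θ)⁻¹ • (w' - Real.cos θ • w), ?_, ?_, ?_, ?_⟩
  · exact Submodule.smul_mem _ _ (Submodule.sub_mem _
      (Submodule.subset_span (by simp))
      (Submodule.smul_mem _ _ (Submodule.subset_span (by simp))))
  · rw [norm_smul, hnorm, norm_inv, Real.norm_of_nonneg hs.le, inv_mul_cancel₀ hs.ne']
  · rw [real_inner_smul_left, inner_sub_left, real_inner_smul_left, hinner,
      real_inner_self_eq_norm_sq, hw]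
    ring
  · rw [real_inner_smul_left, inner_sub_left, real_inner_smul_left, abs_mul,
      abs_of_pos (inv_pos.mpr hs), Real.tan_eq_sin_div_cos, div_div_eq_mul_div,
      div_eq_inv_mul, mul_comm |_| (Real.cos θ)]
    exact mul_le_mul_of_nonneg_left (mul_abs_le_abs_sub_mul_of_sgn_ne hx)
      (inv_pos.mpr hs).le
end

section
/- Let w, w* be unit vectors in ℝ^d with θ = ∠(w,w*) ∈ (0, π/2), and let v be a unit vector in span(w,w*) with ⟨v,w⟩ = 0 and ⟨v,w*⟩ < 0. Let σ > 0 and α ≥ σ/(2 tan θ). Then every x ∈ ℝ^d satisfying |⟨w,x⟩| ≤ σ/6 and |⟨v,x⟩| ≥ α satisfies ⟨v,x⟩ · ⟨w*,x⟩ < 0. -/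
open scoped RealInnerProductSpace

/-- Region inclusion (region `A₁`): let `w, w*` be unit vectors at angle
`θ ∈ (0, π/2)`, and let `v` be a unit vector in `span(w,w*)` with `⟨v,w⟩ = 0` and
`⟨v,w*⟩ < 0`. If `σ > 0` and `α ≥ σ/(2 tan θ)`, then every `x` with `|⟨w,x⟩| ≤ σ/6`
and `|⟨v,x⟩| ≥ α` satisfies `⟨v,x⟩·⟨w*,x⟩ < 0`. -/
theorem band_large_component_in_disagreement_region
    (d : ℕ) (w wstar v x : EuclideanSpace ℝ (Fin d))
    (hw : ‖w‖ = 1) (hwstar : ‖wstar‖ = 1)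
    (hθ0 : 0 < InnerProductGeometry.angle w wstar)
    (hθ1 : InnerProductGeometry.angle w wstar < Real.pi / 2)
    (hv : ‖v‖ = 1) (hvspan : v ∈ Submodule.span ℝ {w, wstar})
    (hvw : ⟪v, w⟫ = 0) (hvws : ⟪v, wstar⟫ < 0)
    (σ α : ℝ) (hσ : 0 < σ)
    (hα : σ / (2 * Real.tan (InnerProductGeometry.angle w wstar)) ≤ α)
    (hxw : |⟪w, x⟫| ≤ σ / 6) (hxv : α ≤ |⟪v, x⟫|) :
    ⟪v, x⟫ * ⟪wstar, x⟫ < 0 := by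
  set θ := InnerProductGeometry.angle w wstar with hθ
  have hc : 0 < Real.cos θ := Real.cos_pos_of_mem_Ioo ⟨by linarith, hθ1⟩
  have hs : 0 < Real.sin θ := Real.sin_pos_of_pos_of_lt_pi hθ0 (by linarith [Real.pi_pos])
  have hws : ⟪w, wstar⟫ = Real.cos θ := by
    rw [hθ, InnerProductGeometry.cos_angle, hw, hwstar]; simp
  have hww : ⟪w, w⟫ = 1 := by rw [real_inner_self_eq_norm_sq, hw]; norm_num
  have hss : ⟪wstar, wstar⟫ = 1 := by rw [real_inner_self_eq_norm_sq, hwstar]; norm_num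
  have hvv : ⟪v, v⟫ = 1 := by rw [real_inner_self_eq_norm_sq, hv]; norm_num
  have hsc := Real.sin_sq_add_cos_sq θ
  obtain ⟨a, b, hab⟩ := Submodule.mem_span_pair.mp hvspan
  have hexp (y : EuclideanSpace ℝ (Fin d)) : ⟪v, y⟫ = a * ⟪w, y⟫ + b * ⟪wstar, y⟫ := by
    rw [← hab, inner_add_left, real_inner_smul_left, real_inner_smul_left]
  have ha : a = -(b * Real.cos θ) := by
    have h := hexp w
    rw [hvw, hww, real_inner_comm, hws] at h
    linarith
  have hvws_eq : ⟪v, wstar⟫ = b * Real.sin θ ^ 2 := by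
    rw [hexp wstar, hws, hss, ha]
    linear_combination -b * hsc
  have hbs : b * Real.sin θ = -1 := by
    have hneg : b * Real.sin θ < 0 := by
      rw [hvws_eq] at hvws
      nlinarith
    have hsq : (b * Real.sin θ) ^ 2 = 1 := by
      have h := hexp v
      rw [hvv, real_inner_comm, hvw, real_inner_comm, hvws_eq] at h
      linarith
    nlinarith
  have hx : ⟪wstar, x⟫ = Real.cos θ * ⟪w, x⟫ - Real.sin θ * ⟪v, x⟫ := by
    rw [hexp x, ha]
    linear_combination (⟪wstar, x⟫ - Real.cos θ * ⟪w, x⟫) * hbs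
  have hq : σ * Real.cos θ / 2 ≤ Real.sin θ * |⟪v, x⟫| := by
    have h := mul_le_mul_of_nonneg_left (hα.trans hxv) hs.le
    have heq : Real.sin θ * (σ / (2 * Real.tan θ)) = σ * Real.cos θ / 2 := by
      rw [Real.tan_eq_sin_div_cos]
      field_simp
    rwa [heq] at h
  have hp : Real.cos θ * |⟪w, x⟫| < Real.sin θ * |⟪v, x⟫| := by
    nlinarith [mul_pos hσ hc]
  have hq_pos : 0 < |⟪v, x⟫| := by
    by_contra! h
    nlinarith [mul_pos hσ hc]
  calc ⟪v, x⟫ * ⟪wstar, x⟫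
      = Real.cos θ * (⟪v, x⟫ * ⟪w, x⟫) - Real.sin θ * |⟪v, x⟫| ^ 2 := by
        rw [hx, sq_abs]; ring
    _ ≤ Real.cos θ * (|⟪v, x⟫| * |⟪w, x⟫|) - Real.sin θ * |⟪v, x⟫| ^ 2 := by
        rw [← abs_mul]; gcongr; exact le_abs_self _
    _ = |⟪v, x⟫| * (Real.cos θ * |⟪w, x⟫| - Real.sin θ * |⟪v, x⟫|) := by ring
    _ < 0 := mul_neg_of_pos_of_neg hq_pos (by linarith)
end

section
/- Let w, w* be unit vectors in ℝ^d with θ = ∠(w,w*) ∈ (0, π/2), and let v be a unit vector in span(w,w*) with ⟨v,w⟩ = 0 and ⟨v,w*⟩ < 0. Let σ > 0. Then every x ∈ ℝ^d satisfying |⟨w,x⟩| ≤ σ/2 and ⟨v,x⟩ · ⟨w*,x⟩ ≥ 0 satisfies |⟨v,x⟩| ≤ σ/(2 tan θ). -/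
open scoped RealInnerProductSpace

/-- Region inclusion (region `A₂`): let `w, w*` be unit vectors at angle
`θ ∈ (0, π/2)`, and let `v` be a unit vector in `span(w,w*)` with `⟨v,w⟩ = 0` and
`⟨v,w*⟩ < 0`. If `σ > 0`, then every `x` with `|⟨w,x⟩| ≤ σ/2` and
`⟨v,x⟩·⟨w*,x⟩ ≥ 0` satisfies `|⟨v,x⟩| ≤ σ/(2 tan θ)`. -/
theorem band_agreement_region_small_component
    (d : ℕ) (w wstar v x : EuclideanSpace ℝ (Fin d))
    (hw : ‖w‖ = 1) (hwstar : ‖wstar‖ = 1)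
    (hθ0 : 0 < InnerProductGeometry.angle w wstar)
    (hθ1 : InnerProductGeometry.angle w wstar < Real.pi / 2)
    (hv : ‖v‖ = 1) (hvspan : v ∈ Submodule.span ℝ {w, wstar})
    (hvw : ⟪v, w⟫ = 0) (hvws : ⟪v, wstar⟫ < 0)
    (σ : ℝ) (hσ : 0 < σ)
    (hxw : |⟪w, x⟫| ≤ σ / 2) (hxG : 0 ≤ ⟪v, x⟫ * ⟪wstar, x⟫) :
    |⟪v, x⟫| ≤ σ / (2 * Real.tan (InnerProductGeometry.angle w wstar)) := by
  set θ := InnerProductGeometry.angle w wstar with hθ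
  have hcos : ⟪w, wstar⟫ = Real.cos θ := by
    rw [hθ, InnerProductGeometry.cos_angle, hw, hwstar]; simp
  have hs : 0 < Real.sin θ := Real.sin_pos_of_pos_of_lt_pi hθ0 (by linarith)
  have hc : 0 < Real.cos θ := Real.cos_pos_of_mem_Ioo ⟨by linarith, hθ1⟩
  have hsc := Real.sin_sq_add_cos_sq θ
  obtain ⟨a, b, hab⟩ := Submodule.mem_span_pair.1 hvspan
  have inner_v (y : EuclideanSpace ℝ (Fin d)) : ⟪v, y⟫ = a * ⟪w, y⟫ + b * ⟪wstar, y⟫ := by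
    rw [← hab, inner_add_left, real_inner_smul_left, real_inner_smul_left]
  have hvv : (1 : ℝ) = b * ⟪v, wstar⟫ := by
    have h := inner_v v
    rw [real_inner_self_eq_norm_sq, hv, real_inner_comm v w, hvw,
      real_inner_comm v wstar] at h
    linarith
  have ha : a = -(b * Real.cos θ) := by
    have h := inner_v w
    rw [hvw, real_inner_self_eq_norm_sq, hw, real_inner_comm w wstar, hcos] at h
    linarith
  have hm : ⟪v, wstar⟫ = b * Real.sin θ ^ 2 := by
    have h := inner_v wstar
    rw [real_inner_self_eq_norm_sq, hwstar, hcos, ha] at h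
    linear_combination h - b * hsc
  have hvsin : ⟪v, wstar⟫ = -Real.sin θ := by
    have hsq : ⟪v, wstar⟫ ^ 2 = Real.sin θ ^ 2 := by
      linear_combination ⟪v, wstar⟫ * hm - Real.sin θ ^ 2 * hvv
    rcases sq_eq_sq_iff_eq_or_eq_neg.1 hsq with h | h <;> linarith
  have hx : ⟪wstar, x⟫ = Real.cos θ * ⟪w, x⟫ - Real.sin θ * ⟪v, x⟫ := by
    have h := inner_v x
    rw [hvsin] at hvv
    rw [ha] at h
    linear_combination (⟪wstar, x⟫ - Real.cos θ * ⟪w, x⟫) * hvv + Real.sin θ * h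
  have hbound : Real.sin θ * |⟪v, x⟫| ≤ Real.cos θ * (σ / 2) := by
    rcases (abs_nonneg ⟪v, x⟫).eq_or_lt with h0 | h0
    · rw [← h0]; simp; positivity
    · refine le_of_mul_le_mul_left ?_ h0
      calc |⟪v, x⟫| * (Real.sin θ * |⟪v, x⟫|) = Real.sin θ * ⟪v, x⟫ ^ 2 := by
            rw [← sq_abs ⟪v, x⟫]; ring
        _ ≤ Real.cos θ * (⟪v, x⟫ * ⟪w, x⟫) := by rw [hx] at hxG; linarith
        _ ≤ Real.cos θ * (|⟪v, x⟫| * |⟪w, x⟫|) := by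
            rw [← abs_mul]; gcongr; exact le_abs_self _
        _ ≤ Real.cos θ * (|⟪v, x⟫| * (σ / 2)) := by gcongr
        _ = |⟪v, x⟫| * (Real.cos θ * (σ / 2)) := by ring
  rw [Real.tan_eq_sin_div_cos, le_div_iff₀ (by positivity)]
  calc |⟪v, x⟫| * (2 * (Real.sin θ / Real.cos θ))
      = 2 * (Real.sin θ * |⟪v, x⟫|) / Real.cos θ := by ring
    _ ≤ σ := by rw [div_le_iff₀ hc]; linarith
end

section
/- Let D be a finitely supported probability distribution on ℝ^d × {−1, 1}, let w* be a unit vector, and let opt = P_{(x,y)∼D}[y ≠ sign(⟨w*,x⟩)]. Let σ > 0, C₀ ≥ 1, and let ℓ : ℝ → [0,1] be continuously differentiable with: ℓ(t) = 1/2 + t/σ on [−σ/6, σ/6]; ℓ(t) = 1 for t > σ/2 and ℓ(t) = 0 for t < −σ/2; ℓ'(t) ∈ [0, C₀/σ] and ℓ'(−t) = ℓ'(t) for all t. Define L(u) = E_{(x,y)∼D}[ℓ(−y·⟨u,x⟩/‖u‖)] for u ≠ 0. Let w be a unit vector with θ = ∠(w,w*) ∈ (0, π/2), let v be the unit vector in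 span(w,w*) with ⟨v,w⟩ = 0 and ⟨v,w*⟩ < 0, and let α ≥ σ/(2 tan θ). Then the gradient of L at w satisfies ‖∇L(w)‖ ≥ (α/σ)·P_{(x,y)∼D}[|⟨v,x⟩| ≥ α and |⟨w,x⟩| ≤ σ/6] − (C₀/(2 tan θ))·P_{(x,y)∼D}[|⟨w,x⟩| ≤ σ/2] − (2C₀/σ)·√opt · √(E_{(x,y)∼D}[⟨v,x⟩² · 1{|⟨w,x⟩| ≤ σ/2}]). -/
open MeasureTheory
open scoped RealInnerProductSpace ENNReal

section FinitelySupported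

variable {X : Type*} [MeasurableSpace X] [MeasurableSingletonClass X]
  {μ : Measure X} [IsFiniteMeasure μ] {s : Finset X}

theorem integral_eq_sum_of_measure_compl_eq_zero (hs : μ ((↑s : Set X)ᶜ) = 0) (f : X → ℝ) :
    ∫ x, f x ∂μ = ∑ x ∈ s, μ.real {x} * f x := by
  have h := setIntegral_finset (μ := μ) (f := f) s IntegrableOn.finset
  have hr : μ.restrict (↑s : Set X) = μ :=
    Measure.restrict_eq_self_of_ae_mem (mem_ae_iff.2 hs)
  rwa [hr] at h

theorem measureReal_eq_sum_of_measure_compl_eq_zero (hs : μ ((↑s : Set X)ᶜ) = 0)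
    (P : X → Prop) [DecidablePred P] :
    μ.real {x | P x} = ∑ x ∈ s, μ.real {x} * (if P x then 1 else 0) := by
  have h : {x | P x} ∩ ↑s = ↑(s.filter P) := by ext x; simp [and_comm]
  rw [measureReal_def, ← measure_inter_conull hs, h, ← measureReal_def,
    ← sum_measureReal_singleton, Finset.sum_filter]
  simp

end FinitelySupported

section InnerProductSpace

variable {E : Type*} [NormedAddCommGroup E] [InnerProductSpace ℝ E]

theorem hasFDerivAt_norm_of_norm_eq_one {w : E} (hw : ‖w‖ = 1) :
    HasFDerivAt (fun u : E => ‖u‖) (innerSL ℝ w) w := by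
  have h := (hasStrictFDerivAt_norm_sq w).hasFDerivAt.sqrt (by simp [hw])
  simp only [Real.sqrt_sq (norm_nonneg _), hw] at h
  convert h using 1
  ext u
  simp

theorem hasFDerivAt_comp_mul_inner_div_norm {ℓ : ℝ → ℝ} (hℓ : Differentiable ℝ ℓ) {w : E}
    (hw : ‖w‖ = 1) (c : ℝ) (x : E) :
    HasFDerivAt (fun u : E => ℓ (c * ⟪u, x⟫ / ‖u‖))
      (deriv ℓ (c * ⟪w, x⟫) • (c • (innerSL ℝ x - ⟪w, x⟫ • innerSL ℝ w))) w := by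
  have h1 : HasFDerivAt (fun u : E => c * ⟪u, x⟫) (c • innerSL ℝ x) w := by
    simpa [real_inner_comm] using ((innerSL ℝ x).hasFDerivAt (x := w)).const_mul c
  have h2 := h1.mul ((hasDerivAt_inv (by simp [hw])).comp_hasFDerivAt w
    (hasFDerivAt_norm_of_norm_eq_one hw))
  have h3 := HasDerivAt.comp_hasFDerivAt w (hℓ _).hasDerivAt h2
  refine (h3.congr_fderiv ?_)
  ext u
  simp [hw]
  ring_nf

/-- In the plane spanned by unit vectors `w` and `z`, a unit vector `v ⟂ w` with `⟪v, z⟫ < 0`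
satisfies `z = cos θ • w - sin θ • v`, where `θ` is the angle between `w` and `z`. -/
theorem eq_cos_smul_sub_sin_smul {w z v : E} (hw : ‖w‖ = 1) (hz : ‖z‖ = 1) (hv : ‖v‖ = 1)
    (hspan : v ∈ Submodule.span ℝ {w, z}) (hvw : ⟪v, w⟫ = 0) (hvz : ⟪v, z⟫ < 0) :
    z = Real.cos (InnerProductGeometry.angle w z) • w
      - Real.sin (InnerProductGeometry.angle w z) • v := by
  obtain ⟨a, b, hab⟩ := Submodule.mem_span_pair.1 hspan
  have hc : Real.cos (InnerProductGeometry.angle w z) = ⟪w, z⟫ := by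
    simp [InnerProductGeometry.cos_angle, hw, hz]
  have hs0 := InnerProductGeometry.sin_angle_nonneg w z
  have hcs := Real.sin_sq_add_cos_sq (InnerProductGeometry.angle w z)
  have hww : ⟪w, w⟫ = 1 := by simp [hw]
  have hzz : ⟪z, z⟫ = 1 := by simp [hz]
  have hvv : ⟪v, v⟫ = 1 := by simp [hv]
  have h1 : a + b * ⟪w, z⟫ = 0 := by
    have h := hvw
    rw [← hab, inner_add_left, inner_smul_left, inner_smul_left, hww, real_inner_comm w z] at h
    simpa using h
  have h2 : b * ⟪v, z⟫ = 1 := by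
    have h := hvv
    nth_rw 2 [← hab] at h
    rw [inner_add_right, inner_smul_right, inner_smul_right, hvw] at h
    simpa using h
  have h3 : ⟪v, z⟫ = a * ⟪w, z⟫ + b := by
    rw [← hab, inner_add_left, inner_smul_left, inner_smul_left, hzz]
    simp
  have hsin : Real.sin (InnerProductGeometry.angle w z) = -⟪v, z⟫ := by
    rw [hc] at hcs
    have : ⟪v, z⟫ ^ 2 = 1 - ⟪w, z⟫ ^ 2 := by
      have : ⟪v, z⟫ = b * (1 - ⟪w, z⟫ ^ 2) := by rw [h3]; linear_combination ⟪w, z⟫ * h1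
      linear_combination ⟪v, z⟫ * this + (1 - ⟪w, z⟫ ^ 2) * h2
    have hsq : Real.sin (InnerProductGeometry.angle w z) ^ 2 = (-⟪v, z⟫) ^ 2 := by
      linear_combination hcs - this
    exact (pow_left_inj₀ hs0 (by linarith) two_ne_zero).1 hsq
  rw [hsin, hc, ← hab, smul_add, smul_smul, smul_smul, hab, neg_mul, neg_mul]
  have h4 : ⟪v, z⟫ * a = -⟪w, z⟫ := by linear_combination ⟪v, z⟫ * h1 - ⟪w, z⟫ * h2
  have h5 : ⟪v, z⟫ * b = 1 := by linarith
  rw [h4, h5]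
  module

end InnerProductSpace

section Ramp

variable {ℓ : ℝ → ℝ} {σ : ℝ}

theorem deriv_eq_zero_of_half_lt_abs (hone : ∀ t, σ / 2 < t → ℓ t = 1)
    (hzero : ∀ t, t < -σ / 2 → ℓ t = 0) {t : ℝ} (ht : σ / 2 < |t|) : deriv ℓ t = 0 := by
  rcases lt_abs.1 ht with h | h
  · have : ℓ =ᶠ[nhds t] fun _ => 1 := by
      filter_upwards [lt_mem_nhds h] with u hu using hone u hu
    rw [this.deriv_eq, deriv_const]
  · have : ℓ =ᶠ[nhds t] fun _ => 0 := by
      filter_upwards [gt_mem_nhds (show t < -σ / 2 by linarith)] with u hu using hzero u hu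
    rw [this.deriv_eq, deriv_const]

theorem deriv_eq_inv_of_abs_le (hσ : 0 < σ) (hℓ : Differentiable ℝ ℓ)
    (hmid : ∀ t ∈ Set.Icc (-σ / 6) (σ / 6), ℓ t = 1 / 2 + t / σ) {t : ℝ} (ht : |t| ≤ σ / 6) :
    deriv ℓ t = 1 / σ := by
  have hmem : t ∈ Set.Icc (-σ / 6) (σ / 6) := by
    have := abs_le.1 ht
    exact ⟨by linarith, this.2⟩
  have hud := uniqueDiffOn_Icc (show -σ / 6 < σ / 6 by linarith) t hmem
  have h : HasDerivWithinAt ℓ (1 / σ) (Set.Icc (-σ / 6) (σ / 6)) t :=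
    ((((hasDerivAt_id t).div_const σ).const_add (1 / 2)).hasDerivWithinAt).congr
      (fun u hu => hmid u hu) (hmid t hmem)
  exact hud.eq_deriv _ (hℓ t).hasDerivAt.hasDerivWithinAt h

end Ramp

theorem sgn_mul_self_nonneg (t : ℝ) : 0 ≤ sgn t * t := by
  unfold sgn; split_ifs <;> linarith

theorem sgn_eq_or (t : ℝ) : sgn t = 1 ∨ sgn t = -1 := by
  unfold sgn; split_ifs <;> simp

/-- With `z = c * a - k * b` the signed margin, `-sgn z * b` is at least `-|a| / (k / c)`, and it
is `|b|` as soon as `|b|` exceeds `|a| / (k / c)`. -/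
theorem neg_sgn_mul_bounds {a b c k : ℝ} (hc : 0 < c) (hk : 0 < k) :
    -(|a| / (k / c)) ≤ -sgn (c * a - k * b) * b ∧
      (|a| / (k / c) < |b| → -sgn (c * a - k * b) * b = |b|) := by
  have h0 := sgn_mul_self_nonneg (c * a - k * b)
  have h1 : -(|a| / (k / c)) ≤ -sgn (c * a - k * b) * b := by
    rw [div_div_eq_mul_div, ← neg_div, div_le_iff₀ hk]
    rcases sgn_eq_or (c * a - k * b) with hs | hs <;> rw [hs] at h0 ⊢ <;>
      nlinarith [neg_abs_le a, le_abs_self a]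
  refine ⟨h1, fun h => ?_⟩
  rcases sgn_eq_or (c * a - k * b) with hs | hs <;> rw [hs] at h1 ⊢ <;>
    rcases abs_cases b with hb | hb <;> linarith

/-- The pointwise lower bound whose expectation gives the gradient bound. -/
theorem neg_mul_slope_mul_ge {σ C₀ α a b c k g y : ℝ} (hσ : 0 < σ) (hC₀ : 1 ≤ C₀) (hc : 0 < c)
    (hk : 0 < k) (hα : σ / (2 * (k / c)) ≤ α) (hg0 : 0 ≤ g) (hg1 : g ≤ C₀ / σ)
    (hgmid : |a| ≤ σ / 6 → g = 1 / σ) (hgout : σ / 2 < |a| → g = 0) (hy : y = 1 ∨ y = -1) :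
    α / σ * (if α ≤ |b| ∧ |a| ≤ σ / 6 then 1 else 0)
        - C₀ / (2 * (k / c)) * (if |a| ≤ σ / 2 then 1 else 0)
        - 2 * C₀ / σ * (if y ≠ sgn (c * a - k * b) ∧ |a| ≤ σ / 2 then |b| else 0)
      ≤ g * (-y * b) := by
  obtain ⟨h1, h2⟩ := neg_sgn_mul_bounds (a := a) (b := b) hc hk
  set S := sgn (c * a - k * b)
  have hT : 0 < k / c := by positivity
  set T := k / c
  have hCσ : 0 < C₀ / σ := by positivity
  by_cases hB : |a| ≤ σ / 2
  swap
  · have hA : ¬ |a| ≤ σ / 6 := fun h => hB (by linarith)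
    simp [hB, hA, hgout (not_le.1 hB)]
  have hnoise : -(2 * C₀ / σ * (if y ≠ S ∧ |a| ≤ σ / 2 then |b| else 0)) ≤ g * ((S - y) * b) := by
    by_cases hyS : y = S
    · simp [hyS]
    · simp only [ne_eq, hyS, not_false_eq_true, hB, and_self, if_true]
      have hSy : |S - y| ≤ 2 := by
        rcases sgn_eq_or (c * a - k * b) with h | h <;> rcases hy with h' | h' <;>
          simp only [S, h, h'] <;> norm_num
      have : |g * ((S - y) * b)| ≤ C₀ / σ * (2 * |b|) := by
        rw [abs_mul, abs_mul, abs_of_nonneg hg0]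
        gcongr
      have h := (abs_le.1 this).1
      rw [show 2 * C₀ / σ * |b| = C₀ / σ * (2 * |b|) by ring]
      exact h
  have hclean : α / σ * (if α ≤ |b| ∧ |a| ≤ σ / 6 then 1 else 0) - C₀ / (2 * T)
      ≤ g * (-S * b) := by
    by_cases hA : α ≤ |b| ∧ |a| ≤ σ / 6
    · have hlt : |a| / T < |b| := by
        refine lt_of_lt_of_le ?_ (hα.trans hA.1)
        rw [div_lt_div_iff₀ hT (by positivity)]
        nlinarith [hA.2, mul_pos hσ hT]
      have hle : α / σ ≤ 1 / σ * |b| := by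
        rw [div_mul_eq_mul_div, one_mul]
        gcongr
        exact hA.1
      have : 0 < C₀ / (2 * T) := by positivity
      rw [if_pos hA, h2 hlt, hgmid hA.2]
      linarith
    · have ha : g * (|a| / T) ≤ C₀ / σ * (σ / 2 / T) := by gcongr
      have he : C₀ / σ * (σ / 2 / T) = C₀ / (2 * T) := by field_simp
      have := mul_le_mul_of_nonneg_left h1 hg0
      rw [if_neg hA]
      linarith
  rw [if_pos hB]
  linarith

/-- Structural gradient lower bound for the smoothed surrogate loss (agnostic case):
for a finitely supported labeled distribution `D` on `ℝ^d × {±1}`, opt the error of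
the halfspace with unit normal `w*`, a smoothed ramp `ℓ` of width `σ` with slope
bound `C₀/σ`, and a unit vector `w` at angle `θ ∈ (0, π/2)` from `w*`, with `v` the
unit vector in `span(w,w*)` orthogonal to `w` with `⟨v,w*⟩ < 0`, the gradient of the
surrogate loss `L(u) = E[ℓ(−y⟨u,x⟩/‖u‖)]` at `w` satisfies
`‖∇L(w)‖ ≥ (α/σ)·P[|⟨v,x⟩| ≥ α ∧ |⟨w,x⟩| ≤ σ/6] − (C₀/(2 tan θ))·P[|⟨w,x⟩| ≤ σ/2]
 − (2C₀/σ)·√opt·√(E[⟨v,x⟩²·1{|⟨w,x⟩| ≤ σ/2}])`. -/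
theorem surrogate_gradient_lower_bound_agnostic
    (d : ℕ)
    (D : Measure (EuclideanSpace ℝ (Fin d) × ℝ)) [IsProbabilityMeasure D]
    (hfin : ∃ s : Finset (EuclideanSpace ℝ (Fin d) × ℝ), D ((↑s : Set _)ᶜ) = 0)
    (hlabel : D {p | p.2 = 1 ∨ p.2 = -1}ᶜ = 0)
    (wstar : EuclideanSpace ℝ (Fin d)) (hwstar : ‖wstar‖ = 1)
    (σ C₀ : ℝ) (hσ : 0 < σ) (hC₀ : 1 ≤ C₀)
    (ℓ : ℝ → ℝ) (hℓC1 : ContDiff ℝ 1 ℓ)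
    (hℓ01 : ∀ t, ℓ t ∈ Set.Icc (0 : ℝ) 1)
    (hℓmid : ∀ t ∈ Set.Icc (-σ / 6) (σ / 6), ℓ t = 1 / 2 + t / σ)
    (hℓone : ∀ t, σ / 2 < t → ℓ t = 1)
    (hℓzero : ∀ t, t < -σ / 2 → ℓ t = 0)
    (hℓderiv : ∀ t, deriv ℓ t ∈ Set.Icc (0 : ℝ) (C₀ / σ))
    (hℓeven : ∀ t, deriv ℓ (-t) = deriv ℓ t)
    (w : EuclideanSpace ℝ (Fin d)) (hw : ‖w‖ = 1)
    (θ : ℝ) (hθ : θ = InnerProductGeometry.angle w wstar)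
    (hθ0 : 0 < θ) (hθ1 : θ < Real.pi / 2)
    (v : EuclideanSpace ℝ (Fin d)) (hv : ‖v‖ = 1)
    (hvspan : v ∈ Submodule.span ℝ {w, wstar})
    (hvw : ⟪v, w⟫ = 0) (hvws : ⟪v, wstar⟫ < 0)
    (α : ℝ) (hα : σ / (2 * Real.tan θ) ≤ α) :
    (α / σ) * (D {p | α ≤ |⟪v, p.1⟫| ∧ |⟪w, p.1⟫| ≤ σ / 6}).toReal
      - (C₀ / (2 * Real.tan θ)) * (D {p | |⟪w, p.1⟫| ≤ σ / 2}).toReal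
      - (2 * C₀ / σ) * Real.sqrt ((D {p | p.2 ≠ sgn ⟪wstar, p.1⟫}).toReal)
          * Real.sqrt (∫ p in {p : EuclideanSpace ℝ (Fin d) × ℝ | |⟪w, p.1⟫| ≤ σ / 2},
              ⟪v, p.1⟫ ^ 2 ∂D)
      ≤ ‖gradient (fun u => ∫ p, ℓ (-(p.2) * ⟪u, p.1⟫ / ‖u‖) ∂D) w‖ := by
  classical
  obtain ⟨s₀, hs₀⟩ := hfin
  set s := s₀.filter fun p => p.2 = 1 ∨ p.2 = -1 with hsdef
  have hs : D ((↑s : Set _)ᶜ) = 0 := by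
    have : (↑s : Set (EuclideanSpace ℝ (Fin d) × ℝ))ᶜ = (↑s₀)ᶜ ∪ {p | p.2 = 1 ∨ p.2 = -1}ᶜ := by
      rw [← Set.compl_inter]
      congr 1
      ext p
      simp [hsdef]
    rw [this]
    exact measure_union_null hs₀ hlabel
  have hy : ∀ p ∈ s, p.2 = 1 ∨ p.2 = -1 := fun p hp => (Finset.mem_filter.1 hp).2
  have hc : 0 < Real.cos θ := Real.cos_pos_of_mem_Ioo ⟨by linarith, hθ1⟩
  have hk : 0 < Real.sin θ := Real.sin_pos_of_pos_of_lt_pi hθ0 (by linarith)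
  have hmargin : ∀ x, ⟪wstar, x⟫ = Real.cos θ * ⟪w, x⟫ - Real.sin θ * ⟪v, x⟫ := by
    intro x
    have h := eq_cos_smul_sub_sin_smul hw hwstar hv hvspan hvw hvws
    rw [← hθ] at h
    nth_rw 1 [h]
    simp [inner_sub_left, inner_smul_left]
  have hℓ : Differentiable ℝ ℓ := hℓC1.differentiable one_ne_zero
  have hgrad : ⟪gradient (fun u => ∫ p, ℓ (-(p.2) * ⟪u, p.1⟫ / ‖u‖) ∂D) w, v⟫
      = ∑ p ∈ s, D.real {p} * (deriv ℓ ⟪w, p.1⟫ * (-p.2 * ⟪v, p.1⟫)) := by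
    simp only [integral_eq_sum_of_measure_compl_eq_zero hs]
    rw [inner_gradient_left, (HasFDerivAt.fun_sum fun p _ =>
      (hasFDerivAt_comp_mul_inner_div_norm hℓ hw (-p.2) p.1).const_mul (D.real {p})).fderiv,
      sum_apply]
    refine Finset.sum_congr rfl fun p hp => ?_
    have heven : deriv ℓ (-p.2 * ⟪w, p.1⟫) = deriv ℓ ⟪w, p.1⟫ := by
      rcases hy p hp with h | h <;> simp [h, hℓeven]
    simp only [smul_apply, sub_apply, innerSL_apply_apply, smul_eq_mul, heven,
      real_inner_comm v, hvw]
    ring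
  have hnorm : ⟪gradient (fun u => ∫ p, ℓ (-(p.2) * ⟪u, p.1⟫ / ‖u‖) ∂D) w, v⟫
      ≤ ‖gradient (fun u => ∫ p, ℓ (-(p.2) * ⟪u, p.1⟫ / ‖u‖) ∂D) w‖ := by
    simpa [hv] using real_inner_le_norm
      (gradient (fun u => ∫ p, ℓ (-(p.2) * ⟪u, p.1⟫ / ‖u‖) ∂D) w) v
  refine le_trans ?_ hnorm
  rw [hgrad]
  have hB : MeasurableSet {p : EuclideanSpace ℝ (Fin d) × ℝ | |⟪w, p.1⟫| ≤ σ / 2} :=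
    (isClosed_le (by fun_prop) continuous_const).measurableSet
  simp only [← measureReal_def]
  rw [← integral_indicator hB, integral_eq_sum_of_measure_compl_eq_zero hs]
  rw [measureReal_eq_sum_of_measure_compl_eq_zero hs,
    measureReal_eq_sum_of_measure_compl_eq_zero hs,
    measureReal_eq_sum_of_measure_compl_eq_zero hs]
  simp only [hmargin, Set.indicator_apply, Set.mem_ofPred_eq, Real.tan_eq_sin_div_cos] at hα ⊢
  have hCS : ∑ p ∈ s, D.real {p} * (if p.2 ≠ sgn (Real.cos θ * ⟪w, p.1⟫ - Real.sin θ * ⟪v, p.1⟫)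
        ∧ |⟪w, p.1⟫| ≤ σ / 2 then |⟪v, p.1⟫| else 0)
      ≤ √(∑ p ∈ s, D.real {p} *
          (if p.2 ≠ sgn (Real.cos θ * ⟪w, p.1⟫ - Real.sin θ * ⟪v, p.1⟫) then 1 else 0))
        * √(∑ p ∈ s, D.real {p} * (if |⟪w, p.1⟫| ≤ σ / 2 then ⟪v, p.1⟫ ^ 2 else 0)) := by
    refine le_trans (le_of_eq (Finset.sum_congr rfl fun p _ => ?_))
      (Real.sum_sqrt_mul_sqrt_le s (fun p => ?_) (fun p => ?_))
    · have hm : (0 : ℝ) ≤ D.real {p} := measureReal_nonneg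
      rw [Real.sqrt_mul hm, Real.sqrt_mul hm, mul_mul_mul_comm, Real.mul_self_sqrt hm]
      congr 1
      split_ifs <;> simp_all [Real.sqrt_sq_eq_abs]
    · positivity
    · positivity
  refine le_trans ?_ (Finset.sum_le_sum fun p hp => mul_le_mul_of_nonneg_left
    (neg_mul_slope_mul_ge hσ hC₀ hc hk hα (hℓderiv ⟪w, p.1⟫).1 (hℓderiv ⟪w, p.1⟫).2
      (deriv_eq_inv_of_abs_le hσ hℓ hℓmid) (deriv_eq_zero_of_half_lt_abs hℓone hℓzero) (hy p hp))
    (measureReal_nonneg (μ := D) (s := {p})))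
  simp only [mul_sub, Finset.sum_sub_distrib, mul_left_comm (D.real _), ← Finset.mul_sum]
  have := mul_le_mul_of_nonneg_left hCS (show 0 ≤ 2 * C₀ / σ by positivity)
  rw [mul_assoc (2 * C₀ / σ)]
  linarith
end
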